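/- arXiv:2005.00303 — 4 statements merged into one kernel-verified Lean document; each statement's English description precedes it below -/
import Mathlib

section
/- Let N ≥ 2, let 1 ≤ p < N and set p* = Np/(N−p), let p ≤ q < p*, and let r > 0. Let (u_n) be a sequence of locally integrable functions u_n : ℝ^N → ℝ, each having a weak gradient g_n : ℝ^N → ℝ^N, such that sup_n ( ∫_{ℝ^N} |u_n|^p dx + ∫_{ℝ^N} ‖g_n‖^p dx ) < ∞ and lim_{n→∞} sup_{y ∈ ℝ^N} ∫_{B_r(y)} |u_n|^q dx = 0. Then for every t with p < t < p*, one has ∫_{ℝ^N} |u_n|^t dx → 0 as n → ∞. -/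
open MeasureTheory Filter Topology ENNReal

noncomputable section

/-- A locally integrable function `u : ℝ^N → ℝ` has weak gradient `g : ℝ^N → ℝ^N` if for
every compactly supported smooth test function `φ` and every coordinate `i`,
`∫ u ∂φ/∂xᵢ = -∫ gᵢ φ`. -/
def HasWeakGradient {N : ℕ} (u : EuclideanSpace ℝ (Fin N) → ℝ)
    (g : EuclideanSpace ℝ (Fin N) → EuclideanSpace ℝ (Fin N)) : Prop :=
  LocallyIntegrable u volume ∧ LocallyIntegrable g volume ∧
  ∀ φ : EuclideanSpace ℝ (Fin N) → ℝ, ContDiff ℝ (⊤ : ℕ∞) φ → HasCompactSupport φ →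
    ∀ i : Fin N,
      (∫ x, u x * fderiv ℝ φ x (EuclideanSpace.single i 1)) =
        - ∫ x, g x i * φ x


/-- **Interpolation**: log-convexity of `s ↦ ∫ f ^ s`. -/
theorem lintegral_rpow_interpolate {α : Type*} [MeasurableSpace α] {μ : Measure α}
    {f : α → ℝ≥0∞} (hf : AEMeasurable f μ) {a b l : ℝ} (ha : 0 ≤ a) (hb : 0 ≤ b)
    (hl0 : 0 ≤ l) (hl1 : l ≤ 1) :
    ∫⁻ x, f x ^ ((1 - l) * a + l * b) ∂μ
      ≤ (∫⁻ x, f x ^ a ∂μ) ^ (1 - l) * (∫⁻ x, f x ^ b ∂μ) ^ l := by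
  have h := ENNReal.lintegral_mul_norm_pow_le (hf.pow_const a) (hf.pow_const b)
    (sub_nonneg.2 hl1) hl0 (sub_add_cancel 1 l)
  refine le_trans (le_of_eq (lintegral_congr fun x => ?_)) h
  rw [← ENNReal.rpow_mul, ← ENNReal.rpow_mul, ← ENNReal.rpow_add_of_nonneg, mul_comm a,
    mul_comm b]
  · exact mul_nonneg ha (sub_nonneg.2 hl1)
  · exact mul_nonneg hb hl0

section Smooth

variable {E : Type*} [NormedAddCommGroup E] [InnerProductSpace ℝ E] [FiniteDimensional ℝ E]

theorem exists_cutoff {R : ℝ} (hR : 0 < R) :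
    ∃ M : ℝ≥0∞, M ≠ ⊤ ∧ ∀ y : E, ∃ χ : E → ℝ, ContDiff ℝ 1 χ ∧ HasCompactSupport χ ∧
      tsupport χ ⊆ Metric.ball y (3 * R) ∧ (∀ x ∈ Metric.ball y R, χ x = 1) ∧
      (∀ x, ‖χ x‖ₑ ≤ 1) ∧ ∀ x, ‖fderiv ℝ χ x‖ₑ ≤ M := by
  let b : ContDiffBump (0 : E) := ⟨R, 2 * R, hR, by linarith⟩
  have hb : ContDiff ℝ 1 b := b.contDiff
  obtain ⟨M, hM⟩ := (hb.continuous_fderiv one_ne_zero).bounded_above_of_compact_support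
    (b.hasCompactSupport.fderiv ℝ)
  refine ⟨ENNReal.ofReal M, ENNReal.ofReal_ne_top, fun y => ⟨fun x => b (x - y),
    hb.comp (contDiff_id.sub contDiff_const), ?_, ?_, fun x hx => ?_, fun x => ?_, fun x => ?_⟩⟩
  · exact b.hasCompactSupport.comp_homeomorph (Homeomorph.subRight y)
  · have : tsupport (fun x => b (x - y)) ⊆ Metric.closedBall y (2 * R) := by
      refine closure_minimal (fun x hx => ?_) Metric.isClosed_closedBall
      have : x - y ∈ Function.support b := hx
      rw [b.support_eq] at this
      have h2 : ‖x - y‖ < 2 * R := by simpa using this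
      rw [Metric.mem_closedBall, dist_eq_norm]
      exact h2.le
    exact this.trans (Metric.closedBall_subset_ball (by linarith))
  · refine b.one_of_mem_closedBall ?_
    rw [Metric.mem_ball, dist_eq_norm] at hx
    simpa using hx.le
  · rw [Real.enorm_eq_ofReal b.nonneg]
    exact ENNReal.ofReal_le_one.2 b.le_one
  · rw [fderiv_comp_sub, ← ofReal_norm]
    exact ENNReal.ofReal_le_ofReal (hM _)

variable [MeasurableSpace E] [BorelSpace E]

theorem lintegral_lintegral_ball {F : E → ℝ≥0∞} (hF : Measurable F) (R : ℝ) :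
    ∫⁻ y : E, ∫⁻ x in Metric.ball y R, F x = volume (Metric.ball (0 : E) R) * ∫⁻ x, F x := by
  have hS : MeasurableSet {z : E × E | dist z.2 z.1 < R} :=
    (isOpen_lt (by fun_prop) continuous_const).measurableSet
  calc ∫⁻ y : E, ∫⁻ x in Metric.ball y R, F x
      = ∫⁻ y : E, ∫⁻ x, {z : E × E | dist z.2 z.1 < R}.indicator (fun z => F z.2) (y, x) := by
        refine lintegral_congr fun y => ?_
        rw [← lintegral_indicator measurableSet_ball]
        rfl
    _ = ∫⁻ x, ∫⁻ y : E, {z : E × E | dist z.2 z.1 < R}.indicator (fun z => F z.2) (y, x) := by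
        refine lintegral_lintegral_swap (Measurable.aemeasurable ?_)
        exact (hF.comp measurable_snd).indicator hS
    _ = ∫⁻ x, F x * volume (Metric.ball (0 : E) R) := by
        refine lintegral_congr fun x => ?_
        rw [← Measure.addHaar_ball_center volume x R, ← setLIntegral_const,
          ← lintegral_indicator measurableSet_ball]
        refine lintegral_congr fun y => ?_
        simp [Set.indicator, dist_comm]
    _ = _ := by rw [lintegral_mul_const _ hF, mul_comm]

theorem eLpNorm_toNNReal_rpow {α G : Type*} [MeasurableSpace α] {μ : Measure α}
    [NormedAddCommGroup G] (f : α → G) {p : ℝ} (hp : 0 < p) :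
    eLpNorm f (p.toNNReal : ℝ≥0∞) μ ^ p = ∫⁻ x, ‖f x‖ₑ ^ p ∂μ := by
  have := eLpNorm_nnreal_pow_eq_lintegral (μ := μ) (f := f) (p := p.toNNReal)
    (by simpa using hp)
  simpa [Real.coe_toNNReal p hp.le] using this

/-- Gagliardo–Nirenberg–Sobolev in integral form. -/
theorem lintegral_rpow_le_lintegral_fderiv_rpow {p P : ℝ} (hp : 1 ≤ p) (hP : 0 < P)
    (hE : 0 < Module.finrank ℝ E) (hpP : P⁻¹ = p⁻¹ - (Module.finrank ℝ E : ℝ)⁻¹) :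
    ∃ C : ℝ≥0∞, C ≠ ⊤ ∧ ∀ v : E → ℝ, ContDiff ℝ 1 v → HasCompactSupport v →
      ∫⁻ x, ‖v x‖ₑ ^ P ≤ C * (∫⁻ x, ‖fderiv ℝ v x‖ₑ ^ p) ^ (P / p) := by
  have hp0 : 0 < p := by linarith
  refine ⟨(SNormLESNormFDerivOfEqConst ℝ (volume : Measure E) p.toNNReal : ℝ≥0∞) ^ P,
    ENNReal.rpow_ne_top_of_nonneg hP.le ENNReal.coe_ne_top, fun v hv hvc => ?_⟩
  have h := eLpNorm_le_eLpNorm_fderiv_of_eq (volume : Measure E) hv hvc (p := p.toNNReal)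
    (p' := P.toNNReal) (by simpa using hp) hE
    (by rw [NNReal.coe_inv, Real.coe_toNNReal _ hp0.le, Real.coe_toNNReal _ hP.le, hpP])
  rw [← eLpNorm_toNNReal_rpow v hP, ← eLpNorm_toNNReal_rpow (fderiv ℝ v) hp0, ← ENNReal.rpow_mul,
    mul_div_cancel₀ _ hp0.ne', ← ENNReal.mul_rpow_of_nonneg _ _ hP.le]
  gcongr

theorem local_sobolev {p P R : ℝ} (hp : 1 ≤ p) (hP : 0 < P) (hR : 0 < R)
    (hE : 0 < Module.finrank ℝ E) (hpP : P⁻¹ = p⁻¹ - (Module.finrank ℝ E : ℝ)⁻¹) :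
    ∃ C : ℝ≥0∞, C ≠ ⊤ ∧ ∀ w : E → ℝ, ContDiff ℝ 1 w → ∀ y : E,
      ∫⁻ x in Metric.ball y R, ‖w x‖ₑ ^ P ≤
        C * (∫⁻ x in Metric.ball y (3 * R), (‖w x‖ₑ ^ p + ‖fderiv ℝ w x‖ₑ ^ p)) ^ (P / p) := by
  have hp0 : 0 < p := by linarith
  obtain ⟨C, hC, hS⟩ := lintegral_rpow_le_lintegral_fderiv_rpow hp hP hE hpP
  obtain ⟨M, hM, hcut⟩ := exists_cutoff (E := E) hR
  set D : ℝ≥0∞ := (1 + M) ^ p * 2 ^ (p - 1) with hD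
  have hDt : D ≠ ⊤ := ENNReal.mul_ne_top
    (ENNReal.rpow_ne_top_of_nonneg hp0.le (by simp [hM]))
    (ENNReal.rpow_ne_top_of_nonneg (by linarith) (by simp))
  refine ⟨C * D ^ (P / p), ENNReal.mul_ne_top hC
    (ENNReal.rpow_ne_top_of_nonneg (by positivity) hDt), fun w hw y => ?_⟩
  obtain ⟨χ, hχ, hχc, hχs, hχ1, hχle, hχd⟩ := hcut y
  have hv : ContDiff ℝ 1 (fun x => χ x * w x) := hχ.mul hw
  have hvc : HasCompactSupport (fun x => χ x * w x) := hχc.mul_right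
  have hpt : ∀ x, ‖fderiv ℝ (fun x => χ x * w x) x‖ₑ ^ p ≤
      (Metric.ball y (3 * R)).indicator
        (fun x => D * (‖w x‖ₑ ^ p + ‖fderiv ℝ w x‖ₑ ^ p)) x := by
    intro x
    by_cases hx : x ∈ Metric.ball y (3 * R)
    · rw [Set.indicator_of_mem hx, fderiv_fun_mul (hχ.differentiable one_ne_zero x)
        (hw.differentiable one_ne_zero x), hD, mul_assoc]
      calc ‖χ x • fderiv ℝ w x + w x • fderiv ℝ χ x‖ₑ ^ p
          ≤ ((1 + M) * (‖w x‖ₑ + ‖fderiv ℝ w x‖ₑ)) ^ p := by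
            gcongr
            calc ‖χ x • fderiv ℝ w x + w x • fderiv ℝ χ x‖ₑ
                ≤ ‖χ x‖ₑ * ‖fderiv ℝ w x‖ₑ + ‖w x‖ₑ * ‖fderiv ℝ χ x‖ₑ := by
                  refine (enorm_add_le (E := E →L[ℝ] ℝ) _ _).trans ?_
                  rw [enorm_smul, enorm_smul]
              _ ≤ 1 * ‖fderiv ℝ w x‖ₑ + ‖w x‖ₑ * M := by
                  gcongr
                  · exact hχle x
                  · exact hχd x
              _ ≤ (1 + M) * ‖fderiv ℝ w x‖ₑ + ‖w x‖ₑ * (1 + M) := by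
                  gcongr
                  · exact le_self_add
                  · exact le_add_self
              _ = _ := by ring
        _ ≤ _ := by
            rw [ENNReal.mul_rpow_of_nonneg _ _ hp0.le]
            gcongr
            exact ENNReal.rpow_add_le_mul_rpow_add_rpow _ _ hp
    · have : x ∉ tsupport (fun x => χ x * w x) := fun h =>
        hx (hχs (closure_mono (Function.support_mul_subset_left χ w) h))
      rw [fderiv_of_notMem_tsupport _ this, ← ofReal_norm]
      simp [hp0]
  calc ∫⁻ x in Metric.ball y R, ‖w x‖ₑ ^ P
      = ∫⁻ x in Metric.ball y R, ‖χ x * w x‖ₑ ^ P := by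
        refine setLIntegral_congr_fun measurableSet_ball fun x hx => ?_
        simp only [hχ1 x hx, one_mul]
    _ ≤ ∫⁻ x, ‖χ x * w x‖ₑ ^ P := setLIntegral_le_lintegral _ _
    _ ≤ C * (∫⁻ x, ‖fderiv ℝ (fun x => χ x * w x) x‖ₑ ^ p) ^ (P / p) := hS _ hv hvc
    _ ≤ C * (D * ∫⁻ x in Metric.ball y (3 * R), (‖w x‖ₑ ^ p + ‖fderiv ℝ w x‖ₑ ^ p)) ^ (P / p) := by
        gcongr
        refine (lintegral_mono hpt).trans ?_
        rw [lintegral_indicator measurableSet_ball, lintegral_const_mul' _ _ hDt]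
    _ = _ := by rw [ENNReal.mul_rpow_of_nonneg _ _ (by positivity), mul_assoc]

/-- Lions' inequality for smooth functions. -/
theorem lions_inequality_of_contDiff {p q P R l : ℝ} (hp : 1 ≤ p) (hq : 0 ≤ q) (hP : 0 < P)
    (hR : 0 < R) (hE : 0 < Module.finrank ℝ E)
    (hpP : P⁻¹ = p⁻¹ - (Module.finrank ℝ E : ℝ)⁻¹) (hl : p / P ≤ l) (hl1 : l ≤ 1) :
    ∃ C : ℝ≥0∞, C ≠ ⊤ ∧ ∀ w : E → ℝ, ContDiff ℝ 1 w → ∀ η K : ℝ≥0∞,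
      (∀ y : E, ∫⁻ x in Metric.ball y R, ‖w x‖ₑ ^ q ≤ η) →
      (∫⁻ x, ‖w x‖ₑ ^ p) + (∫⁻ x, ‖fderiv ℝ w x‖ₑ ^ p) ≤ K →
      ∫⁻ x, ‖w x‖ₑ ^ ((1 - l) * q + l * P) ≤ C * η ^ (1 - l) * K ^ (l * P / p) := by
  have hp0 : 0 < p := by linarith
  have hl0 : 0 ≤ l := (by positivity : 0 ≤ p / P).trans hl
  have hκ : 1 ≤ l * P / p := by
    rw [div_le_iff₀ hP] at hl
    rwa [one_le_div hp0]
  obtain ⟨C, hC, hS⟩ := local_sobolev hp hP hR hE hpP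
  set V := volume (Metric.ball (0 : E) R)
  set V' := volume (Metric.ball (0 : E) (3 * R))
  have hV0 : V ≠ 0 := (Metric.measure_ball_pos volume 0 hR).ne'
  have hVt : V ≠ ⊤ := measure_ball_lt_top.ne
  have hVt' : V' ≠ ⊤ := measure_ball_lt_top.ne
  refine ⟨V⁻¹ * (C ^ l * V'), ENNReal.mul_ne_top (ENNReal.inv_ne_top.2 hV0)
    (ENNReal.mul_ne_top (ENNReal.rpow_ne_top_of_nonneg hl0 hC) hVt'), fun w hw η K hη hK => ?_⟩
  have hwm : Measurable fun x => ‖w x‖ₑ := hw.continuous.enorm.measurable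
  have hdm : Measurable fun x => ‖fderiv ℝ w x‖ₑ :=
    (hw.continuous_fderiv one_ne_zero).enorm.measurable
  set F : E → ℝ≥0∞ := fun x => ‖w x‖ₑ ^ p + ‖fderiv ℝ w x‖ₑ ^ p with hF
  have hFm : Measurable F := (hwm.pow_const p).add (hdm.pow_const p)
  have hFK : ∫⁻ x, F x ≤ K := by
    rw [hF, lintegral_add_left (hwm.pow_const p)]
    exact hK
  have hloc : ∀ y : E, ∫⁻ x in Metric.ball y R, ‖w x‖ₑ ^ ((1 - l) * q + l * P) ≤
      η ^ (1 - l) * C ^ l * K ^ (l * P / p - 1) * ∫⁻ x in Metric.ball y (3 * R), F x := by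
    intro y
    set X := ∫⁻ x in Metric.ball y (3 * R), F x
    have hX : X ≤ K := (setLIntegral_le_lintegral _ _).trans hFK
    calc ∫⁻ x in Metric.ball y R, ‖w x‖ₑ ^ ((1 - l) * q + l * P)
        ≤ (∫⁻ x in Metric.ball y R, ‖w x‖ₑ ^ q) ^ (1 - l) *
            (∫⁻ x in Metric.ball y R, ‖w x‖ₑ ^ P) ^ l :=
          lintegral_rpow_interpolate hwm.aemeasurable hq hP.le hl0 hl1
      _ ≤ η ^ (1 - l) * (C * X ^ (P / p)) ^ l :=
          mul_le_mul' (ENNReal.rpow_le_rpow (hη y) (sub_nonneg.2 hl1))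
            (ENNReal.rpow_le_rpow (hS w hw y) hl0)
      _ = η ^ (1 - l) * C ^ l * (X ^ (l * P / p - 1) * X) := by
          rw [ENNReal.mul_rpow_of_nonneg _ _ hl0, ← ENNReal.rpow_mul, mul_assoc]
          congr 2
          nth_rewrite 3 [← ENNReal.rpow_one X]
          rw [← ENNReal.rpow_add_of_nonneg _ _ (by linarith) zero_le_one]
          congr 1
          ring
      _ ≤ η ^ (1 - l) * C ^ l * (K ^ (l * P / p - 1) * X) := by
          gcongr
      _ = _ := by ring
  have hint := lintegral_mono (μ := (volume : Measure E)) hloc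
  rw [lintegral_lintegral_ball (hwm.pow_const _)] at hint
  have hmeas : Measurable fun y : E => ∫⁻ x in Metric.ball y (3 * R), F x := by
    have hS : MeasurableSet {z : E × E | dist z.2 z.1 < 3 * R} :=
      (isOpen_lt (by fun_prop) continuous_const).measurableSet
    have := ((hFm.comp measurable_snd).indicator hS).lintegral_prod_right' (ν := volume)
    convert this using 2 with y
    rw [← lintegral_indicator measurableSet_ball]
    rfl
  rw [lintegral_const_mul _ hmeas, lintegral_lintegral_ball hFm] at hint
  calc ∫⁻ x, ‖w x‖ₑ ^ ((1 - l) * q + l * P)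
      = V⁻¹ * (V * ∫⁻ x, ‖w x‖ₑ ^ ((1 - l) * q + l * P)) := by
        rw [← mul_assoc, ENNReal.inv_mul_cancel hV0 hVt, one_mul]
    _ ≤ V⁻¹ * (η ^ (1 - l) * C ^ l * K ^ (l * P / p - 1) * (V' * K)) := by
        refine mul_le_mul_right (hint.trans ?_) _
        gcongr
    _ = V⁻¹ * (C ^ l * V') * η ^ (1 - l) * (K ^ (l * P / p - 1) * K ^ (1 : ℝ)) := by
        rw [ENNReal.rpow_one]; ring
    _ = _ := by
        rw [← ENNReal.rpow_add_of_nonneg _ _ (by linarith) zero_le_one, sub_add_cancel]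

end Smooth

section Mollify

open scoped Convolution

variable {E : Type*} [NormedAddCommGroup E] [InnerProductSpace ℝ E] [FiniteDimensional ℝ E]
  [MeasurableSpace E] [BorelSpace E]

/-- **Jensen's inequality** for averages against a probability density. -/
theorem rpow_lintegral_mul_le {α : Type*} [MeasurableSpace α] {μ : Measure α} {ρ h : α → ℝ≥0∞}
    (hρ : AEMeasurable ρ μ) (hh : AEMeasurable h μ) (hρ1 : ∫⁻ z, ρ z ∂μ = 1) {a : ℝ} (ha : 1 ≤ a) :
    (∫⁻ z, ρ z * h z ∂μ) ^ a ≤ ∫⁻ z, ρ z * h z ^ a ∂μ := by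
  have ha0 : 0 < a := by linarith
  have hinv : a⁻¹ ≤ 1 := inv_le_one_of_one_le₀ ha
  have key := ENNReal.lintegral_mul_norm_pow_le hρ (hρ.mul (hh.pow_const a))
    (sub_nonneg.2 hinv) (inv_nonneg.2 ha0.le) (sub_add_cancel 1 a⁻¹)
  rw [hρ1, ENNReal.one_rpow, one_mul] at key
  rw [← ENNReal.le_rpow_inv_iff ha0]
  refine le_trans (le_of_eq (lintegral_congr fun z => ?_)) key
  simp only [Pi.mul_apply]
  rw [ENNReal.mul_rpow_of_nonneg _ _ (inv_nonneg.2 ha0.le), ← ENNReal.rpow_mul,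
    mul_inv_cancel₀ ha0.ne', ENNReal.rpow_one, ← mul_assoc,
    ← ENNReal.rpow_add_of_nonneg _ _ (sub_nonneg.2 hinv) (inv_nonneg.2 ha0.le),
    sub_add_cancel, ENNReal.rpow_one]

theorem setLIntegral_rpow_average_le {ρ h : E → ℝ≥0∞} (hρ : Measurable ρ)
    (hh : AEMeasurable h volume) (hρ1 : ∫⁻ z, ρ z = 1) {a : ℝ} (ha : 1 ≤ a) (A : Set E)
    {η : ℝ≥0∞} (hη : ∀ z, ∫⁻ x in A, h (x - z) ^ a ≤ η) :
    ∫⁻ x in A, (∫⁻ z, ρ z * h (x - z)) ^ a ≤ η := by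
  have hsub : ∀ x : E, Measure.QuasiMeasurePreserving (fun z => x - z) (volume : Measure E) volume :=
    fun x => quasiMeasurePreserving_sub_left volume x
  have hsub' : ∀ z : E, Measure.QuasiMeasurePreserving (fun x => x - z) (volume : Measure E) volume :=
    fun z => (measurePreserving_sub_right volume z).quasiMeasurePreserving
  have hmk : Measurable fun w : E × E => ρ w.2 * hh.mk h (w.1 - w.2) ^ a :=
    (hρ.comp measurable_snd).mul
      ((hh.measurable_mk.comp (measurable_fst.sub measurable_snd)).pow_const a)
  calc ∫⁻ x in A, (∫⁻ z, ρ z * h (x - z)) ^ a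
      ≤ ∫⁻ x in A, ∫⁻ z, ρ z * hh.mk h (x - z) ^ a := by
        refine lintegral_mono fun x => ?_
        refine (rpow_lintegral_mul_le hρ.aemeasurable
          (hh.comp_quasiMeasurePreserving (hsub x)) hρ1 ha).trans (le_of_eq ?_)
        refine lintegral_congr_ae ?_
        filter_upwards [(hsub x).ae hh.ae_eq_mk] with z hz
        simp only [Function.comp_apply, hz]
    _ = ∫⁻ z, ∫⁻ x in A, ρ z * hh.mk h (x - z) ^ a :=
        lintegral_lintegral_swap hmk.aemeasurable
    _ ≤ ∫⁻ z, ρ z * η := by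
        refine lintegral_mono fun z => ?_
        have hm : Measurable fun x => hh.mk h (x - z) ^ a :=
          (hh.measurable_mk.comp (measurable_id.sub_const z)).pow_const a
        rw [lintegral_const_mul _ hm]
        gcongr
        refine le_trans (le_of_eq ?_) (hη z)
        refine lintegral_congr_ae (ae_restrict_of_ae ?_)
        filter_upwards [(hsub' z).ae hh.ae_eq_mk] with x hx
        simp only [hx]
    _ = η := by rw [lintegral_mul_const _ hρ, hρ1, one_mul]

theorem lintegral_enorm_normed (φ : ContDiffBump (0 : E)) :
    ∫⁻ z, ‖φ.normed volume z‖ₑ = 1 := by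
  have h := ofReal_integral_eq_lintegral_ofReal (φ.integrable_normed (μ := volume))
    (Eventually.of_forall φ.nonneg_normed)
  rw [φ.integral_normed, ENNReal.ofReal_one] at h
  rw [h]
  exact lintegral_congr fun z => Real.enorm_eq_ofReal (φ.nonneg_normed z)

theorem enorm_mollify_le {F : Type*} [NormedAddCommGroup F] [NormedSpace ℝ F]
    (ρ : E → ℝ) (f : E → F) (x : E) :
    ‖(ρ ⋆[ContinuousLinearMap.lsmul ℝ ℝ, volume] f) x‖ₑ ≤ ∫⁻ z, ‖ρ z‖ₑ * ‖f (x - z)‖ₑ := by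
  rw [convolution_def]
  refine (enorm_integral_le_lintegral_enorm _).trans (le_of_eq (lintegral_congr fun z => ?_))
  simp [enorm_smul]

theorem fderiv_mollify {N : ℕ} {u : EuclideanSpace ℝ (Fin N) → ℝ}
    {g : EuclideanSpace ℝ (Fin N) → EuclideanSpace ℝ (Fin N)} (h : HasWeakGradient u g)
    {ρ : EuclideanSpace ℝ (Fin N) → ℝ} (hρ : ContDiff ℝ (⊤ : ℕ∞) ρ) (hρc : HasCompactSupport ρ)
    (x : EuclideanSpace ℝ (Fin N)) :
    fderiv ℝ (ρ ⋆[ContinuousLinearMap.lsmul ℝ ℝ, volume] u) x =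
      innerSL ℝ ((ρ ⋆[ContinuousLinearMap.lsmul ℝ ℝ, volume] g) x) := by
  obtain ⟨hu, hg, hw⟩ := h
  have hρ1 : ContDiff ℝ 1 ρ := hρ.of_le (by exact_mod_cast le_top)
  rw [(hρc.hasFDerivAt_convolution_left (ContinuousLinearMap.lsmul ℝ ℝ) hρ1 hu x).fderiv]
  have hex : ConvolutionExistsAt (fderiv ℝ ρ) u x
      ((ContinuousLinearMap.lsmul ℝ ℝ).precompL (EuclideanSpace ℝ (Fin N))) volume :=
    (hρc.fderiv ℝ).convolutionExists_left _ (hρ1.continuous_fderiv one_ne_zero) hu x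
  have hexg : ConvolutionExistsAt ρ g x (ContinuousLinearMap.lsmul ℝ ℝ) volume :=
    hρc.convolutionExists_left _ hρ.continuous hg x
  refine ContinuousLinearMap.coe_injective
    ((EuclideanSpace.basisFun (Fin N) ℝ).toBasis.ext fun i => ?_)
  have hφ : ContDiff ℝ (⊤ : ℕ∞) fun y => ρ (x - y) := hρ.comp (contDiff_const.sub contDiff_id)
  have hφc : HasCompactSupport fun y => ρ (x - y) :=
    hρc.comp_homeomorph (Homeomorph.subLeft x)
  have hfd : ∀ y, fderiv ℝ (fun y => ρ (x - y)) y = - fderiv ℝ ρ (x - y) := by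
    intro y
    have h1 : HasFDerivAt ρ (fderiv ℝ ρ (x - y)) (x - y) :=
      (hρ1.differentiable one_ne_zero _).hasFDerivAt
    have h2 : HasFDerivAt (fun y => ρ (x - y)) _ y :=
      h1.comp y ((hasFDerivAt_id y).const_sub x)
    rw [h2.fderiv]
    ext v
    simp
  have hi := hw _ hφ hφc i
  simp only [hfd, _root_.neg_apply, mul_neg, integral_neg, neg_inj] at hi
  have hL : (fderiv ℝ ρ ⋆[(ContinuousLinearMap.lsmul ℝ ℝ).precompL (EuclideanSpace ℝ (Fin N)),
      volume] u) x (EuclideanSpace.single i 1) =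
      ∫ y, u y * fderiv ℝ ρ (x - y) (EuclideanSpace.single i 1) := by
    rw [convolution_def, ContinuousLinearMap.integral_apply hex,
      ← integral_sub_left_eq_self _ _ x]
    refine integral_congr_ae (Eventually.of_forall fun y => ?_)
    simp [ContinuousLinearMap.precompL_apply, mul_comm]
  have hR : innerSL ℝ ((ρ ⋆[ContinuousLinearMap.lsmul ℝ ℝ, volume] g) x)
      (EuclideanSpace.single i 1) = ∫ y, g y i * ρ (x - y) := by
    rw [convolution_def]
    have h3 := (EuclideanSpace.proj (𝕜 := ℝ) i).integral_comp_comm hexg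
    simp only [PiLp.proj_apply] at h3
    simp only [innerSL_apply_apply, EuclideanSpace.inner_single_right, one_mul, conj_trivial]
    rw [← h3, ← integral_sub_left_eq_self _ _ x]
    refine integral_congr_ae (Eventually.of_forall fun y => ?_)
    simp [mul_comm]
  simpa using hL.trans (hi.trans hR.symm)

theorem ae_tendsto_mollify {u : E → ℝ} (hu : LocallyIntegrable u volume) :
    ∃ φ : ℕ → ContDiffBump (0 : E), ∀ᵐ x, Tendsto
      (fun k => ((φ k).normed volume ⋆[ContinuousLinearMap.lsmul ℝ ℝ, volume] u) x)
      atTop (𝓝 (u x)) := by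
  let φ : ℕ → ContDiffBump (0 : E) := fun k =>
    ⟨1 / ((k : ℝ) + 1), 2 * (1 / ((k : ℝ) + 1)), by positivity,
      lt_mul_of_one_lt_left (by positivity) one_lt_two⟩
  refine ⟨φ, ContDiffBump.ae_convolution_tendsto_right_of_locallyIntegrable (K := 2) ?_
    (Eventually.of_forall fun k => le_rfl) hu⟩
  have h := (tendsto_one_div_add_atTop_nhds_zero_nat (𝕜 := ℝ)).const_mul 2
  rwa [mul_zero] at h

end Mollify

/-- Lions' inequality for weakly differentiable functions. -/
theorem lions_inequality {N : ℕ} {p q P R l : ℝ} (hp : 1 ≤ p) (hq : 1 ≤ q) (hP : 0 < P)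
    (hR : 0 < R) (hN : 0 < N) (hpP : P⁻¹ = p⁻¹ - (N : ℝ)⁻¹) (hl : p / P ≤ l) (hl1 : l ≤ 1) :
    ∃ C : ℝ≥0∞, C ≠ ⊤ ∧ ∀ (u : EuclideanSpace ℝ (Fin N) → ℝ)
      (g : EuclideanSpace ℝ (Fin N) → EuclideanSpace ℝ (Fin N)), HasWeakGradient u g →
      ∀ η K : ℝ≥0∞, (∀ y, ∫⁻ x in Metric.ball y R, ‖u x‖ₑ ^ q ≤ η) →
      (∫⁻ x, ‖u x‖ₑ ^ p) + (∫⁻ x, ‖g x‖ₑ ^ p) ≤ K →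
      ∫⁻ x, ‖u x‖ₑ ^ ((1 - l) * q + l * P) ≤ C * η ^ (1 - l) * K ^ (l * P / p) := by
  obtain ⟨C, hC, hS⟩ := lions_inequality_of_contDiff (E := EuclideanSpace ℝ (Fin N)) hp
    (by linarith : (0 : ℝ) ≤ q) hP hR (by simpa using hN) (by simpa using hpP) hl hl1
  refine ⟨C, hC, fun u g hug η K hη hK => ?_⟩
  obtain ⟨φ, hφ⟩ := ae_tendsto_mollify hug.1
  set w : ℕ → EuclideanSpace ℝ (Fin N) → ℝ := fun k =>
    MeasureTheory.convolution ((φ k).normed volume) u (ContinuousLinearMap.lsmul ℝ ℝ) volume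
  have hsmooth : ∀ k, ContDiff ℝ (⊤ : ℕ∞) ((φ k).normed volume) := fun k => (φ k).contDiff_normed
  have hcpt : ∀ k, HasCompactSupport ((φ k).normed volume) := fun k => (φ k).hasCompactSupport_normed
  have hwc : ∀ k, ContDiff ℝ 1 (w k) := fun k =>
    (hcpt k).contDiff_convolution_left (n := 1) _ (φ k).contDiff_normed hug.1
  have hρm : ∀ k, Measurable fun z => ‖(φ k).normed volume z‖ₑ := fun k =>
    (hsmooth k).continuous.enorm.measurable
  have hum : AEMeasurable (fun x => ‖u x‖ₑ) volume := hug.1.aestronglyMeasurable.enorm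
  have hgm : AEMeasurable (fun x => ‖g x‖ₑ) volume := hug.2.1.aestronglyMeasurable.enorm
  have hbound : ∀ k, ∫⁻ x, ‖w k x‖ₑ ^ ((1 - l) * q + l * P) ≤
      C * η ^ (1 - l) * K ^ (l * P / p) := by
    intro k
    refine hS (w k) (hwc k) η K (fun y => ?_) (le_trans (add_le_add ?_ ?_) hK)
    · refine le_trans (lintegral_mono fun x => ENNReal.rpow_le_rpow
        (enorm_mollify_le _ _ x) (by linarith)) (setLIntegral_rpow_average_le (hρm k) hum
          (lintegral_enorm_normed (φ k)) hq _ fun z => le_trans (le_of_eq ?_) (hη (y - z)))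
      rw [← lintegral_indicator measurableSet_ball, ← lintegral_indicator measurableSet_ball,
        ← lintegral_sub_right_eq_self
          ((Metric.ball (y - z) R).indicator fun x => ‖u x‖ₑ ^ q) z]
      refine lintegral_congr fun x => ?_
      simp [Set.indicator, dist_eq_norm]
    · rw [← setLIntegral_univ fun x => ‖w k x‖ₑ ^ p]
      refine le_trans (lintegral_mono fun x => ENNReal.rpow_le_rpow
        (enorm_mollify_le _ _ x) (by linarith)) (setLIntegral_rpow_average_le (hρm k) hum
          (lintegral_enorm_normed (φ k)) hp _ fun z => ?_)
      rw [setLIntegral_univ, lintegral_sub_right_eq_self (fun x => ‖u x‖ₑ ^ p) z]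
    · rw [← setLIntegral_univ fun x => ‖fderiv ℝ (w k) x‖ₑ ^ p]
      refine le_trans (lintegral_mono fun x => ENNReal.rpow_le_rpow ?_ (by linarith))
        (setLIntegral_rpow_average_le (hρm k) hgm (lintegral_enorm_normed (φ k)) hp _ fun z => ?_)
      · rw [fderiv_mollify hug (hsmooth k) (hcpt k) x, ← ofReal_norm, innerSL_apply_norm,
          ofReal_norm]
        exact enorm_mollify_le _ _ x
      · rw [setLIntegral_univ, lintegral_sub_right_eq_self (fun x => ‖g x‖ₑ ^ p) z]
  calc ∫⁻ x, ‖u x‖ₑ ^ ((1 - l) * q + l * P)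
      = ∫⁻ x, liminf (fun k => ‖w k x‖ₑ ^ ((1 - l) * q + l * P)) atTop := by
        refine lintegral_congr_ae ?_
        filter_upwards [hφ] with x hx
        exact ((ENNReal.continuous_rpow_const.tendsto _).comp hx.enorm).liminf_eq.symm
    _ ≤ liminf (fun k => ∫⁻ x, ‖w k x‖ₑ ^ ((1 - l) * q + l * P)) atTop :=
        lintegral_liminf_le fun k => (hwc k).continuous.enorm.measurable.pow_const _
    _ ≤ liminf (fun _ : ℕ => C * η ^ (1 - l) * K ^ (l * P / p)) atTop :=
        liminf_le_liminf (Eventually.of_forall hbound)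
    _ = _ := liminf_const _

theorem ofReal_norm_rpow {F : Type*} [NormedAddCommGroup F] (x : F) {a : ℝ} (ha : 0 ≤ a) :
    ENNReal.ofReal (‖x‖ ^ a) = ‖x‖ₑ ^ a := by
  rw [← ENNReal.ofReal_rpow_of_nonneg (norm_nonneg x) ha, ofReal_norm]

/-- Lions' vanishing lemma: if `(u_n)` is bounded in `W^{1,p}(ℝ^N)` and
`sup_y ∫_{B_r(y)} |u_n|^q → 0` for some `p ≤ q < p*`, then `∫ |u_n|^t → 0` for all
`p < t < p*`. -/
theorem lions_vanishing (N : ℕ) (hN : 2 ≤ N) (p q r : ℝ)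
    (hp1 : 1 ≤ p) (hpN : p < N) (hpq : p ≤ q) (hq : q < (N : ℝ) * p / ((N : ℝ) - p))
    (hr : 0 < r)
    (u : ℕ → EuclideanSpace ℝ (Fin N) → ℝ)
    (g : ℕ → EuclideanSpace ℝ (Fin N) → EuclideanSpace ℝ (Fin N))
    (hweak : ∀ n, HasWeakGradient (u n) (g n))
    (hbdd : ∃ C : ℝ≥0∞, C ≠ ⊤ ∧ ∀ n,
      (∫⁻ x, ENNReal.ofReal (|u n x| ^ p)) + (∫⁻ x, ENNReal.ofReal (‖g n x‖ ^ p)) ≤ C)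
    (hvanish : Tendsto
      (fun n => ⨆ y : EuclideanSpace ℝ (Fin N),
        ∫⁻ x in Metric.ball y r, ENNReal.ofReal (|u n x| ^ q)) atTop (𝓝 0)) :
    ∀ t : ℝ, p < t → t < (N : ℝ) * p / ((N : ℝ) - p) →
      Tendsto (fun n => ∫⁻ x, ENNReal.ofReal (|u n x| ^ t)) atTop (𝓝 0) := by
  intro t hpt htP
  have hp0 : 0 < p := by linarith
  have hN0 : (0 : ℝ) < N := by linarith
  have hNp : 0 < (N : ℝ) - p := by linarith
  set P : ℝ := (N : ℝ) * p / ((N : ℝ) - p) with hPdef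
  have hpP : p < P := hpt.trans htP
  have hP : 0 < P := hp0.trans hpP
  have hPinv : P⁻¹ = p⁻¹ - (N : ℝ)⁻¹ := by
    rw [hPdef]
    field_simp
  have hqP : 0 < P - q := by linarith
  obtain ⟨C, hC, hbdd⟩ := hbdd
  set l : ℝ := max (p / P) ((t - q) / (P - q)) with hldef
  have hl : p / P ≤ l := le_max_left _ _
  have hl0 : 0 ≤ l := (by positivity : 0 ≤ p / P).trans hl
  have hl1 : l < 1 := max_lt ((div_lt_one hP).2 hpP) ((div_lt_one hqP).2 (by linarith))
  set s : ℝ := (1 - l) * q + l * P with hs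
  have hts : t ≤ s := by
    have := (div_le_iff₀ hqP).1 (le_max_right (p / P) ((t - q) / (P - q)))
    rw [hs]
    linarith
  have hps : 0 < s - p := by linarith
  set m : ℝ := (t - p) / (s - p) with hm
  have hm0 : 0 < m := div_pos (by linarith) hps
  have hm1 : m ≤ 1 := (div_le_one hps).2 (by linarith)
  have htm : t = (1 - m) * p + m * s := by
    have : m * (s - p) = t - p := div_mul_cancel₀ _ hps.ne'
    linarith
  obtain ⟨A, hA, hineq⟩ := lions_inequality hp1 (hp1.trans hpq) hP hr (by omega) hPinv hl hl1.le
  simp only [← Real.norm_eq_abs, ofReal_norm_rpow _ (hp0.le.trans hpq)] at hvanish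
  simp only [← Real.norm_eq_abs, ofReal_norm_rpow _ hp0.le] at hbdd
  simp only [← Real.norm_eq_abs, ofReal_norm_rpow _ (hp0.trans hpt).le]
  set η : ℕ → ℝ≥0∞ := fun n => ⨆ y, ∫⁻ x in Metric.ball y r, ‖u n x‖ₑ ^ q
  have hle : ∀ n, ∫⁻ x, ‖u n x‖ₑ ^ t ≤
      C ^ (1 - m) * (A * η n ^ (1 - l) * C ^ (l * P / p)) ^ m := by
    intro n
    rw [htm]
    refine (lintegral_rpow_interpolate (hweak n).1.aestronglyMeasurable.enorm hp0.le
      (by linarith) hm0.le hm1).trans (mul_le_mul' ?_ ?_)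
    · exact ENNReal.rpow_le_rpow (le_self_add.trans (hbdd n)) (sub_nonneg.2 hm1)
    · refine ENNReal.rpow_le_rpow (hineq _ _ (hweak n) _ _ (fun y => ?_) (hbdd n)) hm0.le
      exact le_iSup (fun y => ∫⁻ x in Metric.ball y r, ‖u n x‖ₑ ^ q) y
  have h1l : 0 < 1 - l := by linarith
  have hη : Tendsto (fun n => η n ^ (1 - l)) atTop (𝓝 0) := by
    simpa [h1l] using hvanish.ennrpow_const (1 - l)
  have hlim : Tendsto (fun n => A * η n ^ (1 - l) * C ^ (l * P / p)) atTop (𝓝 0) := by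
    have h1 := ENNReal.Tendsto.const_mul hη (Or.inr hA)
    have h2 := ENNReal.Tendsto.mul_const h1
      (Or.inr (ENNReal.rpow_ne_top_of_nonneg (by positivity : 0 ≤ l * P / p) hC))
    simpa using h2
  have hlim' : Tendsto (fun n => C ^ (1 - m) * (A * η n ^ (1 - l) * C ^ (l * P / p)) ^ m)
      atTop (𝓝 0) := by
    have h1 := hlim.ennrpow_const m
    rw [ENNReal.zero_rpow_of_pos hm0] at h1
    simpa using ENNReal.Tendsto.const_mul h1
      (Or.inr (ENNReal.rpow_ne_top_of_nonneg (sub_nonneg.2 hm1) hC))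
  exact tendsto_of_tendsto_of_tendsto_of_le_of_le tendsto_const_nhds hlim'
    (fun _ => zero_le) hle
end
end

section
/- Let N ≥ 2 and let φ : (0,∞) → (0,∞) be a C¹ function such that t ↦ tφ(t) is strictly increasing on (0,∞); set Φ(t) = ∫_0^{|t|} s φ(s) ds and assume there are l, m ∈ (1,N) with l ≤ t²φ(t)/Φ(t) ≤ m for all t ≠ 0 and m < l* := lN/(N−l). Assume ∫_1^{∞} Φ^{-1}(s) s^{-(N+1)/N} ds = +∞, and let Φ_* : [0,∞) → [0,∞) be the increasing bijection whose inverse is t ↦ ∫_0^t Φ^{-1}(s) s^{-(N+1)/N} ds, where Φ^{-1} is the inverse of the restriction of Φ to [0,∞). Let B be an N-function satisfying the Δ₂-condition such that lim_{t→0} B(t)/Φ(t) = 0 and lim_{t→∞} B(t)/Φ_*(t) = 0. Let (u_n) be a sequence of locally integrable functions ℝ^N → ℝ, each with a weak gradient g_n, such that sup_n ( ∫_{ℝ^N} Φ(|u_n|) dx + ∫_{ℝ^N} Φ(‖g_n‖) dx ) < ∞, and suppose there is R > 0 with lim_{n→∞} sup_{y ∈ ℝ^N} ∫_{B_R(y)}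 Φ(|u_n|) dx = 0. Then ∫_{ℝ^N} B(|u_n|) dx → 0 as n → ∞. -/
open MeasureTheory Filter Topology ENNReal

noncomputable section

/-- An N-function: continuous, convex, even, nonnegative, vanishing only at `0`, with
`Φ(t)/t → 0` as `t → 0` and `Φ(t)/t → ∞` as `t → ∞`. -/
def IsNFunction (Φ : ℝ → ℝ) : Prop :=
  Continuous Φ ∧ ConvexOn ℝ Set.univ Φ ∧ (∀ t, 0 ≤ Φ t) ∧
  (∀ t, Φ t = 0 ↔ t = 0) ∧ (∀ t, Φ (-t) = Φ t) ∧
  Tendsto (fun t => Φ t / t) (𝓝[≠] (0 : ℝ)) (𝓝 0) ∧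
  Tendsto (fun t => Φ t / t) atTop atTop

/-- A convex function on `[0,∞)` which vanishes only at `0`, is superlinear at `0` and grows at
most like the power `m`. -/
structure PowerYoung (Φ : ℝ → ℝ) (m : ℝ) : Prop where
  cont : Continuous Φ
  zero : Φ 0 = 0
  pos : ∀ t, 0 < t → 0 < Φ t
  convex : ConvexOn ℝ (Set.Ici 0) Φ
  mono : StrictMonoOn Φ (Set.Ici 0)
  scale : ∀ t, 0 ≤ t → ∀ c, 1 ≤ c → Φ (c * t) ≤ c ^ m * Φ t
  lim : Tendsto (fun t => Φ t / t) (𝓝[>] 0) (𝓝 0)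

theorem powerYoung_of_density {f Φ : ℝ → ℝ} {l m : ℝ} (hl : 1 < l)
    (hf : ContinuousOn f (Set.Ioi 0)) (hfpos : ∀ t, 0 < t → 0 < f t)
    (hfmono : StrictMonoOn f (Set.Ioi 0)) (hΦ : ∀ t, Φ t = ∫ s in (0:ℝ)..|t|, f s)
    (hsand : ∀ t, 0 < t → l ≤ t * f t / Φ t ∧ t * f t / Φ t ≤ m) : PowerYoung Φ m := by
  have hne : ∀ t, 0 < t → Φ t ≠ 0 := by
    intro t ht h0
    have := (hsand t ht).1
    rw [h0, _root_.div_zero] at this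
    linarith
  have hpos : ∀ t, 0 < t → 0 < Φ t := by
    intro t ht
    refine lt_of_le_of_ne ?_ (hne t ht).symm
    rw [hΦ, abs_of_pos ht, intervalIntegral.integral_of_le ht.le]
    exact setIntegral_nonneg measurableSet_Ioc fun s hs => (hfpos s hs.1).le
  have hint : ∀ t, 0 < t → IntervalIntegrable f volume 0 t := by
    intro t ht
    by_contra h
    apply hne t ht
    rw [hΦ, abs_of_pos ht, intervalIntegral.integral_undef h]
  have hderiv : ∀ t, 0 < t → HasDerivAt Φ (f t) t := by
    intro t ht
    have h1 : HasDerivAt (fun x => ∫ s in (0:ℝ)..x, f s) (f t) t := by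
      refine intervalIntegral.integral_hasDerivAt_right (hint t ht) ?_
        (hf.continuousAt (Ioi_mem_nhds ht))
      exact ContinuousOn.stronglyMeasurableAtFilter isOpen_Ioi hf t ht
    refine h1.congr_of_eventuallyEq ?_
    filter_upwards [Ioi_mem_nhds ht] with x hx
    rw [hΦ, abs_of_pos hx]
  have hzero : Φ 0 = 0 := by simp [hΦ]
  have hpw : ∀ p t, 0 < t → HasDerivAt (fun x => Φ x * x ^ (-p))
      (f t * t ^ (-p) + Φ t * (-p * t ^ (-p - 1))) t := by
    intro p t ht
    exact (hderiv t ht).mul (Real.hasDerivAt_rpow_const (Or.inl ht.ne'))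
  have hpw' : ∀ p t, 0 < t → f t * t ^ (-p) + Φ t * (-p * t ^ (-p - 1)) =
      t ^ (-p - 1) * (t * f t - p * Φ t) := by
    intro p t ht
    have : t ^ (-p) = t ^ (-p - 1) * t := by
      rw [← Real.rpow_add_one ht.ne']; congr 1; ring
    rw [this]; ring
  have hanti : AntitoneOn (fun x => Φ x * x ^ (-m)) (Set.Ioi 0) := by
    apply antitoneOn_of_deriv_nonpos (convex_Ioi 0)
    · exact fun x hx => (hpw m x hx).continuousAt.continuousWithinAt
    · rw [interior_Ioi]
      exact fun x hx => (hpw m x hx).differentiableAt.differentiableWithinAt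
    · rw [interior_Ioi]
      intro x hx
      rw [(hpw m x hx).deriv, hpw' m x hx]
      refine mul_nonpos_of_nonneg_of_nonpos (Real.rpow_nonneg (le_of_lt hx) _) ?_
      have := (hsand x hx).2
      rw [div_le_iff₀ (hpos x hx)] at this
      linarith
  have hmonol : MonotoneOn (fun x => Φ x * x ^ (-l)) (Set.Ioi 0) := by
    apply monotoneOn_of_deriv_nonneg (convex_Ioi 0)
    · exact fun x hx => (hpw l x hx).continuousAt.continuousWithinAt
    · rw [interior_Ioi]
      exact fun x hx => (hpw l x hx).differentiableAt.differentiableWithinAt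
    · rw [interior_Ioi]
      intro x hx
      rw [(hpw l x hx).deriv, hpw' l x hx]
      refine mul_nonneg (Real.rpow_nonneg (le_of_lt hx) _) ?_
      have := (hsand x hx).1
      rw [le_div_iff₀ (hpos x hx)] at this
      linarith
  have hsmall : ∀ t, 0 < t → t ≤ 1 → Φ t ≤ t ^ (l - 1) * Φ 1 * t := by
    intro t ht ht1
    have h := hmonol (Set.mem_Ioi.2 ht) (Set.mem_Ioi.2 one_pos) ht1
    simp only [Real.one_rpow, mul_one] at h
    rw [Real.rpow_neg ht.le, ← div_eq_mul_inv, div_le_iff₀ (Real.rpow_pos_of_pos ht _)] at h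
    calc Φ t ≤ Φ 1 * t ^ l := h
      _ = t ^ (l - 1) * Φ 1 * t := by
        rw [show t ^ l = t ^ (l - 1) * t by rw [← Real.rpow_add_one ht.ne']; congr 1; ring]; ring
  have hlim : Tendsto (fun t => Φ t / t) (𝓝[>] 0) (𝓝 0) := by
    have h1 : Tendsto (fun t : ℝ => t ^ (l - 1) * Φ 1) (𝓝[>] 0) (𝓝 0) := by
      have : Tendsto (fun t : ℝ => t ^ (l - 1) * Φ 1) (𝓝 0) (𝓝 (0 ^ (l - 1) * Φ 1)) :=
        ((Real.continuousAt_rpow_const 0 (l - 1) (Or.inr (by linarith))).tendsto).mul_const _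
      rw [Real.zero_rpow (by linarith), zero_mul] at this
      exact this.mono_left nhdsWithin_le_nhds
    refine tendsto_of_tendsto_of_tendsto_of_le_of_le' tendsto_const_nhds h1 ?_ ?_
    · filter_upwards [self_mem_nhdsWithin] with t ht
      exact div_nonneg (hpos t ht).le (le_of_lt ht)
    · filter_upwards [self_mem_nhdsWithin, nhdsWithin_le_nhds (Iio_mem_nhds one_pos)] with t ht ht1
      rw [div_le_iff₀ ht]
      exact hsmall t ht (le_of_lt ht1)
  have hevenΦ : ∀ t, Φ t = Φ |t| := fun t => by rw [hΦ, hΦ |t|, abs_abs]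
  have hcont0 : ContinuousAt Φ 0 := by
    have h1 : Tendsto (fun t : ℝ => |t| * Φ 1) (𝓝 0) (𝓝 0) := by
      have : Continuous (fun t : ℝ => |t| * Φ 1) := by fun_prop
      simpa using this.tendsto 0
    rw [ContinuousAt, hzero]
    refine tendsto_of_tendsto_of_tendsto_of_le_of_le' tendsto_const_nhds h1 ?_ ?_
    · refine Eventually.of_forall fun t => ?_
      rcases eq_or_ne t 0 with rfl | ht
      · exact hzero.ge
      · rw [hevenΦ]; exact (hpos _ (abs_pos.2 ht)).le
    · filter_upwards [Ioo_mem_nhds (show (-1:ℝ) < 0 by norm_num) one_pos] with t ht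
      rcases eq_or_ne t 0 with rfl | ht0
      · simp [hzero]
      · have ha : |t| ≤ 1 := abs_le.2 ⟨ht.1.le, ht.2.le⟩
        rw [hevenΦ]
        refine (hsmall _ (abs_pos.2 ht0) ha).trans ?_
        have h2 : |t| ^ (l - 1) ≤ 1 := Real.rpow_le_one (abs_nonneg _) ha (by linarith)
        have := mul_le_mul_of_nonneg_right h2
          (mul_nonneg (hpos 1 one_pos).le (abs_nonneg t))
        nlinarith
  have hcontpos : ∀ t, 0 < t → ContinuousAt Φ t := fun t ht => (hderiv t ht).continuousAt
  have hcontΦ : Continuous Φ := by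
    have hIci : ∀ t, 0 ≤ t → ContinuousAt Φ t := by
      intro t ht
      rcases ht.eq_or_lt with rfl | ht
      exacts [hcont0, hcontpos t ht]
    have : Φ = fun t => Φ |t| := funext hevenΦ
    rw [this, continuous_iff_continuousAt]
    intro t
    exact ContinuousAt.comp (f := fun t : ℝ => |t|) (hIci _ (abs_nonneg t)) continuous_abs.continuousAt
  have hderiv' : ∀ t, 0 < t → deriv Φ t = f t := fun t ht => (hderiv t ht).deriv
  refine ⟨hcontΦ, hzero, hpos, ?_, ?_, ?_, hlim⟩
  · apply MonotoneOn.convexOn_of_deriv (convex_Ici 0) hcontΦ.continuousOn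
    · rw [interior_Ici]
      exact fun x hx => (hderiv x hx).differentiableAt.differentiableWithinAt
    · rw [interior_Ici]
      intro x hx y hy hxy
      rw [hderiv' x hx, hderiv' y hy]
      exact hfmono.monotoneOn hx hy hxy
  · apply strictMonoOn_of_deriv_pos (convex_Ici 0) hcontΦ.continuousOn
    rw [interior_Ici]
    intro x hx
    rw [hderiv' x hx]
    exact hfpos x hx
  · intro t ht c hc
    rcases ht.eq_or_lt with rfl | ht
    · simp [hzero]
    have hc0 : 0 < c := by linarith
    have h := hanti (Set.mem_Ioi.2 ht) (Set.mem_Ioi.2 (mul_pos hc0 ht))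
      (le_mul_of_one_le_left ht.le hc)
    simp only [Real.rpow_neg ht.le, Real.rpow_neg (mul_pos hc0 ht).le] at h
    rw [← div_eq_mul_inv, ← div_eq_mul_inv, Real.mul_rpow hc0.le ht.le,
      div_le_div_iff₀ (by positivity) (by positivity)] at h
    have htm : 0 < t ^ m := by positivity
    nlinarith

theorem StrictMonoOn.continuousOn_of_bijOn_Ici {f : ℝ → ℝ} (hf : StrictMonoOn f (Set.Ici 0))
    (hb : Set.BijOn f (Set.Ici 0) (Set.Ici 0)) : ContinuousOn f (Set.Ici 0) := by
  have h : Continuous (hb.mapsTo.restrict f (Set.Ici 0) (Set.Ici 0)) := by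
    apply Monotone.continuous_of_surjective
    · intro x y hxy
      exact hf.monotoneOn x.2 y.2 hxy
    · exact hb.mapsTo.restrict_surjective_iff.2 hb.surjOn
  rw [continuousOn_iff_continuous_domRestrict]
  exact continuous_subtype_val.comp h

theorem StrictMonoOn.map_zero_of_bijOn_Ici {f : ℝ → ℝ} (hf : StrictMonoOn f (Set.Ici 0))
    (hb : Set.BijOn f (Set.Ici 0) (Set.Ici 0)) : f 0 = 0 := by
  obtain ⟨x, hx, hx0⟩ := hb.surjOn (Set.mem_Ici.2 le_rfl)
  have h1 : f 0 ≤ f x := hf.monotoneOn Set.self_mem_Ici hx hx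
  have h2 : 0 ≤ f 0 := hb.mapsTo Set.self_mem_Ici
  linarith

theorem StrictMonoOn.of_invOn_Ici {Φ Ψ : ℝ → ℝ} (hΦ : StrictMonoOn Φ (Set.Ici 0))
    (hmap : Set.MapsTo Ψ (Set.Ici 0) (Set.Ici 0))
    (hinv : Set.InvOn Ψ Φ (Set.Ici 0) (Set.Ici 0)) : StrictMonoOn Ψ (Set.Ici 0) := by
  intro x hx y hy hxy
  by_contra h
  have := hΦ.monotoneOn (hmap hy) (hmap hx) (not_lt.1 h)
  rw [hinv.2 hx, hinv.2 hy] at this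
  linarith

theorem PowerYoung.div_mono {Φ : ℝ → ℝ} {m : ℝ} (h : PowerYoung Φ m) {s t : ℝ} (hs : 0 < s)
    (hst : s ≤ t) : Φ s / s ≤ Φ t / t := by
  have := h.convex.secant_mono (a := 0) (x := s) (y := t) Set.self_mem_Ici hs.le
    (hs.le.trans hst) hs.ne' (hs.trans_le hst).ne' hst
  simpa [h.zero] using this

theorem PowerYoung.nonneg {Φ : ℝ → ℝ} {m : ℝ} (h : PowerYoung Φ m) {t : ℝ} (ht : 0 ≤ t) :
    0 ≤ Φ t := by
  rcases ht.eq_or_lt with rfl | ht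
  exacts [h.zero.ge, (h.pos t ht).le]

theorem PowerYoung.bijOn {Φ Ψ : ℝ → ℝ} {m : ℝ} (h : PowerYoung Φ m)
    (hmap : Set.MapsTo Ψ (Set.Ici 0) (Set.Ici 0))
    (hinv : Set.InvOn Ψ Φ (Set.Ici 0) (Set.Ici 0)) :
    Set.BijOn Ψ (Set.Ici 0) (Set.Ici 0) :=
  hinv.symm.bijOn hmap fun _ ht => h.nonneg ht

/-- The primitive `S` of `A / Ψ(A)` is, up to the sign, a power of the Sobolev conjugate `A`. -/
theorem exists_sobolev_transform {Φ Ψ A : ℝ → ℝ} {m : ℝ} {N : ℕ} (hN : 2 ≤ N)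
    (hY : PowerYoung Φ m) (hΨmap : Set.MapsTo Ψ (Set.Ici 0) (Set.Ici 0))
    (hΨinv : Set.InvOn Ψ Φ (Set.Ici 0) (Set.Ici 0))
    (hAmono : StrictMonoOn A (Set.Ici 0)) (hAbij : Set.BijOn A (Set.Ici 0) (Set.Ici 0))
    (hAinv : ∀ t, 0 ≤ t → (∫ s in (0:ℝ)..(A t), Ψ s / s ^ (((N : ℝ) + 1) / N)) = t) :
    ∃ S : ℝ → ℝ, ContDiff ℝ 1 S ∧ S 0 = 0 ∧ (∀ t, |S t| = A |t| ^ (1 - 1 / (N : ℝ))) ∧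
      ∀ t, |deriv S t| ≤ Φ (Ψ (A |t|)) / Ψ (A |t|) := by
  have hN' : (2:ℝ) ≤ N := by exact_mod_cast hN
  have hN0 : (0:ℝ) < N := by linarith
  have hΨmono := hY.mono.of_invOn_Ici hΨmap hΨinv
  have hΨbij := hY.bijOn hΨmap hΨinv
  have hΨcont := hΨmono.continuousOn_of_bijOn_Ici hΨbij
  have hΨ0 := hΨmono.map_zero_of_bijOn_Ici hΨbij
  have hAcont := hAmono.continuousOn_of_bijOn_Ici hAbij
  have hA0 := hAmono.map_zero_of_bijOn_Ici hAbij
  have hApos : ∀ t, 0 < t → 0 < A t := fun t ht => by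
    have := hAmono Set.self_mem_Ici ht.le ht
    rwa [hA0] at this
  have hΨpos : ∀ t, 0 < t → 0 < Ψ t := fun t ht => by
    have := hΨmono Set.self_mem_Ici ht.le ht
    rwa [hΨ0] at this
  have hint : ∀ t, 0 < t →
      IntervalIntegrable (fun s => Ψ s / s ^ (((N : ℝ) + 1) / N)) volume 0 (A t) := by
    intro t ht
    by_contra h
    have := hAinv t ht.le
    rw [intervalIntegral.integral_undef h] at this
    exact ht.ne this
  have hDcont : ContinuousOn (fun s => Ψ s / s ^ (((N : ℝ) + 1) / N)) (Set.Ioi 0) := by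
    refine (hΨcont.mono Set.Ioi_subset_Ici_self).div ?_ ?_
    · exact fun s hs => (Real.continuousAt_rpow_const s _ (Or.inl (ne_of_gt hs))).continuousWithinAt
    · exact fun s hs => (Real.rpow_pos_of_pos hs _).ne'
  have hAderiv : ∀ t, 0 < t → HasDerivAt A (Ψ (A t) / A t ^ (((N : ℝ) + 1) / N))⁻¹ t := by
    intro t ht
    refine HasDerivAt.of_local_left_inverse (hAcont.continuousAt (Ici_mem_nhds ht))
      (intervalIntegral.integral_hasDerivAt_right (hint t ht) ?_
        (hDcont.continuousAt (Ioi_mem_nhds (hApos t ht)))) ?_ ?_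
    · exact ContinuousOn.stronglyMeasurableAtFilter isOpen_Ioi hDcont _ (hApos t ht)
    · exact (div_pos (hΨpos _ (hApos t ht)) (Real.rpow_pos_of_pos (hApos t ht) _)).ne'
    · filter_upwards [Ioi_mem_nhds ht] with y hy using hAinv y (le_of_lt hy)
  set c : ℝ := 1 - 1 / N with hc
  have hc0 : 0 < c := by
    rw [hc, sub_pos, div_lt_one hN0]; linarith
  have hc1 : c ≤ 1 := by
    rw [hc]; have : 0 < 1 / (N:ℝ) := by positivity
    linarith
  set k : ℝ → ℝ := fun t => c * (A |t| / Ψ (A |t|)) with hk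
  have hσderiv : ∀ t, 0 < t → HasDerivAt (fun x => A x ^ c) (k t) t := by
    intro t ht
    have hAt := hApos t ht
    have h := (hAderiv t ht).rpow_const (p := c) (Or.inl hAt.ne')
    convert h using 1
    have h1 : A t ^ (((N : ℝ) + 1) / N) * A t ^ (c - 1) = A t := by
      rw [← Real.rpow_add hAt]
      conv_rhs => rw [← Real.rpow_one (A t)]
      congr 1
      rw [hc]; field_simp; ring
    simp only [hk, abs_of_pos ht, inv_div]
    calc c * (A t / Ψ (A t)) = c * ((A t ^ (((N : ℝ) + 1) / N) * A t ^ (c - 1)) / Ψ (A t)) := by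
          rw [h1]
      _ = _ := by ring
  have hΨA : ∀ t, 0 ≤ t → Φ (Ψ (A t)) = A t := fun t ht => hΨinv.2 (hAbij.mapsTo ht)
  have hkcont : Continuous k := by
    have habs : Continuous (fun t : ℝ => A |t|) :=
      hAcont.comp_continuous continuous_abs fun t => abs_nonneg t
    have habs' : Continuous (fun t : ℝ => Ψ (A |t|)) :=
      hΨcont.comp_continuous habs fun t => hAbij.mapsTo (abs_nonneg t)
    rw [continuous_iff_continuousAt]
    intro t
    refine ContinuousAt.mul continuousAt_const ?_
    rcases eq_or_ne t 0 with rfl | ht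
    · have h0 : Tendsto (fun t : ℝ => A |t| / Ψ (A |t|)) (𝓝[≠] 0) (𝓝 0) := by
        have h1 : Tendsto (fun t : ℝ => Ψ (A |t|)) (𝓝[≠] 0) (𝓝[>] 0) := by
          refine tendsto_nhdsWithin_iff.2 ⟨?_, ?_⟩
          · have := habs'.tendsto 0
            simp only [abs_zero, hA0, hΨ0] at this
            exact this.mono_left nhdsWithin_le_nhds
          · filter_upwards [self_mem_nhdsWithin] with t ht
            exact hΨpos _ (hApos _ (abs_pos.2 ht))
        refine (hY.lim.comp h1).congr fun t => ?_
        simp only [Function.comp, hΨA _ (abs_nonneg t)]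
      rw [continuousAt_iff_punctured_nhds]
      simpa [hA0] using h0
    · exact habs.continuousAt.div habs'.continuousAt (hΨpos _ (hApos _ (abs_pos.2 ht))).ne'
  have hSderiv : ∀ t, HasDerivAt (fun t => ∫ s in (0:ℝ)..t, k s) (k t) t := fun t =>
    intervalIntegral.integral_hasDerivAt_right (hkcont.intervalIntegrable _ _)
      hkcont.aestronglyMeasurable.stronglyMeasurableAtFilter hkcont.continuousAt
  have hSpos : ∀ t, 0 ≤ t → (∫ s in (0:ℝ)..t, k s) = A t ^ c := by
    intro t ht
    rw [intervalIntegral.integral_eq_sub_of_hasDerivAt_of_le (f := fun x => A x ^ c) ht ?_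
      (fun x hx => hσderiv x hx.1) (hkcont.intervalIntegrable _ _)]
    · simp only [hA0, Real.zero_rpow hc0.ne', sub_zero]
    · exact (hAcont.mono Set.Icc_subset_Ici_self).rpow_const fun x _ => Or.inr hc0.le
  refine ⟨fun t => ∫ s in (0:ℝ)..t, k s, ?_, by simp, ?_, ?_⟩
  · rw [contDiff_one_iff_deriv]
    refine ⟨fun t => (hSderiv t).differentiableAt, ?_⟩
    rw [funext fun t => (hSderiv t).deriv]
    exact hkcont
  · intro t
    beta_reduce
    rcases le_total 0 t with ht | ht
    · rw [hSpos t ht, abs_of_nonneg ht, abs_of_nonneg]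
      exact Real.rpow_nonneg (hAbij.mapsTo ht) _
    · have h1 : (∫ s in (0:ℝ)..t, k s) = - ∫ s in (0:ℝ)..(-t), k s := by
        have h2 := intervalIntegral.integral_comp_neg (a := 0) (b := t) k
        have h3 : ∀ s, k (-s) = k s := fun s => by simp [hk]
        simp only [h3, neg_zero] at h2
        rw [h2, intervalIntegral.integral_symm]
      rw [h1, hSpos _ (by linarith), abs_neg, abs_of_nonpos ht, abs_of_nonneg]
      exact Real.rpow_nonneg (hAbij.mapsTo (Set.mem_Ici.2 (by linarith))) _
  · intro t
    have h1 : 0 ≤ A |t| / Ψ (A |t|) :=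
      div_nonneg (hAbij.mapsTo (abs_nonneg t)) (hΨmap (hAbij.mapsTo (abs_nonneg t)))
    rw [(hSderiv t).deriv, hΨA _ (abs_nonneg t), abs_of_nonneg (mul_nonneg hc0.le h1)]
    exact mul_le_of_le_one_left h1 hc1

theorem PowerYoung.div_mul_le {Φ : ℝ → ℝ} {m : ℝ} (h : PowerYoung Φ m) {z b ε : ℝ} (hz : 0 ≤ z)
    (hb : 0 ≤ b) (hε : 0 < ε) (hε1 : ε ≤ 1) :
    Φ z / z * b ≤ ε * Φ z + ε ^ (1 - m) * Φ b := by
  have hΦz := h.nonneg hz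
  have hΦb := h.nonneg hb
  have hεm : 0 < ε ^ (1 - m) := Real.rpow_pos_of_pos hε _
  rcases hz.eq_or_lt with rfl | hz
  · simp only [_root_.div_zero, zero_mul]; positivity
  rcases le_or_gt b (ε * z) with hbz | hbz
  · calc Φ z / z * b ≤ Φ z / z * (ε * z) := by gcongr
      _ = ε * Φ z := by field_simp
      _ ≤ _ := le_add_of_nonneg_right (by positivity)
  · have hzb : z ≤ ε⁻¹ * b := by
      rw [inv_mul_eq_div, le_div_iff₀ hε]; linarith
    have hb0 : 0 < b := (mul_pos hε hz).trans hbz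
    calc Φ z / z * b ≤ Φ (ε⁻¹ * b) / (ε⁻¹ * b) * b := by
          gcongr ?_ * _
          exact h.div_mono hz hzb
      _ = ε * Φ (ε⁻¹ * b) := by field_simp
      _ ≤ ε * ((ε⁻¹) ^ m * Φ b) := by
          gcongr
          exact h.scale b hb _ (one_le_inv₀ hε |>.2 hε1)
      _ = ε ^ (1 - m) * Φ b := by
          rw [Real.inv_rpow hε.le, ← Real.rpow_neg hε.le, ← mul_assoc]
          rw [sub_eq_add_neg, Real.rpow_add hε, Real.rpow_one]
      _ ≤ _ := le_add_of_nonneg_left (by positivity)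

theorem exists_bound_of_rpow_le {N m : ℝ} (hN : 1 < N) (hmN : m < N) {C G : ℝ} (hC : 0 ≤ C)
    (hG : 0 ≤ G) :
    ∃ K, ∀ I, 0 ≤ I → (∀ ε, 0 < ε → ε ≤ 1 → I ^ (1 - 1 / N) ≤ C * (ε * I + ε ^ (1 - m) * G)) →
      I ≤ K := by
  set c₀ : ℝ := 1 / (2 * (C + 1)) with hc₀
  have hc₀pos : 0 < c₀ := by positivity
  have hc₀le : c₀ ≤ 1 := by
    rw [hc₀, div_le_one (by positivity)]; linarith
  set Q : ℝ := 2 * C * (c₀ ^ (1 - m) * G) with hQ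
  have hQ0 : 0 ≤ Q := by positivity
  refine ⟨max 1 (Q ^ (N / (N - m))), fun I hI h => ?_⟩
  rcases le_or_gt I 1 with hI1 | hI1
  · exact hI1.trans (le_max_left _ _)
  refine le_trans ?_ (le_max_right _ _)
  have hI0 : 0 < I := by linarith
  have hN0 : 0 < N := by linarith
  have hpow : I ^ (-(1 / N)) ≤ 1 :=
    Real.rpow_le_one_of_one_le_of_nonpos hI1.le (by
      have : 0 < 1 / N := by positivity
      linarith)
  have hpow0 : 0 < I ^ (-(1 / N)) := Real.rpow_pos_of_pos hI0 _
  have h1 := h (c₀ * I ^ (-(1 / N))) (by positivity) (mul_le_one₀ hc₀le hpow0.le hpow)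
  have e1 : I ^ (-(1 / N)) * I = I ^ (1 - 1 / N) := by
    rw [← Real.rpow_add_one hI0.ne']; congr 1; ring
  have e2 : (c₀ * I ^ (-(1 / N))) ^ (1 - m) = c₀ ^ (1 - m) * I ^ ((m - 1) / N) := by
    rw [Real.mul_rpow hc₀pos.le hpow0.le, ← Real.rpow_mul hI0.le]
    congr 2; ring
  have e3 : I ^ (1 - 1 / N) = I ^ ((m - 1) / N) * I ^ ((N - m) / N) := by
    rw [← Real.rpow_add hI0]; congr 1; field_simp; ring
  rw [mul_assoc, e1, e2] at h1
  have hCc : C * c₀ ≤ 1 / 2 := by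
    rw [hc₀, mul_one_div, div_le_div_iff₀ (by positivity) (by positivity)]; linarith
  have hX : 0 < I ^ (1 - 1 / N) := Real.rpow_pos_of_pos hI0 _
  have h2 : I ^ (1 - 1 / N) ≤ Q * I ^ ((m - 1) / N) := by
    have := mul_le_mul_of_nonneg_right hCc hX.le
    rw [hQ]
    nlinarith
  have hY : 0 < I ^ ((m - 1) / N) := Real.rpow_pos_of_pos hI0 _
  have h3 : I ^ ((N - m) / N) ≤ Q := by
    rw [e3, mul_comm] at h2
    exact le_of_mul_le_mul_right h2 hY
  have hNm : 0 < N - m := by linarith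
  calc I = (I ^ ((N - m) / N)) ^ (N / (N - m)) := by
        rw [← Real.rpow_mul hI0.le, div_mul_div_cancel₀ hN0.ne', div_self hNm.ne', Real.rpow_one]
    _ ≤ _ := by gcongr

theorem exists_lintegral_le_of_hasCompactSupport {N : ℕ} (hN : 2 ≤ N) {Φ A S Z : ℝ → ℝ} {m : ℝ}
    (hY : PowerYoung Φ m) (hmN : m < N) (hAcont : Continuous fun t => A |t|) (hA0 : A 0 = 0)
    (hS : ContDiff ℝ 1 S) (hS0 : S 0 = 0) (hSA : ∀ t, |S t| = A |t| ^ (1 - 1 / (N : ℝ)))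
    (hZ : ∀ t, 0 ≤ Z t) (hZA : ∀ t, Φ (Z t) = A |t|) (hSZ : ∀ t, |deriv S t| ≤ Φ (Z t) / Z t)
    {G : ℝ} (hG : 0 ≤ G) :
    ∃ K : ℝ, ∀ w : EuclideanSpace ℝ (Fin N) → ℝ, ContDiff ℝ 1 w → HasCompactSupport w →
      (∫⁻ x, ENNReal.ofReal (Φ ‖fderiv ℝ w x‖)) ≤ ENNReal.ofReal G →
      (∫⁻ x, ENNReal.ofReal (A |w x|)) ≤ ENNReal.ofReal K := by
  have hN1 : (1:ℝ) < N := by exact_mod_cast hN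
  have hN0 : (0:ℝ) < N := by linarith
  set p : ℝ := Real.conjExponent N with hp
  have hpc : Real.HolderConjugate N p := Real.HolderConjugate.conjExponent hN1
  have hp0 : 0 < p := hpc.symm.pos
  have hpinv : p⁻¹ = 1 - 1 / N := by rw [one_div]; exact hpc.one_sub_inv.symm
  set C := lintegralPowLePowLIntegralFDerivConst
    (volume : Measure (EuclideanSpace ℝ (Fin N))) p with hC
  obtain ⟨K, hK⟩ := exists_bound_of_rpow_le hN1 hmN (C := (C : ℝ) ^ p⁻¹) (G := G)
    (by positivity) hG
  refine ⟨K, fun w hw hwc hwG => ?_⟩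
  have hA_nonneg : ∀ t, 0 ≤ A |t| := fun t => by rw [← hZA]; exact hY.nonneg (hZ t)
  have hAw : Continuous fun x => A |w x| := hAcont.comp hw.continuous
  have hAwint : Integrable fun x => A |w x| :=
    hAw.integrable_of_hasCompactSupport (hwc.comp_left (g := fun t => A |t|) (by simpa using hA0))
  set I : ℝ := ∫ x, A |w x| with hI
  have hI0 : 0 ≤ I := integral_nonneg fun x => hA_nonneg _
  have hIeq : (∫⁻ x, ENNReal.ofReal (A |w x|)) = ENNReal.ofReal I :=
    (ofReal_integral_eq_lintegral_ofReal hAwint (Eventually.of_forall fun x => hA_nonneg _)).symm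
  rw [hIeq]
  refine ENNReal.ofReal_le_ofReal (hK I hI0 fun ε hε hε1 => ?_)
  have hv : ContDiff ℝ 1 (S ∘ w) := hS.comp hw
  have hvc : HasCompactSupport (S ∘ w) := hwc.comp_left hS0
  have hsob := lintegral_pow_le_pow_lintegral_fderiv
    (volume : Measure (EuclideanSpace ℝ (Fin N))) hv hvc (p := p) (by simpa using hpc)
  have hleft : (∫⁻ x, ‖(S ∘ w) x‖ₑ ^ p) = ENNReal.ofReal I := by
    rw [← hIeq]
    refine lintegral_congr fun x => ?_
    rw [← ofReal_norm, ENNReal.ofReal_rpow_of_nonneg (norm_nonneg _) hp0.le,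
      Real.norm_eq_abs, Function.comp, hSA, ← hpinv, ← Real.rpow_mul (hA_nonneg _),
      inv_mul_cancel₀ hp0.ne', Real.rpow_one]
  have hεm : 0 ≤ ε ^ (1 - m) := Real.rpow_nonneg hε.le _
  have hright : (∫⁻ x, ‖fderiv ℝ (S ∘ w) x‖ₑ) ≤ ENNReal.ofReal (ε * I + ε ^ (1 - m) * G) := by
    calc (∫⁻ x, ‖fderiv ℝ (S ∘ w) x‖ₑ)
        ≤ ∫⁻ x, (ENNReal.ofReal ε * ENNReal.ofReal (A |w x|) +
            ENNReal.ofReal (ε ^ (1 - m)) * ENNReal.ofReal (Φ ‖fderiv ℝ w x‖)) := by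
          refine lintegral_mono fun x => ?_
          have hd : fderiv ℝ (S ∘ w) x = deriv S (w x) • fderiv ℝ w x :=
            (((hS.differentiable (by norm_num)) (w x)).hasDerivAt.comp_hasFDerivAt x
              ((hw.differentiable (by norm_num)) x).hasFDerivAt).fderiv
          rw [← ofReal_norm, hd, norm_smul, Real.norm_eq_abs,
            ← ENNReal.ofReal_mul hε.le, ← ENNReal.ofReal_mul hεm,
            ← ENNReal.ofReal_add (mul_nonneg hε.le (hA_nonneg _))
              (mul_nonneg hεm (hY.nonneg (norm_nonneg _))), ← hZA]
          refine ENNReal.ofReal_le_ofReal (le_trans ?_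
            (hY.div_mul_le (hZ (w x)) (norm_nonneg (fderiv ℝ w x)) hε hε1))
          exact mul_le_mul_of_nonneg_right (hSZ _) (norm_nonneg _)
      _ = ENNReal.ofReal ε * ENNReal.ofReal I +
            ENNReal.ofReal (ε ^ (1 - m)) * ∫⁻ x, ENNReal.ofReal (Φ ‖fderiv ℝ w x‖) := by
          rw [lintegral_add_left (hAw.measurable.ennreal_ofReal.const_mul _),
            lintegral_const_mul' _ _ ENNReal.ofReal_ne_top,
            lintegral_const_mul' _ _ ENNReal.ofReal_ne_top, hIeq]
      _ ≤ ENNReal.ofReal ε * ENNReal.ofReal I +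
            ENNReal.ofReal (ε ^ (1 - m)) * ENNReal.ofReal G := by gcongr
      _ = _ := by
          rw [← ENNReal.ofReal_mul hε.le, ← ENNReal.ofReal_mul hεm,
            ← ENNReal.ofReal_add (by positivity) (by positivity)]
  have hR0 : 0 ≤ ε * I + ε ^ (1 - m) * G := by positivity
  have hfin : I ≤ C * (ε * I + ε ^ (1 - m) * G) ^ p := by
    rw [hleft] at hsob
    have h1 := hsob.trans (mul_le_mul_right (ENNReal.rpow_le_rpow hright hp0.le) _)
    rw [ENNReal.ofReal_rpow_of_nonneg hR0 hp0.le, ← ENNReal.ofReal_coe_nnreal,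
      ← ENNReal.ofReal_mul (NNReal.coe_nonneg _)] at h1
    exact (ENNReal.ofReal_le_ofReal_iff (by positivity)).1 h1
  rw [← hpinv]
  calc I ^ p⁻¹ ≤ (C * (ε * I + ε ^ (1 - m) * G) ^ p) ^ p⁻¹ := by gcongr
    _ = _ := by
      rw [Real.mul_rpow (NNReal.coe_nonneg _) (by positivity), ← Real.rpow_mul hR0,
        mul_inv_cancel₀ hp0.ne', Real.rpow_one]

theorem exists_cutoff_s1 (N : ℕ) {r : ℝ} (hr : 0 < r) :
    ∃ L : ℝ, 1 ≤ L ∧ ∀ (y : EuclideanSpace ℝ (Fin N)) (c : ℝ), 0 < c → c ≤ 1 →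
      ∃ χ : EuclideanSpace ℝ (Fin N) → ℝ, ContDiff ℝ 1 χ ∧ HasCompactSupport χ ∧
        (∀ x, 0 ≤ χ x) ∧ (∀ x, χ x ≤ 1) ∧ (∀ x, c * dist x y ≤ r / 2 → χ x = 1) ∧
        (∀ x, r ≤ c * dist x y → χ x = 0) ∧ ∀ x, ‖fderiv ℝ χ x‖ ≤ L := by
  let η : ContDiffBump (0 : EuclideanSpace ℝ (Fin N)) := ⟨r / 2, r, by linarith, by linarith⟩
  have hη : ContDiff ℝ 1 η := η.contDiff
  obtain ⟨L, hL⟩ := (hη.continuous_fderiv (by norm_num)).bounded_above_of_compact_support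
    (η.hasCompactSupport.fderiv ℝ)
  refine ⟨max L 1, le_max_right _ _, fun y c hc hc1 => ?_⟩
  have hdist : ∀ x, dist (c • (x - y)) 0 = c * dist x y := fun x => by
    rw [dist_zero_right, norm_smul, Real.norm_of_nonneg hc.le, dist_eq_norm]
  have hzero : ∀ x, r ≤ c * dist x y → η (c • (x - y)) = 0 := fun x hx =>
    η.zero_of_le_dist (by rw [hdist]; exact hx)
  refine ⟨fun x => η (c • (x - y)), ?_, ?_, fun x => η.nonneg, fun x => η.le_one, ?_, hzero, ?_⟩
  · exact hη.comp (by fun_prop)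
  · refine HasCompactSupport.intro (isCompact_closedBall y (r / c)) fun x hx => hzero x ?_
    rw [Metric.mem_closedBall, not_le, div_lt_iff₀ hc] at hx
    linarith
  · intro x hx
    exact η.one_of_mem_closedBall (by rw [Metric.mem_closedBall, hdist]; exact hx)
  · intro x
    have h1 : HasFDerivAt (fun x => c • (x - y))
        (c • ContinuousLinearMap.id ℝ (EuclideanSpace ℝ (Fin N))) x :=
      ((hasFDerivAt_id x).sub_const y).const_smul c
    have h2 := ((hη.differentiable (by norm_num)) (c • (x - y))).hasFDerivAt.comp x h1
    have h3 : fderiv ℝ (fun x => η (c • (x - y))) x = c • fderiv ℝ η (c • (x - y)) := by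
      rw [show (fun x => η (c • (x - y))) = η ∘ fun x => c • (x - y) from rfl, h2.fderiv]
      ext v
      simp
    rw [h3, norm_smul, Real.norm_of_nonneg hc.le]
    calc c * ‖fderiv ℝ η (c • (x - y))‖ ≤ 1 * L := by
          gcongr
          exact hL _
      _ ≤ max L 1 := by rw [one_mul]; exact le_max_left _ _

theorem norm_fderiv_mul_le {E : Type*} [NormedAddCommGroup E] [NormedSpace ℝ E] {χ w : E → ℝ}
    {x : E} {L : ℝ} (hχ : DifferentiableAt ℝ χ x) (hw : DifferentiableAt ℝ w x)
    (h0 : 0 ≤ χ x) (h1 : χ x ≤ 1) (hL : ‖fderiv ℝ χ x‖ ≤ L) :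
    ‖fderiv ℝ (fun x => χ x * w x) x‖ ≤ ‖fderiv ℝ w x‖ + L * |w x| := by
  have : fderiv ℝ (fun x => χ x * w x) x = χ x • fderiv ℝ w x + w x • fderiv ℝ χ x :=
    (hχ.hasFDerivAt.mul hw.hasFDerivAt).fderiv
  rw [this]
  refine (norm_add_le _ _).trans ?_
  rw [norm_smul, norm_smul, Real.norm_of_nonneg h0, Real.norm_eq_abs, mul_comm |w x|]
  gcongr
  exact mul_le_of_le_one_left (norm_nonneg _) h1

theorem PowerYoung.add_mul_le {Φ : ℝ → ℝ} {m : ℝ} (h : PowerYoung Φ m) {a b L : ℝ} (ha : 0 ≤ a)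
    (hb : 0 ≤ b) (hL : 1 ≤ L) :
    Φ (a + L * b) ≤ 2 ^ m * Φ a + 2 ^ m * L ^ m * Φ b := by
  have hLb : 0 ≤ L * b := by positivity
  have h2 : (0:ℝ) < 2 ^ m := Real.rpow_pos_of_pos two_pos _
  have hLm : 0 ≤ L ^ m := Real.rpow_nonneg (by linarith) _
  have hΦa := h.nonneg ha
  have hΦb := h.nonneg hb
  rcases le_total a (L * b) with hab | hab
  · calc Φ (a + L * b) ≤ Φ (2 * (L * b)) :=
          h.mono.monotoneOn (Set.mem_Ici.2 (by positivity)) (Set.mem_Ici.2 (by positivity))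
            (by linarith)
      _ ≤ 2 ^ m * Φ (L * b) := h.scale _ hLb _ one_le_two
      _ ≤ 2 ^ m * (L ^ m * Φ b) := by gcongr; exact h.scale _ hb _ hL
      _ = 2 ^ m * L ^ m * Φ b := by ring
      _ ≤ _ := le_add_of_nonneg_left (by positivity)
  · calc Φ (a + L * b) ≤ Φ (2 * a) :=
          h.mono.monotoneOn (Set.mem_Ici.2 (by positivity)) (Set.mem_Ici.2 (by positivity))
            (by linarith)
      _ ≤ 2 ^ m * Φ a := h.scale _ ha _ one_le_two
      _ ≤ _ := le_add_of_nonneg_right (by positivity)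

theorem PowerYoung.measurable_ofReal_norm {Φ : ℝ → ℝ} {m : ℝ} (h : PowerYoung Φ m) {N : ℕ}
    {F : Type*} [NormedAddCommGroup F] {w : EuclideanSpace ℝ (Fin N) → F} (hw : Continuous w) :
    Measurable fun x => ENNReal.ofReal (Φ ‖w x‖) :=
  (h.cont.comp hw.norm).measurable.ennreal_ofReal

theorem exists_lintegral_le_of_contDiff {N : ℕ} {Φ A : ℝ → ℝ} {m : ℝ}
    (hY : PowerYoung Φ m) (hAcont : Continuous fun t => A |t|)
    (hcpt : ∀ G : ℝ, 0 ≤ G → ∃ K : ℝ, ∀ w : EuclideanSpace ℝ (Fin N) → ℝ, ContDiff ℝ 1 w →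
      HasCompactSupport w → (∫⁻ x, ENNReal.ofReal (Φ ‖fderiv ℝ w x‖)) ≤ ENNReal.ofReal G →
      (∫⁻ x, ENNReal.ofReal (A |w x|)) ≤ ENNReal.ofReal K) (G : ℝ≥0∞) (hG : G ≠ ⊤) :
    ∃ K : ℝ, ∀ w : EuclideanSpace ℝ (Fin N) → ℝ, ContDiff ℝ 1 w →
      (∫⁻ x, ENNReal.ofReal (Φ |w x|)) + (∫⁻ x, ENNReal.ofReal (Φ ‖fderiv ℝ w x‖)) ≤ G →
      (∫⁻ x, ENNReal.ofReal (A |w x|)) ≤ ENNReal.ofReal K := by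
  obtain ⟨L, hL1, hL⟩ := exists_cutoff_s1 N one_pos
  have h2m : (0:ℝ) < 2 ^ m := Real.rpow_pos_of_pos two_pos _
  have hLm : 0 < L ^ m := Real.rpow_pos_of_pos (by linarith) _
  set H : ℝ≥0∞ := ENNReal.ofReal (2 ^ m) * G + ENNReal.ofReal (2 ^ m * L ^ m) * G with hH
  have hHtop : H ≠ ⊤ := by
    rw [hH]
    exact ENNReal.add_ne_top.2 ⟨ENNReal.mul_ne_top ENNReal.ofReal_ne_top hG,
      ENNReal.mul_ne_top ENNReal.ofReal_ne_top hG⟩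
  obtain ⟨K, hK⟩ := hcpt H.toReal ENNReal.toReal_nonneg
  refine ⟨K, fun w hw hwG => ?_⟩
  choose χ hχ using fun k : ℕ => hL 0 (1 / ((k:ℝ) + 1)) (by positivity)
    (by rw [div_le_one (by positivity)]; linarith [(Nat.cast_nonneg k : (0:ℝ) ≤ k)])
  have hbound : ∀ k, (∫⁻ x, ENNReal.ofReal (A |χ k x * w x|)) ≤ ENNReal.ofReal K := by
    intro k
    obtain ⟨hc1, hcs, h0, h1, -, -, hd⟩ := hχ k
    refine hK (fun x => χ k x * w x) (hc1.mul hw) hcs.mul_right ?_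
    rw [ENNReal.ofReal_toReal hHtop]
    calc (∫⁻ x, ENNReal.ofReal (Φ ‖fderiv ℝ (fun x => χ k x * w x) x‖))
        ≤ ∫⁻ x, (ENNReal.ofReal (2 ^ m) * ENNReal.ofReal (Φ ‖fderiv ℝ w x‖) +
            ENNReal.ofReal (2 ^ m * L ^ m) * ENNReal.ofReal (Φ |w x|)) := by
          refine lintegral_mono fun x => ?_
          have e := norm_fderiv_mul_le (hc1.differentiable (by norm_num) x)
            (hw.differentiable (by norm_num) x) (h0 x) (h1 x) (hd x)
          have e1 := hY.mono.monotoneOn (norm_nonneg _) ((norm_nonneg _).trans e) e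
          have e2 := e1.trans (hY.add_mul_le (norm_nonneg _) (abs_nonneg _) hL1)
          rw [← ENNReal.ofReal_mul h2m.le, ← ENNReal.ofReal_mul (by positivity),
            ← ENNReal.ofReal_add (mul_nonneg h2m.le (hY.nonneg (norm_nonneg _)))
              (mul_nonneg (by positivity) (hY.nonneg (abs_nonneg _)))]
          exact ENNReal.ofReal_le_ofReal e2
      _ = ENNReal.ofReal (2 ^ m) * (∫⁻ x, ENNReal.ofReal (Φ ‖fderiv ℝ w x‖)) +
            ENNReal.ofReal (2 ^ m * L ^ m) * ∫⁻ x, ENNReal.ofReal (Φ |w x|) := by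
          rw [lintegral_add_left ((hY.measurable_ofReal_norm
              (hw.continuous_fderiv (by norm_num))).const_mul _),
            lintegral_const_mul' _ _ ENNReal.ofReal_ne_top,
            lintegral_const_mul' _ _ ENNReal.ofReal_ne_top]
      _ ≤ H := by
          rw [hH]
          gcongr
          · exact le_add_self.trans hwG
          · exact le_self_add.trans hwG
  have hlim : ∀ x, Tendsto (fun k => ENNReal.ofReal (A |χ k x * w x|)) atTop
      (𝓝 (ENNReal.ofReal (A |w x|))) := by
    intro x
    refine tendsto_const_nhds.congr' ?_
    obtain ⟨k₀, hk₀⟩ := exists_nat_ge (2 * dist x 0)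
    filter_upwards [eventually_ge_atTop k₀] with k hk
    have hk' : (k₀:ℝ) ≤ k := by exact_mod_cast hk
    rw [(hχ k).2.2.2.2.1 x, one_mul]
    rw [one_div, inv_mul_le_iff₀ (by positivity)]
    linarith
  calc (∫⁻ x, ENNReal.ofReal (A |w x|))
      = ∫⁻ x, liminf (fun k => ENNReal.ofReal (A |χ k x * w x|)) atTop :=
        lintegral_congr fun x => (hlim x).liminf_eq.symm
    _ ≤ liminf (fun k => ∫⁻ x, ENNReal.ofReal (A |χ k x * w x|)) atTop :=
        lintegral_liminf_le fun k => (hAcont.comp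
          ((hχ k).1.continuous.mul hw.continuous)).measurable.ennreal_ofReal
    _ ≤ ENNReal.ofReal K := liminf_le_of_le (by isBoundedDefault) fun b hb => by
        obtain ⟨k, hk⟩ := hb.exists
        exact hk.trans (hbound k)

theorem lintegral_lintegral_ball_s1 {N : ℕ} {f : EuclideanSpace ℝ (Fin N) → ℝ≥0∞}
    (hf : Measurable f) (r : ℝ) :
    (∫⁻ y, ∫⁻ x in Metric.ball y r, f x) =
      volume (Metric.ball (0 : EuclideanSpace ℝ (Fin N)) r) * ∫⁻ x, f x := by
  have hS : MeasurableSet {q : EuclideanSpace ℝ (Fin N) × EuclideanSpace ℝ (Fin N) |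
      dist q.2 q.1 < r} := measurableSet_lt (by fun_prop) (by fun_prop)
  have h1 : ∀ y x, (Metric.ball y r).indicator f x =
      Set.indicator {q : EuclideanSpace ℝ (Fin N) × EuclideanSpace ℝ (Fin N) | dist q.2 q.1 < r}
        (fun q => f q.2) (y, x) := fun y x => by
    simp only [Set.indicator, Metric.mem_ball, Set.mem_ofPred_eq]
  have h2 : ∀ y x, (Metric.ball y r).indicator f x =
      (Metric.ball x r).indicator (fun _ => f x) y := fun y x => by
    simp only [Set.indicator, Metric.mem_ball, dist_comm]
  calc (∫⁻ y, ∫⁻ x in Metric.ball y r, f x)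
      = ∫⁻ y, ∫⁻ x, (Metric.ball y r).indicator f x := by
        simp only [lintegral_indicator Metric.isOpen_ball.measurableSet]
    _ = ∫⁻ x, ∫⁻ y, (Metric.ball y r).indicator f x := by
        simp only [h1]
        exact lintegral_lintegral_swap
          ((hf.comp measurable_snd).indicator hS).aemeasurable
    _ = ∫⁻ x, volume (Metric.ball (0 : EuclideanSpace ℝ (Fin N)) r) * f x := by
        refine lintegral_congr fun x => ?_
        simp only [h2]
        rw [lintegral_indicator Metric.isOpen_ball.measurableSet, setLIntegral_const,
          Measure.addHaar_ball_center, mul_comm]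
    _ = _ := lintegral_const_mul _ hf

/-- A smooth profile which vanishes near `0` and equals `1` where `|t| ≥ δ`. -/
theorem exists_smooth_threshold {δ : ℝ} (hδ : 0 < δ) :
    ∃ (L : ℝ) (h : ℝ → ℝ), 0 ≤ L ∧ ContDiff ℝ 1 h ∧ (∀ t, 0 ≤ h t) ∧ (∀ t, h t ≤ 1) ∧
      (∀ t, δ ≤ |t| → h t = 1) ∧ (∀ t, |t| ≤ δ / 2 → h t = 0) ∧ (∀ t, |deriv h t| ≤ L) ∧
      ∀ t, |t| ≤ δ / 2 → deriv h t = 0 := by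
  let η : ContDiffBump (0 : ℝ) := ⟨δ / 2, δ, by linarith, by linarith⟩
  have hη : ContDiff ℝ 1 η := η.contDiff
  obtain ⟨L, hL⟩ := (hη.continuous_deriv (by norm_num)).bounded_above_of_compact_support
    η.hasCompactSupport.deriv
  have hd : ∀ t, deriv (fun t => 1 - η t) t = - deriv η t := fun t => by
    simp
  have hzero : ∀ t, |t| ≤ δ / 2 → 1 - η t = 0 := fun t ht => by
    rw [η.one_of_mem_closedBall (by simpa using ht), sub_self]
  refine ⟨L, fun t => 1 - η t, (norm_nonneg _).trans (hL 0), contDiff_const.sub hη,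
    fun t => sub_nonneg.2 η.le_one, fun t => by linarith [η.nonneg' t], fun t ht => ?_, hzero,
    fun t => ?_, fun t ht => ?_⟩
  · beta_reduce
    rw [η.zero_of_le_dist (by simpa using ht), sub_zero]
  · rw [hd, abs_neg]; exact hL t
  · apply IsLocalMin.deriv_eq_zero
    exact Eventually.of_forall fun s => by
      beta_reduce
      rw [hzero t ht]; exact sub_nonneg.2 η.le_one

theorem PowerYoung.le_one_add {Φ : ℝ → ℝ} {m : ℝ} (h : PowerYoung Φ m) {δ t s : ℝ} (hδ : 0 < δ)
    (ht : δ ≤ t) (hs : 0 ≤ s) : s ≤ (Φ δ)⁻¹ * Φ t + (Φ 1)⁻¹ * Φ s := by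
  have hδ0 := h.pos δ hδ
  have h10 := h.pos 1 one_pos
  have h1 : 1 ≤ (Φ δ)⁻¹ * Φ t := by
    rw [inv_mul_eq_div, one_le_div hδ0]
    exact h.mono.monotoneOn hδ.le (hδ.le.trans ht) ht
  rcases le_total s 1 with hs1 | hs1
  · have : 0 ≤ (Φ 1)⁻¹ * Φ s := mul_nonneg (inv_nonneg.2 h10.le) (h.nonneg hs)
    linarith
  · have h2 := h.div_mono one_pos hs1
    have : s ≤ (Φ 1)⁻¹ * Φ s := by
      rw [div_one, le_div_iff₀ (by linarith)] at h2
      rw [inv_mul_eq_div, le_div_iff₀ h10]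
      linarith
    linarith

theorem exists_measure_le_of_vanishing {N : ℕ} (hN : 2 ≤ N) {Φ : ℝ → ℝ} {m : ℝ}
    (hY : PowerYoung Φ m) {R δ : ℝ} (hR : 0 < R) (hδ : 0 < δ) {G : ℝ≥0∞} (hG : G ≠ ⊤) :
    ∃ M : ℝ≥0∞, M ≠ ⊤ ∧ ∀ (w : EuclideanSpace ℝ (Fin N) → ℝ) (κ : ℝ≥0∞), κ ≠ ⊤ → ContDiff ℝ 1 w →
      (∫⁻ x, ENNReal.ofReal (Φ |w x|)) + (∫⁻ x, ENNReal.ofReal (Φ ‖fderiv ℝ w x‖)) ≤ G →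
      (∀ y, (∫⁻ x in Metric.ball y R, ENNReal.ofReal (Φ |w x|)) ≤ κ) →
      volume {x | δ ≤ |w x|} ≤ M * κ ^ (1 / (N : ℝ)) := by
  have hN1 : (1:ℝ) < N := by exact_mod_cast hN
  have hN0 : (0:ℝ) < N := by linarith
  set p : ℝ := Real.conjExponent N with hp
  have hpc : Real.HolderConjugate N p := Real.HolderConjugate.conjExponent hN1
  have hp0 : 0 < p := hpc.symm.pos
  obtain ⟨L, hL1, hL⟩ := exists_cutoff_s1 N hR
  obtain ⟨L', h, hL'0, hh, hh0, hh1, hhδ, hhz, hhd, hhdz⟩ := exists_smooth_threshold hδ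
  set C := lintegralPowLePowLIntegralFDerivConst
    (volume : Measure (EuclideanSpace ℝ (Fin N))) p with hC
  have hδ2 : 0 < δ / 2 := by linarith
  have hΦδ2 := hY.pos _ hδ2
  have hΦδ := hY.pos _ hδ
  have hΦ1 := hY.pos 1 one_pos
  set M₁ : ℝ := (L' + L) * ((Φ (δ / 2))⁻¹ + (Φ 1)⁻¹) with hM₁
  have hM₁0 : 0 ≤ M₁ := by positivity
  set V : ℝ≥0∞ := volume (Metric.ball (0 : EuclideanSpace ℝ (Fin N)) (R / 2)) with hV
  set W : ℝ≥0∞ := volume (Metric.ball (0 : EuclideanSpace ℝ (Fin N)) R) with hW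
  have hV0 : V ≠ 0 := (Metric.measure_ball_pos _ _ (by linarith)).ne'
  have hVtop : V ≠ ⊤ := measure_ball_lt_top.ne
  have hWtop : W ≠ ⊤ := measure_ball_lt_top.ne
  set M₂ : ℝ≥0∞ := (ENNReal.ofReal (Φ δ)⁻¹) ^ (1 / (N:ℝ)) *
    ((C : ℝ≥0∞) ^ p⁻¹ * ENNReal.ofReal M₁) with hM₂
  have hM₂top : M₂ ≠ ⊤ := by
    refine ENNReal.mul_ne_top (ENNReal.rpow_ne_top_of_nonneg (by positivity) ENNReal.ofReal_ne_top)
      (ENNReal.mul_ne_top (ENNReal.rpow_ne_top_of_nonneg (by positivity) ENNReal.coe_ne_top)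
        ENNReal.ofReal_ne_top)
  refine ⟨V⁻¹ * (M₂ * (W * G)), ?_, fun w κ hκtop hw hwG hκ => ?_⟩
  · exact ENNReal.mul_ne_top (ENNReal.inv_ne_top.2 hV0)
      (ENNReal.mul_ne_top hM₂top (ENNReal.mul_ne_top hWtop hG))
  set f : EuclideanSpace ℝ (Fin N) → ℝ≥0∞ := fun x =>
    ENNReal.ofReal (Φ |w x|) + ENNReal.ofReal (Φ ‖fderiv ℝ w x‖) with hf
  have hm1 : Measurable fun x => ENNReal.ofReal (Φ |w x|) :=
    hY.measurable_ofReal_norm hw.continuous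
  have hm2 : Measurable fun x => ENNReal.ofReal (Φ ‖fderiv ℝ w x‖) :=
    hY.measurable_ofReal_norm (hw.continuous_fderiv (by norm_num))
  have hfm : Measurable f := hm1.add hm2
  have hfG : (∫⁻ x, f x) ≤ G := by rwa [hf, lintegral_add_left hm1]
  set E : Set (EuclideanSpace ℝ (Fin N)) := {x | δ ≤ |w x|} with hE
  have hEm : MeasurableSet E := measurableSet_le measurable_const hw.continuous.abs.measurable
  have hv : ContDiff ℝ 1 (h ∘ w) := hh.comp hw
  have hpoint : ∀ x, ‖fderiv ℝ (h ∘ w) x‖ + L * |(h ∘ w) x| ≤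
      M₁ * (Φ |w x| + Φ ‖fderiv ℝ w x‖) := by
    intro x
    have hd : fderiv ℝ (h ∘ w) x = deriv h (w x) • fderiv ℝ w x :=
      (((hh.differentiable (by norm_num)) (w x)).hasDerivAt.comp_hasFDerivAt x
        ((hw.differentiable (by norm_num)) x).hasFDerivAt).fderiv
    have hΦa := hY.nonneg (abs_nonneg (w x))
    have hΦb := hY.nonneg (norm_nonneg (fderiv ℝ w x))
    rw [hd, norm_smul, Real.norm_eq_abs, Function.comp, abs_of_nonneg (hh0 _)]
    rcases le_total |w x| (δ / 2) with hx | hx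
    · rw [hhdz _ hx, hhz _ hx]
      simp only [abs_zero, zero_mul, mul_zero, add_zero]
      positivity
    · have e1 := hY.le_one_add hδ2 hx (norm_nonneg (fderiv ℝ w x))
      have e2 : 1 ≤ (Φ (δ / 2))⁻¹ * Φ |w x| := by
        rw [inv_mul_eq_div, one_le_div hΦδ2]
        exact hY.mono.monotoneOn hδ2.le (hδ2.le.trans hx) hx
      have hi1 : 0 ≤ (Φ (δ / 2))⁻¹ := by positivity
      have hi2 : 0 ≤ (Φ 1)⁻¹ := by positivity
      have e3 : (Φ (δ / 2))⁻¹ * Φ |w x| + (Φ 1)⁻¹ * Φ ‖fderiv ℝ w x‖ ≤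
          ((Φ (δ / 2))⁻¹ + (Φ 1)⁻¹) * (Φ |w x| + Φ ‖fderiv ℝ w x‖) := by
        nlinarith [mul_nonneg hi1 hΦb, mul_nonneg hi2 hΦa]
      have e4 : (1:ℝ) ≤ ((Φ (δ / 2))⁻¹ + (Φ 1)⁻¹) * (Φ |w x| + Φ ‖fderiv ℝ w x‖) :=
        e2.trans (le_trans (le_add_of_nonneg_right (mul_nonneg hi2 hΦb)) e3)
      calc |deriv h (w x)| * ‖fderiv ℝ w x‖ + L * h (w x)
          ≤ L' * (((Φ (δ / 2))⁻¹ + (Φ 1)⁻¹) * (Φ |w x| + Φ ‖fderiv ℝ w x‖)) +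
            L * (((Φ (δ / 2))⁻¹ + (Φ 1)⁻¹) * (Φ |w x| + Φ ‖fderiv ℝ w x‖)) := by
            gcongr
            · exact hhd _
            · exact e1.trans e3
            · exact (hh1 _).trans e4
        _ = _ := by rw [hM₁]; ring
  have hlocal : ∀ y, volume (E ∩ Metric.ball y (R / 2)) ≤
      (κ ^ (1 / (N:ℝ)) * M₂) * ∫⁻ x in Metric.ball y R, f x := by
    intro y
    obtain ⟨χ, hc1, hcs, h0, h1, hone, hz, hd⟩ := hL y 1 one_pos le_rfl
    simp only [one_mul] at hone hz
    have hsob := lintegral_pow_le_pow_lintegral_fderiv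
      (volume : Measure (EuclideanSpace ℝ (Fin N))) (u := fun x => χ x * (h ∘ w) x)
      (hc1.mul hv) hcs.mul_right (p := p) (by simpa using hpc)
    have hleft : volume (E ∩ Metric.ball y (R / 2)) ≤ ∫⁻ x, ‖χ x * (h ∘ w) x‖ₑ ^ p := by
      rw [← setLIntegral_one]
      refine le_trans (setLIntegral_mono' (hEm.inter Metric.isOpen_ball.measurableSet)
        fun x hx => ?_) (setLIntegral_le_lintegral _ _)
      rw [hone x (Metric.mem_ball.1 hx.2).le, Function.comp, hhδ _ hx.1]
      simp
    have hright : (∫⁻ x, ‖fderiv ℝ (fun x => χ x * (h ∘ w) x) x‖ₑ) ≤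
        ENNReal.ofReal M₁ * ∫⁻ x in Metric.ball y R, f x := by
      rw [← lintegral_const_mul _ hfm, ← lintegral_indicator Metric.isOpen_ball.measurableSet]
      refine lintegral_mono fun x => ?_
      by_cases hx : x ∈ Metric.ball y R
      · rw [Set.indicator_of_mem hx, ← ofReal_norm,
          show f x = ENNReal.ofReal (Φ |w x|) + ENNReal.ofReal (Φ ‖fderiv ℝ w x‖) from rfl,
          ← ENNReal.ofReal_add (hY.nonneg (abs_nonneg _)) (hY.nonneg (norm_nonneg _)),
          ← ENNReal.ofReal_mul hM₁0]
        refine ENNReal.ofReal_le_ofReal (le_trans ?_ (hpoint x))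
        exact norm_fderiv_mul_le (hc1.differentiable (by norm_num) x)
            (hv.differentiable (by norm_num) x) (h0 x) (h1 x) (hd x)
      · have hx0 : χ x = 0 := hz x (not_lt.1 hx)
        have hmin : IsLocalMin (fun x => χ x * (h ∘ w) x) x :=
          Eventually.of_forall fun z => by
            simp only [hx0, zero_mul]
            exact mul_nonneg (h0 z) (hh0 _)
        have he : ‖fderiv ℝ (fun x => χ x * (h ∘ w) x) x‖ₑ = 0 := by
          rw [hmin.fderiv_eq_zero, ← ofReal_norm, norm_zero, ENNReal.ofReal_zero]
        rw [he]
        exact zero_le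
    have hpow : volume (E ∩ Metric.ball y (R / 2)) ^ p⁻¹ ≤
        (C : ℝ≥0∞) ^ p⁻¹ * (ENNReal.ofReal M₁ * ∫⁻ x in Metric.ball y R, f x) := by
      have h2 := hleft.trans (hsob.trans
        (mul_le_mul_right (ENNReal.rpow_le_rpow hright hp0.le) _))
      have h3 := ENNReal.rpow_le_rpow h2 (inv_nonneg.2 hp0.le)
      rwa [ENNReal.mul_rpow_of_nonneg _ _ (inv_nonneg.2 hp0.le), ← ENNReal.rpow_mul,
        mul_inv_cancel₀ hp0.ne', ENNReal.rpow_one] at h3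
    have hsmall : volume (E ∩ Metric.ball y (R / 2)) ≤ ENNReal.ofReal (Φ δ)⁻¹ * κ := by
      calc volume (E ∩ Metric.ball y (R / 2))
          = ∫⁻ _ in E ∩ Metric.ball y (R / 2), 1 := (setLIntegral_one _).symm
        _ ≤ ∫⁻ x in E ∩ Metric.ball y (R / 2),
              ENNReal.ofReal (Φ δ)⁻¹ * ENNReal.ofReal (Φ |w x|) := by
            refine setLIntegral_mono' (hEm.inter Metric.isOpen_ball.measurableSet) fun x hx => ?_
            rw [← ENNReal.ofReal_mul (by positivity), ENNReal.one_le_ofReal, inv_mul_eq_div,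
              one_le_div hΦδ]
            exact hY.mono.monotoneOn hδ.le (Set.mem_Ici.2 (abs_nonneg _)) hx.1
        _ ≤ ∫⁻ x in Metric.ball y R, ENNReal.ofReal (Φ δ)⁻¹ * ENNReal.ofReal (Φ |w x|) :=
            lintegral_mono_set (Set.inter_subset_right.trans
              (Metric.ball_subset_ball (by linarith)))
        _ = ENNReal.ofReal (Φ δ)⁻¹ * ∫⁻ x in Metric.ball y R, ENNReal.ofReal (Φ |w x|) :=
            lintegral_const_mul _ hm1
        _ ≤ _ := by gcongr; exact hκ y
    calc volume (E ∩ Metric.ball y (R / 2))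
        = volume (E ∩ Metric.ball y (R / 2)) ^ (1 / (N:ℝ)) *
          volume (E ∩ Metric.ball y (R / 2)) ^ p⁻¹ := by
          rw [← ENNReal.rpow_add_of_nonneg _ _ (by positivity) (inv_nonneg.2 hp0.le), one_div,
            hpc.inv_add_inv_eq_one, ENNReal.rpow_one]
      _ ≤ (ENNReal.ofReal (Φ δ)⁻¹ * κ) ^ (1 / (N:ℝ)) *
          ((C : ℝ≥0∞) ^ p⁻¹ * (ENNReal.ofReal M₁ * ∫⁻ x in Metric.ball y R, f x)) := by
          gcongr
      _ = _ := by
          rw [ENNReal.mul_rpow_of_nonneg _ _ (by positivity), hM₂]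
          ring
  have hVE : V * volume E ≤ κ ^ (1 / (N:ℝ)) * M₂ * (W * ∫⁻ x, f x) := by
    calc V * volume E = V * ∫⁻ x, E.indicator 1 x := by rw [lintegral_indicator_one hEm]
      _ = ∫⁻ y, ∫⁻ x in Metric.ball y (R / 2), E.indicator 1 x :=
          (lintegral_lintegral_ball_s1 (measurable_one.indicator hEm) _).symm
      _ = ∫⁻ y, volume (E ∩ Metric.ball y (R / 2)) := by
          refine lintegral_congr fun y => ?_
          rw [lintegral_indicator_one hEm, Measure.restrict_apply hEm]
      _ ≤ ∫⁻ y, (κ ^ (1 / (N:ℝ)) * M₂) * ∫⁻ x in Metric.ball y R, f x := lintegral_mono hlocal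
      _ = (κ ^ (1 / (N:ℝ)) * M₂) * ∫⁻ y, ∫⁻ x in Metric.ball y R, f x :=
          lintegral_const_mul' _ _ (ENNReal.mul_ne_top
            (ENNReal.rpow_ne_top_of_nonneg (by positivity) hκtop) hM₂top)
      _ = _ := by rw [lintegral_lintegral_ball_s1 hfm]
  calc volume E = V⁻¹ * (V * volume E) := by
        rw [← mul_assoc, ENNReal.inv_mul_cancel hV0 hVtop, one_mul]
    _ ≤ V⁻¹ * (κ ^ (1 / (N:ℝ)) * M₂ * (W * G)) := by
        refine mul_le_mul_right (hVE.trans ?_) _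
        exact (mul_le_mul_right (mul_le_mul_right hfG _) _)
    _ = _ := by ring

/-- For smooth functions with bounded modulars, the modular of `B` is small as soon as the local
modulars of `Φ` are uniformly small. -/
theorem exists_lintegral_le_of_vanishing_contDiff {N : ℕ} (hN : 2 ≤ N) {Φ A B : ℝ → ℝ} {m : ℝ}
    (hY : PowerYoung Φ m) (hAcont : Continuous fun t => A |t|) (hApos : ∀ t, 0 < t → 0 < A t)
    (hBcont : Continuous B) (hBzero : B 0 = 0)
    (hB0 : Tendsto (fun t => B t / Φ t) (𝓝[≠] (0 : ℝ)) (𝓝 0))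
    (hBinf : Tendsto (fun t => B t / A t) atTop (𝓝 0)) {G : ℝ≥0∞} (hG : G ≠ ⊤) {K : ℝ}
    (hK : ∀ w : EuclideanSpace ℝ (Fin N) → ℝ, ContDiff ℝ 1 w →
      (∫⁻ x, ENNReal.ofReal (Φ |w x|)) + (∫⁻ x, ENNReal.ofReal (Φ ‖fderiv ℝ w x‖)) ≤ G →
      (∫⁻ x, ENNReal.ofReal (A |w x|)) ≤ ENNReal.ofReal K)
    {R : ℝ} (hR : 0 < R) {η : ℝ≥0∞} (hη : η ≠ 0) :
    ∃ κ : ℝ≥0∞, 0 < κ ∧ ∀ w : EuclideanSpace ℝ (Fin N) → ℝ, ContDiff ℝ 1 w →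
      (∫⁻ x, ENNReal.ofReal (Φ |w x|)) + (∫⁻ x, ENNReal.ofReal (Φ ‖fderiv ℝ w x‖)) ≤ G →
      (∀ y, (∫⁻ x in Metric.ball y R, ENNReal.ofReal (Φ |w x|)) ≤ κ) →
      (∫⁻ x, ENNReal.ofReal (B |w x|)) ≤ η := by
  have hη2 : η / 2 ≠ 0 := (ENNReal.half_pos hη).ne'
  obtain ⟨ε, hε, hεη⟩ := ENNReal.exists_nnreal_pos_mul_lt
    (ENNReal.add_ne_top.2 ⟨hG, ENNReal.ofReal_ne_top (r := K)⟩) hη2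
  have hε' : (0:ℝ) < ε := hε
  obtain ⟨δ, hδ, hsmall⟩ : ∃ δ : ℝ, 0 < δ ∧ ∀ t, 0 ≤ t → t < δ → B t ≤ ε * Φ t := by
    have h1 := hB0.eventually (gt_mem_nhds hε')
    rw [eventually_nhdsWithin_iff, Metric.eventually_nhds_iff] at h1
    obtain ⟨δ, hδ, h1⟩ := h1
    refine ⟨δ, hδ, fun t ht htδ => ?_⟩
    rcases ht.eq_or_lt with rfl | ht
    · rw [hBzero, hY.zero, mul_zero]
    · have h2 := h1 (y := t) (by rwa [Real.dist_eq, sub_zero, abs_of_pos ht]) ht.ne'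
      exact ((div_lt_iff₀ (hY.pos t ht)).1 h2).le
  obtain ⟨T, hT, hlarge⟩ : ∃ T : ℝ, 0 < T ∧ ∀ t, T ≤ t → B t ≤ ε * A t := by
    obtain ⟨T, h1⟩ := eventually_atTop.1 (hBinf.eventually (gt_mem_nhds hε'))
    refine ⟨max T 1, by positivity, fun t ht => ?_⟩
    have ht0 : 0 < t := lt_of_lt_of_le (by positivity) ht
    exact ((div_lt_iff₀ (hApos t ht0)).1 (h1 t ((le_max_left _ _).trans ht))).le
  obtain ⟨b, hb⟩ := (isCompact_Icc (a := δ) (b := T)).bddAbove_image hBcont.continuousOn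
  obtain ⟨M, hM, hmeas⟩ := exists_measure_le_of_vanishing hN hY hR hδ hG
  obtain ⟨c, hc, hcη⟩ := ENNReal.exists_nnreal_pos_mul_lt
    (ENNReal.mul_ne_top (ENNReal.ofReal_ne_top (r := b)) hM) hη2
  have hN0 : N ≠ 0 := by omega
  refine ⟨(c : ℝ≥0∞) ^ N, ENNReal.pow_pos (by exact_mod_cast hc) N, fun w hw hwG hwκ => ?_⟩
  have hvol : volume {x | δ ≤ |w x|} ≤ M * c := by
    have h1 := hmeas w _ (ENNReal.pow_ne_top ENNReal.coe_ne_top) hw hwG hwκ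
    rwa [one_div, ENNReal.pow_rpow_inv_natCast hN0] at h1
  have hwc := hw.continuous
  have hEm : MeasurableSet {x | δ ≤ |w x|} :=
    measurableSet_le measurable_const hwc.abs.measurable
  have hm1 : Measurable fun x => ENNReal.ofReal (Φ |w x|) :=
    (hY.cont.comp hwc.abs).measurable.ennreal_ofReal
  have hm2 : Measurable fun x => ENNReal.ofReal (A |w x|) :=
    (hAcont.comp hwc).measurable.ennreal_ofReal
  have hpoint : ∀ x, ENNReal.ofReal (B |w x|) ≤
      (ε * ENNReal.ofReal (Φ |w x|) + ε * ENNReal.ofReal (A |w x|)) +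
        {x | δ ≤ |w x|}.indicator (fun _ => ENNReal.ofReal b) x := fun x => by
    have hmul : ∀ s : ℝ, ENNReal.ofReal (ε * s) = ε * ENNReal.ofReal s := fun s => by
      rw [ENNReal.ofReal_mul hε'.le, ENNReal.ofReal_coe_nnreal]
    rcases lt_or_ge |w x| δ with h1 | h1
    · refine le_trans ?_ (le_self_add.trans le_self_add)
      rw [← hmul]
      exact ENNReal.ofReal_le_ofReal (hsmall _ (abs_nonneg _) h1)
    rcases le_or_gt T |w x| with h2 | h2
    · refine le_trans ?_ (le_add_self.trans le_self_add)
      rw [← hmul]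
      exact ENNReal.ofReal_le_ofReal (hlarge _ h2)
    · refine le_trans ?_ le_add_self
      rw [Set.indicator_of_mem (show x ∈ {x | δ ≤ |w x|} from h1)]
      exact ENNReal.ofReal_le_ofReal (hb (Set.mem_image_of_mem _ ⟨h1, h2.le⟩))
  calc (∫⁻ x, ENNReal.ofReal (B |w x|))
      ≤ ∫⁻ x, (ε * ENNReal.ofReal (Φ |w x|) + ε * ENNReal.ofReal (A |w x|)) +
        {x | δ ≤ |w x|}.indicator (fun _ => ENNReal.ofReal b) x := lintegral_mono hpoint
    _ = ε * ((∫⁻ x, ENNReal.ofReal (Φ |w x|)) + ∫⁻ x, ENNReal.ofReal (A |w x|)) +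
        ENNReal.ofReal b * volume {x | δ ≤ |w x|} := by
      rw [lintegral_add_right _ (measurable_const.indicator hEm),
        lintegral_add_left (hm1.const_mul _), lintegral_const_mul _ hm1,
        lintegral_const_mul _ hm2, lintegral_indicator_const hEm, mul_add]
    _ ≤ ε * (G + ENNReal.ofReal K) + ENNReal.ofReal b * (M * c) := by
      gcongr
      · exact le_self_add.trans hwG
      · exact hK w hw hwG
    _ = ε * (G + ENNReal.ofReal K) + c * (ENNReal.ofReal b * M) := by ring
    _ ≤ η / 2 + η / 2 := add_le_add hεη.le hcη.le
    _ = η := ENNReal.add_halves η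

section Mollification

open scoped Convolution

/-- Jensen's inequality for the modular, with values in `ℝ≥0∞`. -/
theorem PowerYoung.ofReal_map_integral_le {α : Type*} [MeasurableSpace α] {ν : Measure α}
    [IsProbabilityMeasure ν] {Φ : ℝ → ℝ} {m : ℝ} (hY : PowerYoung Φ m) {f : α → ℝ}
    (hf : ∀ x, 0 ≤ f x) (hfi : Integrable f ν) :
    ENNReal.ofReal (Φ (∫ x, f x ∂ν)) ≤ ∫⁻ x, ENNReal.ofReal (Φ (f x)) ∂ν := by
  by_cases hfin : (∫⁻ x, ENNReal.ofReal (Φ (f x)) ∂ν) = ⊤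
  · rw [hfin]
    exact le_top
  have h0 : ∀ x, 0 ≤ Φ (f x) := fun x => hY.nonneg (hf x)
  have hm : AEStronglyMeasurable (fun x => Φ (f x)) ν :=
    hY.cont.comp_aestronglyMeasurable hfi.aestronglyMeasurable
  have hi : Integrable (fun x => Φ (f x)) ν :=
    (lintegral_ofReal_ne_top_iff_integrable hm (Eventually.of_forall h0)).1 hfin
  rw [← ofReal_integral_eq_lintegral_ofReal hi (Eventually.of_forall h0)]
  exact ENNReal.ofReal_le_ofReal (hY.convex.map_integral_le hY.cont.continuousOn isClosed_Ici
    (Eventually.of_forall hf) hfi hi)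

/-- The modular of a mollification over a set is bounded by an average of the modulars of
translates. -/
theorem PowerYoung.exists_setLIntegral_convolution_le {N : ℕ} {F : Type*} [NormedAddCommGroup F]
    [NormedSpace ℝ F] [CompleteSpace F] {Φ : ℝ → ℝ} {m : ℝ} (hY : PowerYoung Φ m)
    {ρ : EuclideanSpace ℝ (Fin N) → ℝ} (hρc : Continuous ρ) (hρs : HasCompactSupport ρ)
    (hρ0 : ∀ x, 0 ≤ ρ x) (hρ1 : ∫ x, ρ x = 1) :
    ∃ ν : Measure (EuclideanSpace ℝ (Fin N)), IsProbabilityMeasure ν ∧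
      ∀ v : EuclideanSpace ℝ (Fin N) → F, LocallyIntegrable v volume →
      ∀ S : Set (EuclideanSpace ℝ (Fin N)),
      (∫⁻ x in S, ENNReal.ofReal (Φ ‖(ρ ⋆[ContinuousLinearMap.lsmul ℝ ℝ, volume] v) x‖)) ≤
        ∫⁻ s, (∫⁻ x in S, ENNReal.ofReal (Φ ‖v (x - s)‖)) ∂ν := by
  have hρi : Integrable ρ := hρc.integrable_of_hasCompactSupport hρs
  have hmρ : Measurable fun x => ENNReal.ofReal (ρ x) := hρc.measurable.ennreal_ofReal
  have hfin : ∀ᵐ x, ENNReal.ofReal (ρ x) < ⊤ := Eventually.of_forall fun x => ENNReal.ofReal_lt_top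
  set ν : Measure (EuclideanSpace ℝ (Fin N)) :=
    volume.withDensity fun x => ENNReal.ofReal (ρ x) with hν
  have hνp : IsProbabilityMeasure ν := ⟨by
    rw [hν, withDensity_apply _ MeasurableSet.univ, setLIntegral_univ,
      ← ofReal_integral_eq_lintegral_ofReal hρi (Eventually.of_forall hρ0), hρ1,
      ENNReal.ofReal_one]⟩
  refine ⟨ν, hνp, fun v hv S => ?_⟩
  have hvm : AEMeasurable (fun x => ENNReal.ofReal (Φ ‖v x‖)) volume :=
    (hY.cont.comp_aestronglyMeasurable hv.aestronglyMeasurable.norm).aemeasurable.ennreal_ofReal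
  have hprod : AEMeasurable (Function.uncurry fun x s => ENNReal.ofReal (Φ ‖v (x - s)‖))
      ((volume.restrict S).prod ν) :=
    (hvm.comp_quasiMeasurePreserving
      (quasiMeasurePreserving_sub_of_right_invariant volume ν)).mono_ac
      (Measure.AbsolutelyContinuous.prod Measure.restrict_le_self.absolutelyContinuous
        Measure.AbsolutelyContinuous.rfl)
  rw [← lintegral_lintegral_swap hprod]
  refine lintegral_mono fun x => ?_
  have hconv : Integrable (fun s => ρ s • v (x - s)) volume :=
    hρs.convolutionExists_left (ContinuousLinearMap.lsmul ℝ ℝ) hρc hv x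
  have hsmul : ∀ s, (ENNReal.ofReal (ρ s)).toReal • v (x - s) = ρ s • v (x - s) := fun s => by
    rw [ENNReal.toReal_ofReal (hρ0 s)]
  have hint : Integrable (fun s => v (x - s)) ν := by
    rw [hν, integrable_withDensity_iff_integrable_smul' hmρ hfin]
    simpa only [hsmul] using hconv
  have heq : (ρ ⋆[ContinuousLinearMap.lsmul ℝ ℝ, volume] v) x = ∫ s, v (x - s) ∂ν := by
    rw [hν, integral_withDensity_eq_integral_toReal_smul hmρ hfin, convolution_def]
    simp only [hsmul, ContinuousLinearMap.lsmul_apply]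
  refine le_trans (ENNReal.ofReal_le_ofReal ?_)
    (hY.ofReal_map_integral_le (fun s => norm_nonneg (v (x - s))) hint.norm)
  rw [heq]
  exact hY.mono.monotoneOn (Set.mem_Ici.2 (norm_nonneg _))
    (Set.mem_Ici.2 (integral_nonneg fun s => norm_nonneg _)) (norm_integral_le_integral_norm _)

/-- Mollification does not increase the modular. -/
theorem PowerYoung.lintegral_convolution_le {N : ℕ} {F : Type*} [NormedAddCommGroup F]
    [NormedSpace ℝ F] [CompleteSpace F] {Φ : ℝ → ℝ} {m : ℝ} (hY : PowerYoung Φ m)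
    {ρ : EuclideanSpace ℝ (Fin N) → ℝ} (hρc : Continuous ρ) (hρs : HasCompactSupport ρ)
    (hρ0 : ∀ x, 0 ≤ ρ x) (hρ1 : ∫ x, ρ x = 1) {v : EuclideanSpace ℝ (Fin N) → F}
    (hv : LocallyIntegrable v volume) :
    (∫⁻ x, ENNReal.ofReal (Φ ‖(ρ ⋆[ContinuousLinearMap.lsmul ℝ ℝ, volume] v) x‖)) ≤
      ∫⁻ x, ENNReal.ofReal (Φ ‖v x‖) := by
  obtain ⟨ν, hν, h⟩ := hY.exists_setLIntegral_convolution_le (F := F) hρc hρs hρ0 hρ1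
  have h1 := h v hv Set.univ
  simp only [Measure.restrict_univ] at h1
  refine h1.trans (le_of_eq ?_)
  simp only [lintegral_sub_right_eq_self fun x => ENNReal.ofReal (Φ ‖v x‖)]
  rw [lintegral_const, measure_univ, mul_one]

/-- Mollification does not increase the supremum of the modulars over balls of a fixed radius. -/
theorem PowerYoung.setLIntegral_ball_convolution_le {N : ℕ} {F : Type*} [NormedAddCommGroup F]
    [NormedSpace ℝ F] [CompleteSpace F] {Φ : ℝ → ℝ} {m : ℝ} (hY : PowerYoung Φ m)
    {ρ : EuclideanSpace ℝ (Fin N) → ℝ} (hρc : Continuous ρ) (hρs : HasCompactSupport ρ)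
    (hρ0 : ∀ x, 0 ≤ ρ x) (hρ1 : ∫ x, ρ x = 1) {v : EuclideanSpace ℝ (Fin N) → F}
    (hv : LocallyIntegrable v volume) {R : ℝ} {κ : ℝ≥0∞}
    (hκ : ∀ y, (∫⁻ x in Metric.ball y R, ENNReal.ofReal (Φ ‖v x‖)) ≤ κ)
    (y : EuclideanSpace ℝ (Fin N)) :
    (∫⁻ x in Metric.ball y R,
      ENNReal.ofReal (Φ ‖(ρ ⋆[ContinuousLinearMap.lsmul ℝ ℝ, volume] v) x‖)) ≤ κ := by
  obtain ⟨ν, hν, h⟩ := hY.exists_setLIntegral_convolution_le (F := F) hρc hρs hρ0 hρ1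
  refine (h v hv (Metric.ball y R)).trans ?_
  have htrans : ∀ s, (∫⁻ x in Metric.ball y R, ENNReal.ofReal (Φ ‖v (x - s)‖)) ≤ κ := fun s => by
    refine le_trans (le_of_eq ?_) (hκ (y - s))
    rw [← lintegral_indicator Metric.isOpen_ball.measurableSet,
      ← lintegral_indicator Metric.isOpen_ball.measurableSet,
      ← lintegral_sub_right_eq_self
        ((Metric.ball (y - s) R).indicator fun x => ENNReal.ofReal (Φ ‖v x‖)) s]
    refine lintegral_congr fun x => ?_
    simp only [Set.indicator, Metric.mem_ball, dist_sub_right]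
  calc (∫⁻ s, (∫⁻ x in Metric.ball y R, ENNReal.ofReal (Φ ‖v (x - s)‖)) ∂ν) ≤ ∫⁻ _, κ ∂ν :=
        lintegral_mono htrans
    _ = κ := by rw [lintegral_const, measure_univ, mul_one]

/-- The gradient of a mollification is the mollification of the weak gradient. -/
theorem HasWeakGradient.norm_fderiv_convolution {N : ℕ} {u : EuclideanSpace ℝ (Fin N) → ℝ}
    {g : EuclideanSpace ℝ (Fin N) → EuclideanSpace ℝ (Fin N)} (h : HasWeakGradient u g)
    {ρ : EuclideanSpace ℝ (Fin N) → ℝ} (hρ : ContDiff ℝ (⊤ : ℕ∞) ρ) (hρs : HasCompactSupport ρ)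
    (x : EuclideanSpace ℝ (Fin N)) :
    ‖fderiv ℝ (ρ ⋆[ContinuousLinearMap.lsmul ℝ ℝ, volume] u) x‖ =
      ‖(ρ ⋆[ContinuousLinearMap.lsmul ℝ ℝ, volume] g) x‖ := by
  obtain ⟨hu, hg, hw⟩ := h
  have hρ1 : ContDiff ℝ 1 ρ := hρ.of_le (by exact_mod_cast le_top)
  have hD := hρs.hasFDerivAt_convolution_left (ContinuousLinearMap.lsmul ℝ ℝ) hρ1 hu x
  have hgi : Integrable (fun t => ρ (x - t) • g t) volume := by
    have h1 : ConvolutionExistsAt ρ g x (ContinuousLinearMap.lsmul ℝ ℝ) volume :=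
      hρs.convolutionExists_left _ hρ.continuous hg x
    exact h1.integrable_swap
  have hDi : Integrable (fun t => (ContinuousLinearMap.precompL (EuclideanSpace ℝ (Fin N))
      (ContinuousLinearMap.lsmul ℝ ℝ)) (fderiv ℝ ρ (x - t)) (u t)) volume := by
    have h1 : ConvolutionExistsAt (fderiv ℝ ρ) u x (ContinuousLinearMap.precompL
        (EuclideanSpace ℝ (Fin N)) (ContinuousLinearMap.lsmul ℝ ℝ)) volume :=
      (hρs.fderiv ℝ).convolutionExists_left _ (hρ1.continuous_fderiv (by norm_num)) hu x
    exact h1.integrable_swap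
  have hsub : ∀ t, HasFDerivAt (fun t => ρ (x - t)) (-(fderiv ℝ ρ (x - t))) t := fun t => by
    have h1 := ((hρ1.differentiable (by norm_num)) (x - t)).hasFDerivAt.comp t
      ((hasFDerivAt_id t).const_sub x)
    exact h1.congr_fderiv (by ext v; simp)
  have hψs : HasCompactSupport fun t => ρ (x - t) :=
    hρs.comp_homeomorph (Homeomorph.subLeft x)
  have hkey : fderiv ℝ (ρ ⋆[ContinuousLinearMap.lsmul ℝ ℝ, volume] u) x =
      innerSL ℝ ((ρ ⋆[ContinuousLinearMap.lsmul ℝ ℝ, volume] g) x) := by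
    rw [hD.fderiv]
    apply ContinuousLinearMap.coe_injective
    refine (EuclideanSpace.basisFun (Fin N) ℝ).toBasis.ext fun i => ?_
    have hi := hw (fun t => ρ (x - t)) (hρ.comp (contDiff_const.sub contDiff_id)) hψs i
    simp only [(hsub _).fderiv, neg_apply, mul_neg, integral_neg,
      neg_inj] at hi
    simp only [OrthonormalBasis.coe_toBasis, EuclideanSpace.basisFun_apply,
      ContinuousLinearMap.coe_coe, innerSL_apply_apply]
    rw [convolution_eq_swap, convolution_eq_swap, ContinuousLinearMap.integral_apply hDi,
      real_inner_comm, EuclideanSpace.inner_single_left]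
    have hproj := (EuclideanSpace.proj (𝕜 := ℝ) i).integral_comp_comm hgi
    simp only [EuclideanSpace.coe_proj, PiLp.smul_apply, smul_eq_mul] at hproj
    simp only [ContinuousLinearMap.lsmul_apply, map_one, one_mul]
    rw [← hproj]
    simp only [ContinuousLinearMap.precompL_apply, ContinuousLinearMap.lsmul_apply, smul_eq_mul]
    simpa only [mul_comm] using hi
  rw [hkey, innerSL_apply_norm]

/-- A modular bound valid for all smooth functions with controlled modulars passes to functions
with a weak gradient. -/
theorem HasWeakGradient.lintegral_le_of_contDiff {N : ℕ} {Φ B : ℝ → ℝ} {m : ℝ}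
    (hY : PowerYoung Φ m) (hBcont : Continuous B) {R : ℝ} {G κ η : ℝ≥0∞}
    (hsmooth : ∀ w : EuclideanSpace ℝ (Fin N) → ℝ, ContDiff ℝ 1 w →
      (∫⁻ x, ENNReal.ofReal (Φ |w x|)) + (∫⁻ x, ENNReal.ofReal (Φ ‖fderiv ℝ w x‖)) ≤ G →
      (∀ y, (∫⁻ x in Metric.ball y R, ENNReal.ofReal (Φ |w x|)) ≤ κ) →
      (∫⁻ x, ENNReal.ofReal (B |w x|)) ≤ η)
    {u : EuclideanSpace ℝ (Fin N) → ℝ}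
    {g : EuclideanSpace ℝ (Fin N) → EuclideanSpace ℝ (Fin N)} (hug : HasWeakGradient u g)
    (hG : (∫⁻ x, ENNReal.ofReal (Φ |u x|)) + (∫⁻ x, ENNReal.ofReal (Φ ‖g x‖)) ≤ G)
    (hκ : ∀ y, (∫⁻ x in Metric.ball y R, ENNReal.ofReal (Φ |u x|)) ≤ κ) :
    (∫⁻ x, ENNReal.ofReal (B |u x|)) ≤ η := by
  let b : ℕ → ContDiffBump (0 : EuclideanSpace ℝ (Fin N)) := fun n =>
    ⟨1 / ((n : ℝ) + 1), 2 * (1 / ((n : ℝ) + 1)), by positivity, by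
      have : 0 < 1 / ((n : ℝ) + 1) := by positivity
      linarith⟩
  let w : ℕ → EuclideanSpace ℝ (Fin N) → ℝ := fun n =>
    (b n).normed volume ⋆[ContinuousLinearMap.lsmul ℝ ℝ, volume] u
  have hb : Tendsto (fun n => (b n).rOut) atTop (𝓝 0) := by
    simpa [b] using (tendsto_one_div_add_atTop_nhds_zero_nat (𝕜 := ℝ)).const_mul 2
  have hae : ∀ᵐ x, Tendsto (fun n => w n x) atTop (𝓝 (u x)) :=
    ContDiffBump.ae_convolution_tendsto_right_of_locallyIntegrable hb (K := 2)
      (Eventually.of_forall fun n => le_rfl) hug.1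
  have hcd : ∀ n, ContDiff ℝ (⊤ : ℕ∞)
      ((b n).normed (volume : Measure (EuclideanSpace ℝ (Fin N)))) :=
    fun n => (b n).contDiff_normed
  have hwB : ∀ n, (∫⁻ x, ENNReal.ofReal (B |w n x|)) ≤ η := fun n => by
    have hs := (b n).hasCompactSupport_normed (μ := volume)
    have hc := (hcd n).continuous
    have h0 := (b n).nonneg_normed (μ := volume)
    have h1 := (b n).integral_normed (μ := volume)
    have hw1 : ContDiff ℝ 1 (w n) :=
      hs.contDiff_convolution_left (n := 1) _ ((hcd n).of_le (by exact_mod_cast le_top)) hug.1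
    refine hsmooth (w n) hw1 (le_trans (add_le_add ?_ ?_) hG) fun y => ?_
    · exact hY.lintegral_convolution_le hc hs h0 h1 hug.1
    · simp only [w, hug.norm_fderiv_convolution (hcd n) hs]
      exact hY.lintegral_convolution_le hc hs h0 h1 hug.2.1
    · exact hY.setLIntegral_ball_convolution_le hc hs h0 h1 hug.1 hκ y
  have hwc : ∀ n, Continuous (w n) := fun n =>
    (((b n).hasCompactSupport_normed (μ := volume)).contDiff_convolution_left (n := 0) _
      ((hcd n).of_le (by exact_mod_cast le_top)) hug.1).continuous
  calc (∫⁻ x, ENNReal.ofReal (B |u x|))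
      = ∫⁻ x, liminf (fun n => ENNReal.ofReal (B |w n x|)) atTop := by
        refine lintegral_congr_ae ?_
        filter_upwards [hae] with x hx
        exact (((ENNReal.continuous_ofReal.comp (hBcont.comp continuous_abs)).tendsto
          (u x)).comp hx).liminf_eq.symm
    _ ≤ liminf (fun n => ∫⁻ x, ENNReal.ofReal (B |w n x|)) atTop :=
        lintegral_liminf_le fun n => (hBcont.comp (hwc n).abs).measurable.ennreal_ofReal
    _ ≤ η := liminf_le_of_le (by isBoundedDefault) fun c hc => by
        obtain ⟨n, hn⟩ := hc.exists
        exact hn.trans (hwB n)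

end Mollification

/-- A Lions type result for Orlicz–Sobolev spaces (Theorem 1.2): under the conditions
`(i)-(ii)` on `φ` with `1 < l ≤ m < N`, `m < l* = lN/(N-l)`, for any N-function `B`
satisfying the Δ₂-condition with `B/Φ → 0` at `0` and `B/Φ_* → 0` at `∞`, if `(u_n)` is
bounded in `W^{1,Φ}(ℝ^N)` and `sup_y ∫_{B_R(y)} Φ(|u_n|) → 0`, then `∫ B(|u_n|) → 0`. -/
theorem lions_orlicz_sobolev (N : ℕ) (hN : 2 ≤ N)
    (φfun : ℝ → ℝ)
    (hφC1 : ContDiffOn ℝ 1 φfun (Set.Ioi 0))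
    (hφpos : ∀ t, 0 < t → 0 < φfun t)
    (hφmono : StrictMonoOn (fun t => t * φfun t) (Set.Ioi 0))
    (Φ : ℝ → ℝ) (hΦdef : ∀ t, Φ t = ∫ s in (0:ℝ)..|t|, s * φfun s)
    (l m : ℝ) (hl1 : 1 < l) (hlN : l < N) (hm1 : 1 < m) (hmN : m < N)
    (hlm : l ≤ m) (hml : m < l * N / ((N : ℝ) - l))
    (hsand : ∀ t, t ≠ 0 → l ≤ t ^ 2 * φfun |t| / Φ t ∧ t ^ 2 * φfun |t| / Φ t ≤ m)
    (Φinv : ℝ → ℝ) (hΦinvmap : Set.MapsTo Φinv (Set.Ici 0) (Set.Ici 0))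
    (hΦinv : Set.InvOn Φinv Φ (Set.Ici 0) (Set.Ici 0))
    (hdiv : Tendsto (fun T => ∫ s in (1:ℝ)..T, Φinv s / s ^ (((N : ℝ) + 1) / N))
      atTop atTop)
    (Φstar : ℝ → ℝ)
    (hstarmono : StrictMonoOn Φstar (Set.Ici 0))
    (hstarbij : Set.BijOn Φstar (Set.Ici 0) (Set.Ici 0))
    (hstarinv : ∀ t, 0 ≤ t →
      (∫ s in (0:ℝ)..(Φstar t), Φinv s / s ^ (((N : ℝ) + 1) / N)) = t)
    (B : ℝ → ℝ) (hB : IsNFunction B)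
    (KB : ℝ) (hKB : 0 < KB) (hΔ2 : ∀ t ≥ (0:ℝ), B (2 * t) ≤ KB * B t)
    (hB0 : Tendsto (fun t => B t / Φ t) (𝓝[≠] (0 : ℝ)) (𝓝 0))
    (hBinf : Tendsto (fun t => B t / Φstar t) atTop (𝓝 0))
    (u : ℕ → EuclideanSpace ℝ (Fin N) → ℝ)
    (g : ℕ → EuclideanSpace ℝ (Fin N) → EuclideanSpace ℝ (Fin N))
    (hweak : ∀ n, HasWeakGradient (u n) (g n))
    (hbdd : ∃ C : ℝ≥0∞, C ≠ ⊤ ∧ ∀ n,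
      (∫⁻ x, ENNReal.ofReal (Φ |u n x|)) + (∫⁻ x, ENNReal.ofReal (Φ ‖g n x‖)) ≤ C)
    (R : ℝ) (hR : 0 < R)
    (hvanish : Tendsto (fun n => ⨆ y : EuclideanSpace ℝ (Fin N),
      ∫⁻ x in Metric.ball y R, ENNReal.ofReal (Φ |u n x|)) atTop (𝓝 0)) :
    Tendsto (fun n => ∫⁻ x, ENNReal.ofReal (B |u n x|)) atTop (𝓝 0) := by
  have hY : PowerYoung Φ m := by
    refine powerYoung_of_density (f := fun t => t * φfun t) hl1
      (continuousOn_id.mul hφC1.continuousOn) (fun t ht => mul_pos ht (hφpos t ht)) hφmono hΦdef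
      fun t ht => ?_
    have h := hsand t ht.ne'
    rwa [abs_of_pos ht, sq, mul_assoc] at h
  have hstar0 : Φstar 0 = 0 := hstarmono.map_zero_of_bijOn_Ici hstarbij
  have hstarcont : Continuous fun t => Φstar |t| :=
    (hstarmono.continuousOn_of_bijOn_Ici hstarbij).comp_continuous continuous_abs abs_nonneg
  have hstarnonneg : ∀ t, 0 ≤ Φstar |t| := fun t => hstarbij.mapsTo (abs_nonneg t)
  have hstarpos : ∀ t, 0 < t → 0 < Φstar t := fun t ht => by
    rw [← hstar0]
    exact hstarmono Set.self_mem_Ici ht.le ht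
  obtain ⟨S, hS, hS0, hSA, hSd⟩ :=
    exists_sobolev_transform hN hY hΦinvmap hΦinv hstarmono hstarbij hstarinv
  obtain ⟨C, hC, hbound⟩ := hbdd
  obtain ⟨K, hK⟩ := exists_lintegral_le_of_contDiff hY hstarcont
    (fun G hG => exists_lintegral_le_of_hasCompactSupport hN hY hmN hstarcont hstar0 hS hS0 hSA
      (Z := fun t => Φinv (Φstar |t|)) (fun t => hΦinvmap (hstarnonneg t))
      (fun t => hΦinv.2 (hstarnonneg t)) hSd hG) C hC
  rw [ENNReal.tendsto_nhds_zero]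
  intro η hη
  obtain ⟨κ, hκ, hsmooth⟩ := exists_lintegral_le_of_vanishing_contDiff hN hY hstarcont hstarpos
    hB.1 ((hB.2.2.2.1 0).2 rfl) hB0 hBinf hC hK hR hη.ne'
  filter_upwards [ENNReal.tendsto_nhds_zero.1 hvanish κ hκ] with n hn
  exact (hweak n).lintegral_le_of_contDiff hY hB.1 hsmooth (hbound n)
    fun y => (le_iSup_iff.2 fun b hb => hb y).trans hn
end
end

section
/- Let Φ, Ψ and B be N-functions such that lim_{t→0} B(t)/Φ(t) = 0 and lim_{t→∞} B(t)/Ψ(t) = 0. Let (w_n) be a sequence of measurable functions ℝ^N → ℝ such that sup_n ∫_{ℝ^N} Φ(|w_n|) dx < ∞ and sup_n ∫_{ℝ^N} Ψ(|w_n|) dx < ∞, and such that for each ε > 0 the Lebesgue measure of the set {x ∈ ℝ^N : |w_n(x)| > ε} tends to 0 as n → ∞. Then ∫_{ℝ^N} B(|w_n|) dx → 0 as n → ∞. -/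
open MeasureTheory Filter Topology ENNReal

noncomputable section

/-- A function that is `o(Φ)` at `0` and `o(Ψ)` at `∞` is, for every `δ > 0`, dominated on `[0, ∞)`
by `δ (Φ + Ψ)` up to a bounded error that vanishes near `0`. -/
theorem exists_le_mul_add_indicator {Φ Ψ B : ℝ → ℝ}
    (hΦ0 : ∀ t, 0 ≤ Φ t) (hΦz : ∀ t, Φ t = 0 → t = 0)
    (hΨ0 : ∀ t, 0 ≤ Ψ t) (hΨz : ∀ t, Ψ t = 0 → t = 0)
    (hBc : Continuous B) (hBz : B 0 = 0)
    (hB0 : Tendsto (fun t => B t / Φ t) (𝓝[≠] (0 : ℝ)) (𝓝 0))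
    (hBinf : Tendsto (fun t => B t / Ψ t) atTop (𝓝 0)) {δ : ℝ} (hδ : 0 < δ) :
    ∃ ε > 0, ∃ M : ℝ, ∀ t, 0 ≤ t →
      B t ≤ δ * Φ t + δ * Ψ t + (Set.Ioi ε).indicator (fun _ => M) t := by
  have hΦpos : ∀ t, t ≠ 0 → 0 < Φ t := fun t ht => (hΦ0 t).lt_of_ne' fun h => ht (hΦz t h)
  have hΨpos : ∀ t, t ≠ 0 → 0 < Ψ t := fun t ht => (hΨ0 t).lt_of_ne' fun h => ht (hΨz t h)
  have hnear := eventually_nhdsWithin_iff.1 (hB0.eventually_lt_const hδ)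
  obtain ⟨r, hr, hnear⟩ := Metric.eventually_nhds_iff.1 hnear
  obtain ⟨T, hfar⟩ := eventually_atTop.1 (hBinf.eventually_lt_const hδ)
  obtain ⟨M, hM⟩ := (isCompact_Icc (a := (0 : ℝ)) (b := T)).bddAbove_image hBc.continuousOn
  refine ⟨r / 2, half_pos hr, max M 0, fun t ht => ?_⟩
  have hδΦ := mul_nonneg hδ.le (hΦ0 t)
  have hδΨ := mul_nonneg hδ.le (hΨ0 t)
  rcases ht.eq_or_lt with rfl | htpos
  · have : (0 : ℝ) ∉ Set.Ioi (r / 2) := fun h => (half_pos hr).not_gt h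
    rw [Set.indicator_of_notMem this, hBz]
    linarith
  by_cases hε : r / 2 < t
  · rw [Set.indicator_of_mem (Set.mem_Ioi.2 hε)]
    rcases le_total t T with hT | hT
    · have := hM (Set.mem_image_of_mem B ⟨ht, hT⟩)
      linarith [le_max_left M 0]
    · have := (div_lt_iff₀ (hΨpos t htpos.ne')).1 (hfar t hT)
      linarith [le_max_right M 0]
  · rw [Set.indicator_of_notMem (by simpa using hε)]
    have hdist : dist t 0 < r := by
      rw [Real.dist_eq, sub_zero, abs_of_pos htpos]
      linarith
    have := (div_lt_iff₀ (hΦpos t htpos.ne')).1 (hnear hdist htpos.ne')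
    linarith

/-- If for every `δ > 0` the function `B` is dominated on `[0, ∞)` by `δ (Φ + Ψ)` up to a bounded
error supported away from `0`, then `∫ B(|w n|) → 0` along every sequence with bounded `Φ`- and
`Ψ`-modulars that tends to `0` in measure. -/
theorem tendsto_lintegral_of_le_mul_add_indicator {α : Type*} [MeasurableSpace α] {μ : Measure α}
    {Φ Ψ B : ℝ → ℝ} (hΦ : Measurable Φ) (hΨ : Measurable Ψ)
    (hB : ∀ δ > 0, ∃ ε > 0, ∃ M : ℝ, ∀ t, 0 ≤ t →
      B t ≤ δ * Φ t + δ * Ψ t + (Set.Ioi ε).indicator (fun _ => M) t)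
    {w : ℕ → α → ℝ} (hw : ∀ n, Measurable (w n)) {K₁ K₂ : ℝ≥0∞} (hK₁ : K₁ ≠ ∞) (hK₂ : K₂ ≠ ∞)
    (hbd1 : ∀ n, ∫⁻ x, ENNReal.ofReal (Φ |w n x|) ∂μ ≤ K₁)
    (hbd2 : ∀ n, ∫⁻ x, ENNReal.ofReal (Ψ |w n x|) ∂μ ≤ K₂)
    (hmeas : ∀ ε > 0, Tendsto (fun n => μ {x | ε < |w n x|}) atTop (𝓝 0)) :
    Tendsto (fun n => ∫⁻ x, ENNReal.ofReal (B |w n x|) ∂μ) atTop (𝓝 0) := by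
  refine ENNReal.tendsto_nhds_zero.2 fun η hη => ?_
  have hη2 : 0 < η / 2 := ENNReal.half_pos hη.ne'
  have hsmall : Tendsto (fun δ : ℝ => ENNReal.ofReal δ * (K₁ + K₂)) (𝓝[>] 0) (𝓝 0) := by
    have h : Tendsto ENNReal.ofReal (𝓝[>] 0) (𝓝 0) := by
      simpa using (ENNReal.continuous_ofReal.tendsto 0).mono_left nhdsWithin_le_nhds
    simpa using ENNReal.Tendsto.mul_const h (Or.inr (ENNReal.add_ne_top.2 ⟨hK₁, hK₂⟩))
  obtain ⟨δ, hδη, hδ⟩ :=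
    ((ENNReal.tendsto_nhds_zero.1 hsmall _ hη2).and self_mem_nhdsWithin).exists
  have hδ : 0 < δ := hδ
  obtain ⟨ε, hε, M, hBM⟩ := hB δ hδ
  have htail : Tendsto (fun n => ENNReal.ofReal M * μ {x | ε < |w n x|}) atTop (𝓝 0) := by
    simpa using ENNReal.Tendsto.const_mul (hmeas ε hε) (Or.inr ENNReal.ofReal_ne_top)
  filter_upwards [ENNReal.tendsto_nhds_zero.1 htail _ hη2] with n hn
  have hset : MeasurableSet {x | ε < |w n x|} := measurableSet_lt measurable_const (hw n).abs
  have hΦm : Measurable fun x => ENNReal.ofReal (Φ |w n x|) := (hΦ.comp (hw n).abs).ennreal_ofReal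
  have hΨm : Measurable fun x => ENNReal.ofReal (Ψ |w n x|) := (hΨ.comp (hw n).abs).ennreal_ofReal
  have hpt : ∀ x, ENNReal.ofReal (B |w n x|) ≤
      (ENNReal.ofReal δ * ENNReal.ofReal (Φ |w n x|) +
        ENNReal.ofReal δ * ENNReal.ofReal (Ψ |w n x|)) +
      {x | ε < |w n x|}.indicator (fun _ => ENNReal.ofReal M) x := by
    intro x
    refine (ENNReal.ofReal_le_ofReal (hBM _ (abs_nonneg _))).trans ?_
    rw [← ENNReal.ofReal_mul hδ.le, ← ENNReal.ofReal_mul hδ.le]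
    refine ENNReal.ofReal_add_le.trans (add_le_add ENNReal.ofReal_add_le ?_)
    by_cases hx : ε < |w n x| <;> simp [hx]
  calc ∫⁻ x, ENNReal.ofReal (B |w n x|) ∂μ
      ≤ _ := lintegral_mono hpt
    _ = (ENNReal.ofReal δ * ∫⁻ x, ENNReal.ofReal (Φ |w n x|) ∂μ +
          ENNReal.ofReal δ * ∫⁻ x, ENNReal.ofReal (Ψ |w n x|) ∂μ) +
        ENNReal.ofReal M * μ {x | ε < |w n x|} := by
      rw [lintegral_add_right _ (measurable_const.indicator hset),
        lintegral_add_right _ (hΨm.const_mul _), lintegral_const_mul _ hΦm,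
        lintegral_const_mul _ hΨm, lintegral_indicator_const hset]
    _ ≤ (ENNReal.ofReal δ * K₁ + ENNReal.ofReal δ * K₂) + η / 2 := by
      gcongr
      exacts [hbd1 n, hbd2 n]
    _ ≤ η / 2 + η / 2 := by
      rw [← mul_add]
      gcongr
    _ = η := ENNReal.add_halves η

/-- A Lions type result (Theorem 1.3): if `B(t)/Φ(t) → 0` at `0` and `B(t)/Ψ(t) → 0` at `∞`,
the modulars `∫ Φ(|w_n|)` and `∫ Ψ(|w_n|)` are bounded, and `mes([|w_n| > ε]) → 0` for each
`ε > 0`, then `∫ B(|w_n|) → 0`. -/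
theorem lions_type_nonreflexive (N : ℕ) (Φ Ψ B : ℝ → ℝ)
    (hΦ : IsNFunction Φ) (hΨ : IsNFunction Ψ) (hB : IsNFunction B)
    (hB0 : Tendsto (fun t => B t / Φ t) (𝓝[≠] (0 : ℝ)) (𝓝 0))
    (hBinf : Tendsto (fun t => B t / Ψ t) atTop (𝓝 0))
    (w : ℕ → EuclideanSpace ℝ (Fin N) → ℝ) (hw : ∀ n, Measurable (w n))
    (C₁ C₂ : ℝ)
    (hbd1 : ∀ n, ∫⁻ x, ENNReal.ofReal (Φ |w n x|) ≤ ENNReal.ofReal C₁)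
    (hbd2 : ∀ n, ∫⁻ x, ENNReal.ofReal (Ψ |w n x|) ≤ ENNReal.ofReal C₂)
    (hmeas : ∀ ε > 0, Tendsto (fun n => volume {x | ε < |w n x|}) atTop (𝓝 0)) :
    Tendsto (fun n => ∫⁻ x, ENNReal.ofReal (B |w n x|)) atTop (𝓝 0) := by
  obtain ⟨hΦc, -, hΦ0, hΦz, -⟩ := hΦ
  obtain ⟨hΨc, -, hΨ0, hΨz, -⟩ := hΨ
  obtain ⟨hBc, -, -, hBz, -⟩ := hB
  exact tendsto_lintegral_of_le_mul_add_indicator hΦc.measurable hΨc.measurable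
    (fun δ hδ => exists_le_mul_add_indicator hΦ0 (fun t => (hΦz t).1) hΨ0 (fun t => (hΨz t).1)
      hBc ((hBz 0).2 rfl) hB0 hBinf hδ)
    hw ENNReal.ofReal_ne_top ENNReal.ofReal_ne_top hbd1 hbd2 hmeas
end
end

section
/- Let Φ : ℝ → [0,∞) be a C¹ N-function and let (u_n) be a sequence of locally integrable functions ℝ^N → ℝ, each with a weak gradient g_n, such that ∫_{ℝ^N} Φ(‖g_n‖) dx ≤ M for all n and sup_n ∫_{ℝ^N} Φ(|u_n|) dx < ∞. If there are ε, δ > 0 such that the Lebesgue measure of {x : |u_n(x)| > ε} is at least δ for every n, then there exist a sequence (z_n) ⊂ ℤ^N, a subsequence (n_k), and a measurable function v : ℝ^N → ℝ with v ≠ 0 on a set of positive Lebesgue measure, such that the translates v_k(x) = u_{n_k}(x + z_{n_k}) converge to v in L^Φ_loc(ℝ^N); that is, for every compact set K ⊂ ℝ^N and every α > 0, ∫_K Φ(|v_k(x) − v(x)|/α) dx → 0 as k → ∞. -/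
open MeasureTheory Filter Topology ENNReal

noncomputable section

namespace IsNFunction

variable {Φ : ℝ → ℝ}

lemma apply_zero (hΦ : IsNFunction Φ) : Φ 0 = 0 := (hΦ.2.2.2.1 0).2 rfl

lemma apply_pos (hΦ : IsNFunction Φ) {t : ℝ} (ht : t ≠ 0) : 0 < Φ t :=
  lt_of_le_of_ne (hΦ.2.2.1 t) fun h => ht ((hΦ.2.2.2.1 t).1 h.symm)

lemma apply_mul_le (hΦ : IsNFunction Φ) {c : ℝ} (hc0 : 0 ≤ c) (hc1 : c ≤ 1) (t : ℝ) :
    Φ (c * t) ≤ c * Φ t := by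
  have h := hΦ.2.1.2 (Set.mem_univ t) (Set.mem_univ 0) hc0 (sub_nonneg.2 hc1) (by ring)
  simpa [hΦ.apply_zero] using h

lemma mono (hΦ : IsNFunction Φ) {s t : ℝ} (hs : 0 ≤ s) (hst : s ≤ t) : Φ s ≤ Φ t := by
  rcases hs.eq_or_lt with rfl | hs
  · rw [hΦ.apply_zero]; exact hΦ.2.2.1 t
  have ht : 0 < t := hs.trans_le hst
  have h := hΦ.apply_mul_le (div_nonneg hs.le ht.le) ((div_le_one ht).2 hst) t
  rw [div_mul_cancel₀ _ ht.ne'] at h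
  exact h.trans (mul_le_of_le_one_left (hΦ.2.2.1 t) ((div_le_one ht).2 hst))

lemma apply_abs (hΦ : IsNFunction Φ) (t : ℝ) : Φ |t| = Φ t := by
  rcases abs_choice t with h | h <;> rw [h]
  exact hΦ.2.2.2.2.1 t

lemma exists_le_add (hΦ : IsNFunction Φ) : ∃ T : ℝ, 0 ≤ T ∧ ∀ t, 0 ≤ t → t ≤ T + Φ t := by
  obtain ⟨T, hT⟩ := eventually_atTop.1 (hΦ.2.2.2.2.2.2.eventually_ge_atTop 1)
  refine ⟨max T 1, by positivity, fun t _ => ?_⟩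
  rcases le_total t (max T 1) with h | h
  · linarith [hΦ.2.2.1 t]
  · have ht : 0 < t := lt_of_lt_of_le (by positivity) h
    have := (one_le_div ht).1 (hT t ((le_max_left _ _).trans h))
    linarith [le_max_right T 1]

lemma apply_add_le (hΦ : IsNFunction Φ) (s t : ℝ) :
    Φ (s + t) ≤ 2⁻¹ * Φ (2 * s) + 2⁻¹ * Φ (2 * t) := by
  have h := hΦ.2.1.2 (Set.mem_univ (2 * s)) (Set.mem_univ (2 * t))
    (by norm_num : (0 : ℝ) ≤ 2⁻¹) (by norm_num : (0 : ℝ) ≤ 2⁻¹) (by norm_num)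
  simpa [smul_eq_mul, ← mul_assoc] using h

lemma apply_add_add_le (hΦ : IsNFunction Φ) (r s t : ℝ) :
    Φ (r + s + t) ≤ Φ (3 * r) + Φ (3 * s) + Φ (3 * t) := by
  have h1 := hΦ.apply_add_le (r + s) t
  have h2 := hΦ.2.1.2 (Set.mem_univ (3 * r)) (Set.mem_univ (3 * s))
    (by norm_num : (0 : ℝ) ≤ 2⁻¹) (by norm_num : (0 : ℝ) ≤ 2⁻¹) (by norm_num)
  have h3 := hΦ.2.1.2 (Set.mem_univ (2⁻¹ * (3 * r) + 2⁻¹ * (3 * s))) (Set.mem_univ (3 * t))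
    (by norm_num : (0 : ℝ) ≤ 2 / 3) (by norm_num : (0 : ℝ) ≤ 1 / 3) (by norm_num)
  simp only [smul_eq_mul] at h2 h3
  rw [show 2 / 3 * (2⁻¹ * (3 * r) + 2⁻¹ * (3 * s)) + 1 / 3 * (3 * t) = r + s + t by ring] at h3
  linarith [hΦ.2.2.1 (3 * r), hΦ.2.2.1 (3 * s), hΦ.2.2.1 (3 * t)]

lemma measurable_ofReal (hΦ : IsNFunction Φ) : Measurable fun t => ENNReal.ofReal (Φ t) :=
  hΦ.1.measurable.ennreal_ofReal

/-- Jensen's inequality for the norm of a vector-valued integral. -/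
lemma ofReal_apply_norm_integral_le (hΦ : IsNFunction Φ) {Ω F : Type*} [MeasurableSpace Ω]
    [NormedAddCommGroup F] [NormedSpace ℝ F] (P : Measure Ω) [IsProbabilityMeasure P] {f : Ω → F}
    (hf : Integrable f P) :
    ENNReal.ofReal (Φ ‖∫ z, f z ∂P‖) ≤ ∫⁻ z, ENNReal.ofReal (Φ ‖f z‖) ∂P := by
  have hm : AEStronglyMeasurable (fun z => Φ ‖f z‖) P :=
    hΦ.1.comp_aestronglyMeasurable hf.norm.aestronglyMeasurable
  by_cases htop : ∫⁻ z, ENNReal.ofReal (Φ ‖f z‖) ∂P = ⊤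
  · rw [htop]; exact le_top
  have hi : Integrable (fun z => Φ ‖f z‖) P :=
    ⟨hm, (hasFiniteIntegral_iff_ofReal (Eventually.of_forall fun z => hΦ.2.2.1 _)).2
      (lt_top_iff_ne_top.2 htop)⟩
  rw [← ofReal_integral_eq_lintegral_ofReal hi (Eventually.of_forall fun z => hΦ.2.2.1 _)]
  refine ENNReal.ofReal_le_ofReal ?_
  refine (hΦ.mono (norm_nonneg _) (norm_integral_le_integral_norm f)).trans ?_
  exact hΦ.2.1.map_integral_le hΦ.1.continuousOn isClosed_univ (by simp) hf.norm hi

/-- A modular bound that holds for almost every slice passes to the average of the slices. -/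
lemma lintegral_apply_norm_integral_le (hΦ : IsNFunction Φ) {Ω X F : Type*} [MeasurableSpace Ω]
    [MeasurableSpace X] [NormedAddCommGroup F] [NormedSpace ℝ F] [MeasurableSpace F] [BorelSpace F]
    (μ : Measure X) [SFinite μ] (P : Measure Ω) [IsProbabilityMeasure P] {f : X → Ω → F}
    (hf : Measurable (Function.uncurry f)) (hfi : ∀ x, Integrable (f x) P) {M : ℝ≥0∞}
    (hM : ∀ᵐ z ∂P, ∫⁻ x, ENNReal.ofReal (Φ ‖f x z‖) ∂μ ≤ M) :
    ∫⁻ x, ENNReal.ofReal (Φ ‖∫ z, f x z ∂P‖) ∂μ ≤ M := by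
  calc ∫⁻ x, ENNReal.ofReal (Φ ‖∫ z, f x z ∂P‖) ∂μ
      ≤ ∫⁻ x, ∫⁻ z, ENNReal.ofReal (Φ ‖f x z‖) ∂P ∂μ :=
        lintegral_mono fun x => hΦ.ofReal_apply_norm_integral_le P (hfi x)
    _ = ∫⁻ z, ∫⁻ x, ENNReal.ofReal (Φ ‖f x z‖) ∂μ ∂P :=
        lintegral_lintegral_swap (hΦ.measurable_ofReal.comp hf.norm).aemeasurable
    _ ≤ ∫⁻ _, M ∂P := lintegral_mono_ae hM
    _ = M := by simp

/-- Modulars at scale `α` are controlled by modulars at a smaller scale `h`. -/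
lemma lintegral_apply_div_le (hΦ : IsNFunction Φ) {X : Type*} [MeasurableSpace X]
    (μ : Measure X) (f : X → ℝ) {h α : ℝ} (hh : 0 < h) (hα : h ≤ α) {M : ℝ≥0∞}
    (hM : ∫⁻ x, ENNReal.ofReal (Φ (f x / h)) ∂μ ≤ M) :
    ∫⁻ x, ENNReal.ofReal (Φ (f x / α)) ∂μ ≤ ENNReal.ofReal (h / α) * M := by
  have hα0 : 0 < α := hh.trans_le hα
  calc ∫⁻ x, ENNReal.ofReal (Φ (f x / α)) ∂μ
      ≤ ∫⁻ x, ENNReal.ofReal (h / α) * ENNReal.ofReal (Φ (f x / h)) ∂μ := by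
        refine lintegral_mono fun x => ?_
        rw [← ENNReal.ofReal_mul (by positivity)]
        refine ENNReal.ofReal_le_ofReal ?_
        have := hΦ.apply_mul_le (c := h / α) (by positivity) ((div_le_one hα0).2 hα) (f x / h)
        rwa [show h / α * (f x / h) = f x / α by field_simp] at this
    _ = ENNReal.ofReal (h / α) * ∫⁻ x, ENNReal.ofReal (Φ (f x / h)) ∂μ :=
        lintegral_const_mul' _ _ ENNReal.ofReal_ne_top
    _ ≤ _ := by gcongr

end IsNFunction

section BumpMeasure

variable {E : Type*} [NormedAddCommGroup E] [InnerProductSpace ℝ E] [FiniteDimensional ℝ E]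
  [MeasurableSpace E] [BorelSpace E] (μ : Measure E)

/-- The probability measure whose density is a normalized bump function. -/
def bumpMeasure (φ : ContDiffBump (0 : E)) : Measure E :=
  μ.withDensity fun y => ENNReal.ofReal (φ.normed μ y)

lemma integral_bumpMeasure {F : Type*} [NormedAddCommGroup F] [NormedSpace ℝ F]
    (φ : ContDiffBump (0 : E)) (f : E → F) :
    ∫ y, f y ∂(bumpMeasure μ φ) = ∫ y, φ.normed μ y • f y ∂μ := by
  rw [bumpMeasure, integral_withDensity_eq_integral_toReal_smul
    φ.continuous_normed.measurable.ennreal_ofReal (by simp)]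
  simp [ENNReal.toReal_ofReal (φ.nonneg_normed _)]

/-- Mollification of a function by a normalized bump function. -/
def mollify {F : Type*} [NormedAddCommGroup F] [NormedSpace ℝ F] (φ : ContDiffBump (0 : E))
    (f : E → F) (x : E) : F :=
  ∫ y, f (x - y) ∂(bumpMeasure μ φ)

lemma mollify_eq_convolution {F : Type*} [NormedAddCommGroup F] [NormedSpace ℝ F]
    (φ : ContDiffBump (0 : E)) (f : E → F) :
    mollify μ φ f = convolution (φ.normed μ) f (ContinuousLinearMap.lsmul ℝ ℝ) μ := by
  ext x
  simp [mollify, integral_bumpMeasure, convolution_def]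

variable [μ.IsAddHaarMeasure]

lemma isProbabilityMeasure_bumpMeasure (φ : ContDiffBump (0 : E)) :
    IsProbabilityMeasure (bumpMeasure μ φ) := by
  refine ⟨?_⟩
  rw [bumpMeasure, withDensity_apply _ MeasurableSet.univ, Measure.restrict_univ,
    ← ofReal_integral_eq_lintegral_ofReal φ.integrable_normed
      (Eventually.of_forall φ.nonneg_normed), φ.integral_normed, ENNReal.ofReal_one]

lemma integrable_sub_bumpMeasure {F : Type*} [NormedAddCommGroup F] [NormedSpace ℝ F]
    (φ : ContDiffBump (0 : E)) {f : E → F} (hf : LocallyIntegrable f μ) (x : E) :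
    Integrable (fun y => f (x - y)) (bumpMeasure μ φ) := by
  rw [bumpMeasure, integrable_withDensity_iff_integrable_smul'
    φ.continuous_normed.measurable.ennreal_ofReal (by simp)]
  simp only [ENNReal.toReal_ofReal (φ.nonneg_normed _)]
  exact φ.hasCompactSupport_normed.convolutionExists_left (ContinuousLinearMap.lsmul ℝ ℝ)
    φ.continuous_normed hf x

lemma ae_bumpMeasure_norm_le (φ : ContDiffBump (0 : E)) :
    ∀ᵐ z ∂(bumpMeasure μ φ), ‖z‖ ≤ φ.rOut := by
  rw [bumpMeasure, ae_withDensity_iff φ.continuous_normed.measurable.ennreal_ofReal]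
  refine Eventually.of_forall fun z hz => ?_
  have : z ∈ Function.support (φ.normed μ) := by
    intro h; simp [h] at hz
  rw [φ.support_normed_eq] at this
  simpa using (Metric.mem_ball.1 this).le

lemma mollify_eq_integral_mul (φ : ContDiffBump (0 : E)) (f : E → ℝ) (x : E) :
    mollify μ φ f x = ∫ y, φ.normed μ (x - y) * f y ∂μ := by
  rw [mollify_eq_convolution, convolution_eq_swap]
  simp

end BumpMeasure

section BumpFamily

variable (E : Type*) [NormedAddCommGroup E]

/-- A sequence of bump functions centred at the origin, supported in the balls of radius
`2 ^ (-j)`. -/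
def dyadicBump (j : ℕ) : ContDiffBump (0 : E) where
  rIn := (1 / 2) ^ j / 2
  rOut := (1 / 2) ^ j
  rIn_pos := by positivity
  rIn_lt_rOut := half_lt_self (by positivity)

lemma tendsto_dyadicBump_rOut : Tendsto (fun j => (dyadicBump E j).rOut) atTop (𝓝 0) :=
  tendsto_pow_atTop_nhds_zero_of_lt_one (by norm_num) (by norm_num)

end BumpFamily

section Mollify

variable {E : Type*} [NormedAddCommGroup E] [InnerProductSpace ℝ E] [FiniteDimensional ℝ E]
  [MeasurableSpace E] [BorelSpace E] (μ : Measure E) [μ.IsAddHaarMeasure]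

lemma continuous_mollify {F : Type*} [NormedAddCommGroup F] [NormedSpace ℝ F]
    (φ : ContDiffBump (0 : E)) {f : E → F} (hf : LocallyIntegrable f μ) :
    Continuous (mollify μ φ f) := by
  rw [mollify_eq_convolution]
  exact φ.hasCompactSupport_normed.continuous_convolution_left _ φ.continuous_normed hf

lemma ae_tendsto_mollify_s3 {F : Type*} [NormedAddCommGroup F] [NormedSpace ℝ F] [CompleteSpace F]
    {f : E → F} (hf : LocallyIntegrable f μ) :
    ∀ᵐ x ∂μ, Tendsto (fun j => mollify μ (dyadicBump E j) f x) atTop (𝓝 (f x)) := by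
  simp only [mollify_eq_convolution]
  refine ContDiffBump.ae_convolution_tendsto_right_of_locallyIntegrable (K := 2)
    (tendsto_dyadicBump_rOut E) (Eventually.of_forall fun j => ?_) hf
  simp only [dyadicBump]
  linarith

end Mollify

/-- Mollification turns a weak gradient into a classical one. -/
lemma HasWeakGradient.hasFDerivAt_mollify {N : ℕ} {u : EuclideanSpace ℝ (Fin N) → ℝ}
    {g : EuclideanSpace ℝ (Fin N) → EuclideanSpace ℝ (Fin N)} (h : HasWeakGradient u g)
    (φ : ContDiffBump (0 : EuclideanSpace ℝ (Fin N))) (x : EuclideanSpace ℝ (Fin N)) :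
    HasFDerivAt (mollify volume φ u) (innerSL ℝ (mollify volume φ g x)) x := by
  obtain ⟨hu, hg, hw⟩ := h
  have hρ : ContDiff ℝ (⊤ : ℕ∞) (φ.normed volume) := φ.contDiff_normed
  have hρ1 : ContDiff ℝ 1 (φ.normed volume) := hρ.of_le (by exact_mod_cast le_top)
  have hd := φ.hasCompactSupport_normed.hasFDerivAt_convolution_left
    (ContinuousLinearMap.lsmul ℝ ℝ) hρ1 hu x
  rw [← mollify_eq_convolution] at hd
  suffices heq : innerSL ℝ (mollify volume φ g x) = convolution (fderiv ℝ (φ.normed volume)) u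
      ((ContinuousLinearMap.lsmul ℝ ℝ).precompL (EuclideanSpace ℝ (Fin N))) volume x by
    rw [heq]; exact hd
  apply ContinuousLinearMap.coe_injective
  refine (EuclideanSpace.basisFun (Fin N) ℝ).toBasis.ext fun i => ?_
  simp only [OrthonormalBasis.coe_toBasis, EuclideanSpace.basisFun_apply,
    ContinuousLinearMap.coe_coe, innerSL_apply_apply]
  have hex := (φ.hasCompactSupport_normed.fderiv ℝ).convolutionExists_left
    ((ContinuousLinearMap.lsmul ℝ ℝ).precompL (EuclideanSpace ℝ (Fin N)))
    (hρ1.continuous_fderiv one_ne_zero) hu x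
  have hsm : ContDiff ℝ (⊤ : ℕ∞) fun y => φ.normed volume (x - y) :=
    hρ.comp (contDiff_const.sub contDiff_id)
  have hcs : HasCompactSupport fun y => φ.normed volume (x - y) :=
    φ.hasCompactSupport_normed.comp_homeomorph (Homeomorph.subLeft x)
  have hfd : ∀ y, fderiv ℝ (fun y => φ.normed volume (x - y)) y (EuclideanSpace.single i 1)
      = - fderiv ℝ (φ.normed volume) (x - y) (EuclideanSpace.single i 1) := by
    intro y
    have h1 := (hρ1.differentiable one_ne_zero (x - y)).hasFDerivAt.comp y
      ((hasFDerivAt_id y).const_sub x)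
    refine (congrArg (fun A => A (EuclideanSpace.single i 1)) h1.fderiv).trans ?_
    simp
  have hwi := hw _ hsm hcs i
  simp only [hfd, mul_neg, integral_neg, neg_inj] at hwi
  have hgi := integrable_sub_bumpMeasure volume φ hg x
  calc inner ℝ (mollify volume φ g x) (EuclideanSpace.single i 1)
      = mollify volume φ g x i := by simp [EuclideanSpace.inner_single_right]
    _ = ∫ y, (g (x - y)) i ∂(bumpMeasure volume φ) := by
        exact ((EuclideanSpace.proj (𝕜 := ℝ) i).integral_comp_comm hgi).symm
    _ = mollify volume φ (fun y => g y i) x := rfl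
    _ = ∫ y, g y i * φ.normed volume (x - y) := by
        rw [mollify_eq_integral_mul]; simp only [mul_comm]
    _ = ∫ y, u y * fderiv ℝ (φ.normed volume) (x - y) (EuclideanSpace.single i 1) := hwi.symm
    _ = ∫ y, u (x - y) * fderiv ℝ (φ.normed volume) y (EuclideanSpace.single i 1) := by
        rw [← integral_sub_left_eq_self _ _ x]; simp
    _ = _ := by
        rw [convolution_def, ContinuousLinearMap.integral_apply hex]
        simp [mul_comm]

namespace IsNFunction

variable {Φ : ℝ → ℝ}

/-- Modular bounds are preserved by almost everywhere limits. -/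
lemma lintegral_apply_le_of_tendsto (hΦ : IsNFunction Φ) {X : Type*} [MeasurableSpace X]
    {μ : Measure X} {f : ℕ → X → ℝ} {f₀ : X → ℝ} (hf : ∀ n, Measurable (f n))
    (ht : ∀ᵐ x ∂μ, Tendsto (fun n => f n x) atTop (𝓝 (f₀ x))) {M : ℝ≥0∞}
    (hM : ∀ᶠ n in atTop, ∫⁻ x, ENNReal.ofReal (Φ (f n x)) ∂μ ≤ M) :
    ∫⁻ x, ENNReal.ofReal (Φ (f₀ x)) ∂μ ≤ M := by
  calc ∫⁻ x, ENNReal.ofReal (Φ (f₀ x)) ∂μ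
      = ∫⁻ x, liminf (fun n => ENNReal.ofReal (Φ (f n x))) atTop ∂μ := by
        refine lintegral_congr_ae ?_
        filter_upwards [ht] with x hx
        exact ((ENNReal.continuous_ofReal.comp hΦ.1).tendsto _ |>.comp hx).liminf_eq.symm
    _ ≤ liminf (fun n => ∫⁻ x, ENNReal.ofReal (Φ (f n x)) ∂μ) atTop :=
        lintegral_liminf_le fun n => hΦ.measurable_ofReal.comp (hf n)
    _ ≤ M := liminf_le_of_frequently_le' hM.frequently

variable {E : Type*} [NormedAddCommGroup E] [InnerProductSpace ℝ E] [FiniteDimensional ℝ E]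
  [MeasurableSpace E] [BorelSpace E] {μ : Measure E} [μ.IsAddHaarMeasure]

lemma lintegral_apply_norm_mollify_le (hΦ : IsNFunction Φ) {F : Type*} [NormedAddCommGroup F]
    [NormedSpace ℝ F] [MeasurableSpace F] [BorelSpace F] (φ : ContDiffBump (0 : E)) {g : E → F}
    (hg : Measurable g) (hgi : LocallyIntegrable g μ) {M : ℝ≥0∞}
    (hM : ∫⁻ x, ENNReal.ofReal (Φ ‖g x‖) ∂μ ≤ M) :
    ∫⁻ x, ENNReal.ofReal (Φ ‖mollify μ φ g x‖) ∂μ ≤ M := by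
  have := isProbabilityMeasure_bumpMeasure μ φ
  refine hΦ.lintegral_apply_norm_integral_le μ (bumpMeasure μ φ)
    (f := fun x z => g (x - z)) (hg.comp (measurable_fst.sub measurable_snd))
    (integrable_sub_bumpMeasure μ φ hgi)
    (Eventually.of_forall fun z => ?_)
  rwa [lintegral_sub_right_eq_self (fun x => ENNReal.ofReal (Φ ‖g x‖)) z]

/-- Difference quotients of a `C¹` function are controlled by its derivative. -/
lemma lintegral_apply_sub_le_of_hasFDerivAt (hΦ : IsNFunction Φ) {w : E → ℝ} {D : E → E →L[ℝ] ℝ}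
    (hw : ∀ x, HasFDerivAt w (D x) x) (hD : Continuous D) {M : ℝ≥0∞}
    (hM : ∫⁻ x, ENNReal.ofReal (Φ ‖D x‖) ∂μ ≤ M) {h : ℝ} (hh : 0 < h) {z : E} (hz : ‖z‖ ≤ h) :
    ∫⁻ x, ENNReal.ofReal (Φ ((w x - w (x - z)) / h)) ∂μ ≤ M := by
  have : IsProbabilityMeasure ((volume : Measure ℝ).restrict (Set.Ioc 0 1)) := ⟨by simp⟩
  have hc : Continuous fun p : E × ℝ => D (p.1 - z + p.2 • z) (h⁻¹ • z) :=
    (hD.comp (by fun_prop)).clm_apply continuous_const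
  have hc' : ∀ x, Continuous fun t : ℝ => D (x - z + t • z) (h⁻¹ • z) := fun x =>
    hc.comp (by fun_prop : Continuous fun t : ℝ => (x, t))
  have hint : ∀ x, ∫ t in Set.Ioc (0 : ℝ) 1, D (x - z + t • z) (h⁻¹ • z)
      = (w x - w (x - z)) / h := by
    intro x
    rw [← intervalIntegral.integral_of_le zero_le_one]
    have hderiv : ∀ t ∈ Set.uIcc (0 : ℝ) 1,
        HasDerivAt (fun t : ℝ => w (x - z + t • z) / h) (D (x - z + t • z) (h⁻¹ • z)) t := by
      intro t _
      have h1 : HasDerivAt (fun t : ℝ => x - z + t • z) z t := by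
        simpa using ((hasDerivAt_id t).smul_const z).const_add (x - z)
      have h2 := ((hw (x - z + t • z)).comp_hasDerivAt t h1).div_const h
      rw [map_smul, smul_eq_mul, mul_comm, ← div_eq_mul_inv]
      exact h2
    rw [intervalIntegral.integral_eq_sub_of_hasDerivAt hderiv
      ((hc' x).intervalIntegrable _ _)]
    simp [sub_div]
  have key := hΦ.lintegral_apply_norm_integral_le μ ((volume : Measure ℝ).restrict (Set.Ioc 0 1))
    (f := fun x t => D (x - z + t • z) (h⁻¹ • z)) hc.measurable
    (fun x => ((hc' x).integrableOn_Icc).mono_set Set.Ioc_subset_Icc_self) (M := M)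
    (Eventually.of_forall fun t => ?_)
  · simp only [hint, Real.norm_eq_abs, hΦ.apply_abs] at key
    exact key
  · calc ∫⁻ x, ENNReal.ofReal (Φ ‖D (x - z + t • z) (h⁻¹ • z)‖) ∂μ
        ≤ ∫⁻ x, ENNReal.ofReal (Φ ‖D (x - z + t • z)‖) ∂μ := by
          refine lintegral_mono fun x => ENNReal.ofReal_le_ofReal ?_
          refine hΦ.mono (norm_nonneg _) ((ContinuousLinearMap.le_opNorm _ _).trans ?_)
          refine mul_le_of_le_one_right (norm_nonneg _) ?_
          rw [norm_smul, norm_inv, Real.norm_of_nonneg hh.le, inv_mul_le_iff₀ hh, mul_one]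
          exact hz
      _ = ∫⁻ x, ENNReal.ofReal (Φ ‖D x‖) ∂μ := by
          simp only [sub_add]
          exact lintegral_sub_right_eq_self (fun x => ENNReal.ofReal (Φ ‖D x‖)) _
      _ ≤ M := hM

/-- Difference quotients are controlled by the weak gradient. -/
lemma lintegral_apply_sub_translate_le (hΦ : IsNFunction Φ) {N : ℕ}
    {u : EuclideanSpace ℝ (Fin N) → ℝ} {g : EuclideanSpace ℝ (Fin N) → EuclideanSpace ℝ (Fin N)}
    (hug : HasWeakGradient u g) (hg : Measurable g) {M : ℝ≥0∞}
    (hM : ∫⁻ x, ENNReal.ofReal (Φ ‖g x‖) ≤ M) {h : ℝ} (hh : 0 < h)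
    {z : EuclideanSpace ℝ (Fin N)} (hz : ‖z‖ ≤ h) :
    ∫⁻ x, ENNReal.ofReal (Φ ((u x - u (x - z)) / h)) ≤ M := by
  have hcu : ∀ j, Continuous (mollify volume (dyadicBump _ j) u) := fun j =>
    continuous_mollify volume _ hug.1
  have hae := ae_tendsto_mollify_s3 volume hug.1
  have hae' := (measurePreserving_sub_right volume z).quasiMeasurePreserving.ae hae
  refine hΦ.lintegral_apply_le_of_tendsto (f := fun j x =>
    (mollify volume (dyadicBump _ j) u x - mollify volume (dyadicBump _ j) u (x - z)) / h)
    (fun j => ?_) ?_ (Eventually.of_forall fun j => ?_)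
  · exact (((hcu j).sub ((hcu j).comp (by fun_prop))).div_const h).measurable
  · filter_upwards [hae, hae'] with x h1 h2
    exact (h1.sub h2).div_const h
  · refine hΦ.lintegral_apply_sub_le_of_hasFDerivAt (hug.hasFDerivAt_mollify _)
      ((innerSL ℝ).continuous.comp (continuous_mollify volume _ hug.2.1)) ?_ hh hz
    simp only [innerSL_apply_norm]
    exact hΦ.lintegral_apply_norm_mollify_le _ hg hug.2.1 hM

/-- Mollification error in terms of the weak gradient. -/
lemma lintegral_apply_sub_mollify_le (hΦ : IsNFunction Φ) {N : ℕ}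
    {u : EuclideanSpace ℝ (Fin N) → ℝ} {g : EuclideanSpace ℝ (Fin N) → EuclideanSpace ℝ (Fin N)}
    (hug : HasWeakGradient u g) (hu : Measurable u) (hg : Measurable g) {M : ℝ≥0∞}
    (hM : ∫⁻ x, ENNReal.ofReal (Φ ‖g x‖) ≤ M) (φ : ContDiffBump (0 : EuclideanSpace ℝ (Fin N))) :
    ∫⁻ x, ENNReal.ofReal (Φ ((u x - mollify volume φ u x) / φ.rOut)) ≤ M := by
  have := isProbabilityMeasure_bumpMeasure volume φ
  have hi := integrable_sub_bumpMeasure volume φ hug.1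
  have key := hΦ.lintegral_apply_norm_integral_le volume (bumpMeasure volume φ)
    (f := fun x z => (u x - u (x - z)) / φ.rOut) ?_
    (fun x => ((integrable_const _).sub (hi x)).div_const _) (M := M) ?_
  · have heq : ∀ x, ∫ z, (u x - u (x - z)) / φ.rOut ∂(bumpMeasure volume φ)
        = (u x - mollify volume φ u x) / φ.rOut := by
      intro x
      rw [integral_div, integral_sub (integrable_const _) (hi x)]
      simp [mollify]
    simp only [heq, Real.norm_eq_abs, hΦ.apply_abs] at key
    exact key
  · exact ((hu.comp measurable_fst).sub
      (hu.comp (measurable_fst.sub measurable_snd))).div_const _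
  · filter_upwards [ae_bumpMeasure_norm_le volume φ] with z hz
    simp only [Real.norm_eq_abs, hΦ.apply_abs]
    exact hΦ.lintegral_apply_sub_translate_le hug hg hM φ.rOut_pos hz

end IsNFunction

/-- A sequence of uniformly bounded, uniformly Lipschitz families of functions has a subsequence
along which every member of the family converges pointwise. -/
lemma exists_subseq_tendsto_of_lipschitzWith {X : Type*} [PseudoMetricSpace X]
    [TopologicalSpace.SeparableSpace X] (f : ℕ → ℕ → X → ℝ) (B : ℕ → ℝ) (L : ℕ → NNReal)
    (hB : ∀ k j x, |f k j x| ≤ B j) (hL : ∀ k j, LipschitzWith (L j) (f k j)) :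
    ∃ nk : ℕ → ℕ, StrictMono nk ∧ ∃ w : ℕ → X → ℝ,
      ∀ j x, Tendsto (fun k => f (nk k) j x) atTop (𝓝 (w j x)) := by
  rcases isEmpty_or_nonempty X with hX | hX
  · exact ⟨id, strictMono_id, fun _ _ => 0, fun _ x => isEmptyElim x⟩
  let q := TopologicalSpace.denseSeq X
  have hcpt : IsCompact (Set.pi Set.univ fun p : ℕ × ℕ => Set.Icc (-B p.1) (B p.1)) :=
    isCompact_univ_pi fun p => isCompact_Icc
  obtain ⟨a, -, nk, hnk, ha⟩ := hcpt.tendsto_subseq (x := fun k p => f k p.1 (q p.2))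
    fun k p _ => abs_le.1 (hB k p.1 _)
  refine ⟨nk, hnk, ?_⟩
  have hlim : ∀ j x, ∃ l, Tendsto (fun k => f (nk k) j x) atTop (𝓝 l) := by
    intro j x
    refine cauchySeq_tendsto_of_complete (Metric.cauchySeq_iff.2 fun e he => ?_)
    obtain ⟨m, hm⟩ := (TopologicalSpace.denseRange_denseSeq X).exists_dist_lt x
      (show 0 < e / (3 * (L j + 1)) by positivity)
    have hclose : ∀ k, dist (f (nk k) j x) (f (nk k) j (q m)) < e / 3 := by
      intro k
      calc dist (f (nk k) j x) (f (nk k) j (q m)) ≤ L j * dist x (q m) := (hL _ j).dist_le_mul _ _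
        _ ≤ (L j + 1) * dist x (q m) := by gcongr; linarith
        _ < (L j + 1) * (e / (3 * (L j + 1))) := by gcongr
        _ = e / 3 := by field_simp
    have hc : CauchySeq fun k => f (nk k) j (q m) :=
      (((continuous_apply (j, m)).tendsto a).comp ha).cauchySeq
    obtain ⟨K, hK⟩ := Metric.cauchySeq_iff.1 hc (e / 3) (by positivity)
    refine ⟨K, fun k hk l hl => ?_⟩
    have h1 := hclose k
    have h2 := hK k hk l hl
    have h3 := hclose l
    rw [dist_comm] at h3
    have h4 := dist_triangle4 (f (nk k) j x) (f (nk k) j (q m)) (f (nk l) j (q m)) (f (nk l) j x)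
    linarith
  choose w hw using hlim
  exact ⟨w, hw⟩

lemma abs_integral_mul_le {X : Type*} [MeasurableSpace X] {μ : Measure X} {k f : X → ℝ}
    {S : Set X} {B : ℝ} (hk : ∀ y, |k y| ≤ B) (hk0 : ∀ y ∉ S, k y = 0)
    (hf : IntegrableOn f S μ) : |∫ y, k y * f y ∂μ| ≤ B * ∫ y in S, |f y| ∂μ := by
  rw [← setIntegral_eq_integral_of_forall_compl_eq_zero (s := S)
    (fun y hy => by rw [hk0 y hy, zero_mul]), ← integral_const_mul, ← Real.norm_eq_abs]
  refine norm_integral_le_of_norm_le (hf.abs.const_mul B) (Eventually.of_forall fun y => ?_)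
  rw [Real.norm_eq_abs, abs_mul]
  exact mul_le_mul_of_nonneg_right (hk y) (abs_nonneg _)

lemma IsNFunction.lintegral_enorm_le {Φ : ℝ → ℝ} (hΦ : IsNFunction Φ) {T : ℝ}
    (hT0 : 0 ≤ T) (hT : ∀ t, 0 ≤ t → t ≤ T + Φ t) {X : Type*} [MeasurableSpace X] (ν : Measure X)
    {f : X → ℝ} {h : ℝ} (hh : 0 < h) {M : ℝ≥0∞}
    (hM : ∫⁻ x, ENNReal.ofReal (Φ (f x / h)) ∂ν ≤ M) :
    ∫⁻ x, ‖f x‖ₑ ∂ν ≤ ENNReal.ofReal h * (ENNReal.ofReal T * ν Set.univ + M) := by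
  calc ∫⁻ x, ‖f x‖ₑ ∂ν
      ≤ ∫⁻ x, ENNReal.ofReal h * (ENNReal.ofReal T + ENNReal.ofReal (Φ (f x / h))) ∂ν := by
        refine lintegral_mono fun x => ?_
        rw [← ENNReal.ofReal_add hT0 (hΦ.2.2.1 _), ← ENNReal.ofReal_mul hh.le,
          Real.enorm_eq_ofReal_abs]
        refine ENNReal.ofReal_le_ofReal ?_
        have := hT |f x / h| (abs_nonneg _)
        rw [hΦ.apply_abs, abs_div, abs_of_pos hh, div_le_iff₀ hh] at this
        linarith
    _ = ENNReal.ofReal h * (ENNReal.ofReal T * ν Set.univ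
          + ∫⁻ x, ENNReal.ofReal (Φ (f x / h)) ∂ν) := by
        rw [lintegral_const_mul' _ _ ENNReal.ofReal_ne_top, lintegral_add_left measurable_const,
          lintegral_const]
    _ ≤ _ := by gcongr

section Compactness

variable {E : Type*} [NormedAddCommGroup E] [InnerProductSpace ℝ E] [FiniteDimensional ℝ E]
  [MeasurableSpace E] [BorelSpace E] {μ : Measure E} [μ.IsAddHaarMeasure]

lemma normed_sub_eq_zero_of_notMem {φ : ContDiffBump (0 : E)} {r : ℝ} (hr : φ.rOut ≤ r) {x y : E}
    (hy : y ∉ Metric.closedBall x r) : φ.normed μ (x - y) = 0 := by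
  by_contra h
  have : x - y ∈ Function.support (φ.normed μ) := h
  rw [φ.support_normed_eq, mem_ball_zero_iff] at this
  exact hy (by rw [Metric.mem_closedBall, dist_comm, dist_eq_norm]; linarith)

lemma integrable_normed_mul (φ : ContDiffBump (0 : E)) {f : E → ℝ} (hf : LocallyIntegrable f μ)
    (x : E) : Integrable (fun y => φ.normed μ (x - y) * f y) μ :=
  (φ.hasCompactSupport_normed.convolutionExists_left (ContinuousLinearMap.lsmul ℝ ℝ)
    φ.continuous_normed hf x).integrable_swap

variable (μ) in
/-- A mollification is bounded by a local `L¹` norm. -/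
lemma exists_abs_mollify_le (φ : ContDiffBump (0 : E)) : ∃ B : ℝ, 0 ≤ B ∧
    ∀ f : E → ℝ, LocallyIntegrable f μ → ∀ x,
      |mollify μ φ f x| ≤ B * ∫ y in Metric.closedBall x φ.rOut, |f y| ∂μ := by
  obtain ⟨B, hB⟩ := φ.hasCompactSupport_normed.exists_bound_of_continuous
    (φ.continuous_normed (μ := μ))
  refine ⟨B, (norm_nonneg _).trans (hB 0), fun f hf x => ?_⟩
  rw [mollify_eq_integral_mul]
  exact abs_integral_mul_le (fun y => hB _)
    (fun y hy => normed_sub_eq_zero_of_notMem le_rfl hy)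
    (hf.integrableOn_isCompact (isCompact_closedBall x _))

variable (μ) in
/-- The Lipschitz constant of a mollification is bounded by local `L¹` norms. -/
lemma exists_lipschitzWith_mollify (φ : ContDiffBump (0 : E)) : ∃ L : NNReal,
    ∀ (f : E → ℝ) (D : NNReal), LocallyIntegrable f μ →
      (∀ x, ∫ y in Metric.closedBall x φ.rOut, |f y| ∂μ ≤ D) →
      LipschitzWith (L * (D + D)) (mollify μ φ f) := by
  obtain ⟨L, hL⟩ := ContDiff.lipschitzWith_of_hasCompactSupport (𝕂 := ℝ)
    (φ.hasCompactSupport_normed (μ := μ)) (φ.contDiff_normed (n := 1)) one_ne_zero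
  refine ⟨L, fun f D hf hD => LipschitzWith.of_dist_le_mul fun x x' => ?_⟩
  have hb : ∀ z, IntegrableOn f (Metric.closedBall z φ.rOut) μ := fun z =>
    hf.integrableOn_isCompact (isCompact_closedBall z _)
  rw [Real.dist_eq, mollify_eq_integral_mul, mollify_eq_integral_mul,
    ← integral_sub (integrable_normed_mul φ hf x) (integrable_normed_mul φ hf x')]
  simp only [← sub_mul]
  have h1 := abs_integral_mul_le (μ := μ)
    (k := fun y => φ.normed μ (x - y) - φ.normed μ (x' - y)) (f := f) (B := L * dist x x')
    (S := Metric.closedBall x φ.rOut ∪ Metric.closedBall x' φ.rOut)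
    (fun y => ?_) (fun y hy => ?_) ((hb x).union (hb x'))
  · refine h1.trans ?_
    have h2 : ∫ y in Metric.closedBall x φ.rOut ∪ Metric.closedBall x' φ.rOut, |f y| ∂μ
        ≤ D + D := by
      refine le_trans ?_ (add_le_add (hD x) (hD x'))
      rw [← integral_add_measure (hb x).abs (hb x').abs]
      exact integral_mono_measure (Measure.restrict_union_le _ _)
        (Eventually.of_forall fun _ => abs_nonneg _) ((hb x).abs.add_measure (hb x').abs)
    calc (L : ℝ) * dist x x' * ∫ y in _, |f y| ∂μ ≤ L * dist x x' * (D + D) := by gcongr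
      _ = _ := by push_cast; ring
  · rw [← Real.dist_eq]
    simpa using hL.dist_le_mul (x - y) (x' - y)
  · rw [Set.mem_union, not_or] at hy
    rw [normed_sub_eq_zero_of_notMem le_rfl hy.1, normed_sub_eq_zero_of_notMem le_rfl hy.2,
      sub_zero]

end Compactness

section LocalCompactness

variable {E : Type*} [NormedAddCommGroup E] [InnerProductSpace ℝ E] [FiniteDimensional ℝ E]
  [MeasurableSpace E] [BorelSpace E] {μ : Measure E} [μ.IsAddHaarMeasure]

/-- Mollifications at a fixed scale of a modular-bounded sequence have a common pointwise
convergent subsequence. -/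
lemma exists_subseq_tendsto_mollify {Φ : ℝ → ℝ} (hΦ : IsNFunction Φ) {v : ℕ → E → ℝ}
    (hv : ∀ k, LocallyIntegrable (v k) μ) {C : ℝ≥0∞} (hC : C ≠ ⊤)
    (hvC : ∀ k, ∫⁻ x, ENNReal.ofReal (Φ (v k x)) ∂μ ≤ C) :
    ∃ (B : ℕ → ℝ) (nk : ℕ → ℕ) (w : ℕ → E → ℝ), StrictMono nk ∧
      (∀ k j x, |mollify μ (dyadicBump E j) (v k) x| ≤ B j) ∧
      ∀ j x, Tendsto (fun k => mollify μ (dyadicBump E j) (v (nk k)) x) atTop (𝓝 (w j x)) := by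
  obtain ⟨T, hT0, hT⟩ := hΦ.exists_le_add
  let D' : ℕ → ℝ≥0∞ := fun j => ENNReal.ofReal 1 *
    (ENNReal.ofReal T * μ (Metric.closedBall 0 (dyadicBump E j).rOut) + C)
  have hD' : ∀ j, D' j ≠ ⊤ := fun j => ENNReal.mul_ne_top ENNReal.ofReal_ne_top
    (ENNReal.add_ne_top.2 ⟨ENNReal.mul_ne_top ENNReal.ofReal_ne_top
      (isCompact_closedBall _ _).measure_lt_top.ne, hC⟩)
  have hD : ∀ k j x, ∫ y in Metric.closedBall x (dyadicBump E j).rOut, |v k y| ∂μ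
      ≤ (D' j).toNNReal := by
    intro k j x
    have h := hΦ.lintegral_enorm_le hT0 hT
      (μ.restrict (Metric.closedBall x (dyadicBump E j).rOut)) (f := v k) one_pos (M := C)
      (by simpa using (setLIntegral_le_lintegral _ _).trans (hvC k))
    rw [Measure.restrict_apply_univ, Measure.addHaar_closedBall_center] at h
    simp only [← Real.norm_eq_abs]
    rw [integral_norm_eq_lintegral_enorm ((hv k).aestronglyMeasurable.restrict)]
    exact ENNReal.toReal_mono (hD' j) h
  choose B₀ hB₀ hB using fun j => exists_abs_mollify_le μ (dyadicBump E j)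
  choose L hL using fun j => exists_lipschitzWith_mollify μ (dyadicBump E j)
  have hbound : ∀ k j x, |mollify μ (dyadicBump E j) (v k) x| ≤ B₀ j * (D' j).toNNReal :=
    fun k j x => (hB j _ (hv k) x).trans (mul_le_mul_of_nonneg_left (hD k j x) (hB₀ j))
  obtain ⟨nk, hnk, w, hw⟩ := exists_subseq_tendsto_of_lipschitzWith
    (fun k j => mollify μ (dyadicBump E j) (v k)) _ _ hbound
    (fun k j => hL j _ _ (hv k) (hD k j))
  exact ⟨_, nk, w, hnk, hbound, hw⟩

/-- Rellich-type compactness: a modular-bounded sequence whose mollification errors are controlled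
uniformly has a subsequence converging locally at every modular scale. -/
lemma exists_subseq_tendsto_lintegral {Φ : ℝ → ℝ} (hΦ : IsNFunction Φ) {v : ℕ → E → ℝ}
    (hvm : ∀ k, Measurable (v k)) (hv : ∀ k, LocallyIntegrable (v k) μ) {C M : ℝ≥0∞}
    (hC : C ≠ ⊤) (hM : M ≠ ⊤) (hvC : ∀ k, ∫⁻ x, ENNReal.ofReal (Φ (v k x)) ∂μ ≤ C)
    (hvM : ∀ k j, ∫⁻ x, ENNReal.ofReal
      (Φ ((v k x - mollify μ (dyadicBump E j) (v k) x) / (dyadicBump E j).rOut)) ∂μ ≤ M) :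
    ∃ (nk : ℕ → ℕ) (v₀ : E → ℝ), StrictMono nk ∧ Measurable v₀ ∧
      ∀ K : Set E, IsCompact K → ∀ α > (0 : ℝ), Tendsto (fun k => ∫⁻ x in K,
        ENNReal.ofReal (Φ ((v (nk k) x - v₀ x) / α)) ∂μ) atTop (𝓝 0) := by
  obtain ⟨T, hT0, hT⟩ := hΦ.exists_le_add
  obtain ⟨B, nk, w, hnk, hB, hw⟩ := exists_subseq_tendsto_mollify hΦ hv hC hvC
  set r : ℕ → ℝ := fun j => (dyadicBump E j).rOut with hr
  have hr0 : ∀ j, 0 < r j := fun j => (dyadicBump E j).rOut_pos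
  have hrle : ∀ {i j}, i ≤ j → r j ≤ r i := fun h =>
    pow_le_pow_of_le_one (by norm_num) (by norm_num) h
  have hrt : Tendsto r atTop (𝓝 0) := tendsto_dyadicBump_rOut E
  set m : ℕ → ℕ → E → ℝ := fun k j => mollify μ (dyadicBump E j) (v (nk k)) with hm
  have hmm : ∀ k j, Measurable (m k j) := fun k j => (continuous_mollify μ _ (hv _)).measurable
  have hwm : ∀ j, Measurable (w j) := fun j =>
    measurable_of_tendsto_metrizable (fun k => hmm k j) (tendsto_pi_nhds.2 (hw j))
  have hwB : ∀ j x, |w j x| ≤ B j := fun j x =>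
    le_of_tendsto (hw j x).abs (Eventually.of_forall fun k => hB _ j x)
  have herr : ∀ k {i j}, i ≤ j →
      ∫⁻ x, ENNReal.ofReal (Φ ((v (nk k) x - m k j x) / r i)) ∂μ ≤ M := by
    intro k i j hij
    refine (hΦ.lintegral_apply_div_le μ _ (hr0 j) (hrle hij) (hvM (nk k) j)).trans ?_
    refine mul_le_of_le_one_left zero_le ?_
    rw [ENNReal.ofReal_le_one, div_le_one (hr0 i)]
    exact hrle hij
  have hpair : ∀ k {i j l}, i ≤ j → i ≤ l →
      ∫⁻ x, ENNReal.ofReal (Φ ((m k j x - m k l x) / (2 * r i))) ∂μ ≤ M := by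
    intro k i j l hij hil
    have hmeas : Measurable fun x =>
        ENNReal.ofReal 2⁻¹ * ENNReal.ofReal (Φ ((v (nk k) x - m k j x) / r i)) :=
      (hΦ.measurable_ofReal.comp (((hvm _).sub (hmm k j)).div_const _)).const_mul _
    calc ∫⁻ x, ENNReal.ofReal (Φ ((m k j x - m k l x) / (2 * r i))) ∂μ
        ≤ ∫⁻ x, (ENNReal.ofReal 2⁻¹ * ENNReal.ofReal (Φ ((v (nk k) x - m k j x) / r i)) +
          ENNReal.ofReal 2⁻¹ * ENNReal.ofReal (Φ ((v (nk k) x - m k l x) / r i))) ∂μ := by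
          refine lintegral_mono fun x => ?_
          rw [← ENNReal.ofReal_mul (by norm_num), ← ENNReal.ofReal_mul (by norm_num),
            ← ENNReal.ofReal_add (mul_nonneg (by norm_num) (hΦ.2.2.1 _))
              (mul_nonneg (by norm_num) (hΦ.2.2.1 _))]
          refine ENNReal.ofReal_le_ofReal ?_
          have h := hΦ.apply_add_le (-((v (nk k) x - m k j x) / (2 * r i)))
            ((v (nk k) x - m k l x) / (2 * r i))
          have hri := (hr0 i).ne'
          rw [show -((v (nk k) x - m k j x) / (2 * r i)) + (v (nk k) x - m k l x) / (2 * r i)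
              = (m k j x - m k l x) / (2 * r i) by ring,
            show 2 * -((v (nk k) x - m k j x) / (2 * r i))
              = -((v (nk k) x - m k j x) / r i) by field_simp,
            show 2 * ((v (nk k) x - m k l x) / (2 * r i))
              = (v (nk k) x - m k l x) / r i by field_simp, hΦ.2.2.2.2.1] at h
          exact h
      _ = ENNReal.ofReal 2⁻¹ * ∫⁻ x, ENNReal.ofReal (Φ ((v (nk k) x - m k j x) / r i)) ∂μ +
          ENNReal.ofReal 2⁻¹ * ∫⁻ x, ENNReal.ofReal (Φ ((v (nk k) x - m k l x) / r i)) ∂μ := by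
          rw [lintegral_add_left hmeas, lintegral_const_mul' _ _ ENNReal.ofReal_ne_top,
            lintegral_const_mul' _ _ ENNReal.ofReal_ne_top]
      _ ≤ ENNReal.ofReal 2⁻¹ * M + ENNReal.ofReal 2⁻¹ * M := by
          gcongr
          · exact herr k hij
          · exact herr k hil
      _ = M := by
          rw [← add_mul, ← ENNReal.ofReal_add (by norm_num) (by norm_num)]
          norm_num
  have hwpair : ∀ {i j l}, i ≤ j → i ≤ l →
      ∫⁻ x, ENNReal.ofReal (Φ ((w j x - w l x) / (2 * r i))) ∂μ ≤ M := by
    intro i j l hij hil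
    exact hΦ.lintegral_apply_le_of_tendsto
      (f := fun k x => (m k j x - m k l x) / (2 * r i))
      (fun k => ((hmm k j).sub (hmm k l)).div_const _)
      (Eventually.of_forall fun x => ((hw j x).sub (hw l x)).div_const _)
      (Eventually.of_forall fun k => hpair k hij hil)
  have hae : ∀ᵐ x ∂μ, ∃ l, Tendsto (fun j => w j x) atTop (𝓝 l) := by
    have hball : ∀ R : ℕ, ∀ᵐ x ∂(μ.restrict (Metric.closedBall 0 (R : ℝ))),
        ∃ l, Tendsto (fun j => w j x) atTop (𝓝 l) := by
      intro R
      set D : ℝ≥0∞ := ENNReal.ofReal T * μ (Metric.closedBall 0 (R : ℝ)) + M + 1 with hD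
      have hD0 : ENNReal.ofReal T * μ (Metric.closedBall 0 (R : ℝ)) + M ≠ ⊤ :=
        ENNReal.add_ne_top.2 ⟨ENNReal.mul_ne_top ENNReal.ofReal_ne_top
          (isCompact_closedBall _ _).measure_lt_top.ne, hM⟩
      refine Lp.ae_tendsto_of_cauchy_eLpNorm (p := 1)
        (B := fun n => ENNReal.ofReal (2 * r n) * D)
        (fun n => (hwm n).aestronglyMeasurable) le_rfl ?_ fun n j l hj hl => ?_
      · rw [ENNReal.tsum_mul_right]
        have hs : Summable fun n => 2 * r n :=
          (summable_geometric_of_lt_one (by norm_num) (by norm_num)).mul_left 2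
        rw [← ENNReal.ofReal_tsum_of_nonneg (fun n => by have := hr0 n; positivity) hs]
        exact ENNReal.mul_ne_top ENNReal.ofReal_ne_top
          (ENNReal.add_ne_top.2 ⟨hD0, ENNReal.one_ne_top⟩)
      · have hrn : 0 < 2 * r n := by have := hr0 n; positivity
        rw [eLpNorm_one_eq_lintegral_enorm]
        refine (hΦ.lintegral_enorm_le hT0 hT _ (f := w j - w l) hrn
          ((setLIntegral_le_lintegral _ _).trans (hwpair hj hl))).trans_lt ?_
        rw [Measure.restrict_apply_univ]
        exact ENNReal.mul_lt_mul_right (ENNReal.ofReal_pos.2 hrn).ne' ENNReal.ofReal_ne_top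
          (ENNReal.lt_add_right hD0 one_ne_zero)
    have hall := ae_all_iff.2 fun R : ℕ =>
      (ae_restrict_iff' (Metric.isClosed_closedBall (x := (0 : E)).measurableSet)).1 (hball R)
    filter_upwards [hall] with x hx
    obtain ⟨R, hR⟩ := exists_nat_ge ‖x‖
    exact hx R (by simpa using hR)
  obtain ⟨v₀, hv₀m, hv₀⟩ := measurable_limit_of_tendsto_metrizable_ae
    (fun j => (hwm j).aemeasurable) hae
  have hwv : ∀ j, ∫⁻ x, ENNReal.ofReal (Φ ((w j x - v₀ x) / (2 * r j))) ∂μ ≤ M := by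
    intro j
    refine hΦ.lintegral_apply_le_of_tendsto (f := fun l x => (w j x - w l x) / (2 * r j))
      (fun l => ((hwm j).sub (hwm l)).div_const _) ?_
      ((eventually_ge_atTop j).mono fun l hl => hwpair le_rfl hl)
    filter_upwards [hv₀] with x hx
    exact (tendsto_const_nhds.sub hx).div_const _
  refine ⟨nk, v₀, hnk, hv₀m, fun K hK α hα => ?_⟩
  have hβ : 0 < α / 3 := by positivity
  set β := α / 3 with hβdef
  rw [ENNReal.tendsto_nhds_zero]
  intro e he
  have he3 : 0 < e / 3 := ENNReal.div_pos he.ne' (by norm_num)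
  have hsmall : Tendsto (fun j => ENNReal.ofReal (2 * r j / β) * M) atTop (𝓝 0) := by
    have h1 : Tendsto (fun j => 2 * r j / β) atTop (𝓝 0) := by
      simpa using (hrt.const_mul 2).div_const β
    have h2 := ENNReal.Tendsto.mul_const (ENNReal.tendsto_ofReal h1) (Or.inr hM)
    simpa using h2
  obtain ⟨j, hj1, hj2⟩ := ((ENNReal.tendsto_nhds_zero.1 hsmall (e / 3) he3).and
    ((hrt.const_mul 2).eventually (ge_mem_nhds (by simpa using hβ)))).exists
  have hrj := hr0 j
  have hmid : Tendsto (fun k => ∫⁻ x in K, ENNReal.ofReal (Φ ((m k j x - w j x) / β)) ∂μ) atTop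
      (𝓝 0) := by
    have hlim : ∀ x, Tendsto (fun k => ENNReal.ofReal (Φ ((m k j x - w j x) / β))) atTop
        (𝓝 0) := by
      intro x
      have h1 : Tendsto (fun k => (m k j x - w j x) / β) atTop (𝓝 0) := by
        simpa using ((hw j x).sub_const (w j x)).div_const β
      have h2 := ((ENNReal.continuous_ofReal.comp hΦ.1).tendsto 0).comp h1
      simpa [Function.comp_def, hΦ.apply_zero] using h2
    have h := tendsto_lintegral_of_dominated_convergence (μ := μ.restrict K)
      (F := fun k x => ENNReal.ofReal (Φ ((m k j x - w j x) / β))) (f := fun _ => 0)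
      (fun _ => ENNReal.ofReal (Φ ((B j + B j) / β)))
      (fun k => hΦ.measurable_ofReal.comp (((hmm k j).sub (hwm j)).div_const _))
      (fun k => Eventually.of_forall fun x => ENNReal.ofReal_le_ofReal ?_) ?_
      (Eventually.of_forall hlim)
    · simpa using h
    · rw [← hΦ.apply_abs ((m k j x - w j x) / β), abs_div, abs_of_pos hβ]
      refine hΦ.mono (by positivity) ?_
      gcongr
      exact (abs_sub _ _).trans (add_le_add (hB _ j x) (hwB j x))
    · rw [lintegral_const, Measure.restrict_apply_univ]
      exact ENNReal.mul_ne_top ENNReal.ofReal_ne_top hK.measure_lt_top.ne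
  filter_upwards [ENNReal.tendsto_nhds_zero.1 hmid (e / 3) he3] with k hk
  have hm1 : Measurable fun x => ENNReal.ofReal (Φ ((v (nk k) x - m k j x) / β)) :=
    hΦ.measurable_ofReal.comp (((hvm _).sub (hmm k j)).div_const _)
  have hm2 : Measurable fun x => ENNReal.ofReal (Φ ((m k j x - w j x) / β)) :=
    hΦ.measurable_ofReal.comp (((hmm k j).sub (hwm j)).div_const _)
  have hfirst : ∫⁻ x in K, ENNReal.ofReal (Φ ((v (nk k) x - m k j x) / β)) ∂μ ≤ e / 3 := by
    refine (setLIntegral_le_lintegral _ _).trans (le_trans ?_ hj1)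
    refine (hΦ.lintegral_apply_div_le μ _ hrj (by linarith) (herr k le_rfl)).trans ?_
    gcongr
    linarith
  have hthird : ∫⁻ x in K, ENNReal.ofReal (Φ ((w j x - v₀ x) / β)) ∂μ ≤ e / 3 := by
    refine (setLIntegral_le_lintegral _ _).trans (le_trans ?_ hj1)
    exact hΦ.lintegral_apply_div_le μ _ (by positivity) hj2 (hwv j)
  calc ∫⁻ x in K, ENNReal.ofReal (Φ ((v (nk k) x - v₀ x) / α)) ∂μ
      ≤ ∫⁻ x in K, (ENNReal.ofReal (Φ ((v (nk k) x - m k j x) / β)) +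
          ENNReal.ofReal (Φ ((m k j x - w j x) / β)) +
          ENNReal.ofReal (Φ ((w j x - v₀ x) / β))) ∂μ := by
        refine lintegral_mono fun x => ?_
        rw [← ENNReal.ofReal_add (hΦ.2.2.1 _) (hΦ.2.2.1 _),
          ← ENNReal.ofReal_add (add_nonneg (hΦ.2.2.1 _) (hΦ.2.2.1 _)) (hΦ.2.2.1 _)]
        refine ENNReal.ofReal_le_ofReal ?_
        have h := hΦ.apply_add_add_le ((v (nk k) x - m k j x) / α) ((m k j x - w j x) / α)
          ((w j x - v₀ x) / α)
        have h3 : ∀ t : ℝ, 3 * (t / α) = t / β := fun t => by rw [hβdef]; field_simp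
        rw [h3, h3, h3, show (v (nk k) x - m k j x) / α + (m k j x - w j x) / α
          + (w j x - v₀ x) / α = (v (nk k) x - v₀ x) / α by ring] at h
        exact h
    _ ≤ e / 3 + e / 3 + e / 3 := by
        have hm12 : Measurable fun x => ENNReal.ofReal (Φ ((v (nk k) x - m k j x) / β)) +
            ENNReal.ofReal (Φ ((m k j x - w j x) / β)) := hm1.add hm2
        rw [lintegral_add_left hm12, lintegral_add_left hm1]
        exact add_le_add (add_le_add hfirst hk) hthird
    _ = e := ENNReal.add_thirds e

end LocalCompactness

section LocalIntegrability

variable {E : Type*} [MeasurableSpace E] {μ : Measure E}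

lemma IsNFunction.locallyIntegrable [NormedAddCommGroup E] [InnerProductSpace ℝ E]
    [FiniteDimensional ℝ E] [IsFiniteMeasureOnCompacts μ] {Φ : ℝ → ℝ} (hΦ : IsNFunction Φ)
    {f : E → ℝ} (hf : Measurable f) {C : ℝ≥0∞} (hC : C ≠ ⊤)
    (h : ∫⁻ x, ENNReal.ofReal (Φ (f x)) ∂μ ≤ C) : LocallyIntegrable f μ := by
  obtain ⟨T, hT0, hT⟩ := hΦ.exists_le_add
  refine locallyIntegrable_iff.2 fun K hK => ⟨hf.aestronglyMeasurable, ?_⟩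
  refine (hΦ.lintegral_enorm_le hT0 hT (μ.restrict K) (f := f) one_pos (M := C)
    (by simpa using (setLIntegral_le_lintegral _ _).trans h)).trans_lt ?_
  rw [Measure.restrict_apply_univ]
  exact ENNReal.mul_lt_top ENNReal.ofReal_lt_top (ENNReal.add_lt_top.2
    ⟨ENNReal.mul_lt_top ENNReal.ofReal_lt_top hK.measure_lt_top, hC.lt_top⟩)

/-- On a set of finite measure, convergence to zero in modular implies convergence to zero in
mean. -/
lemma IsNFunction.tendsto_setLIntegral_enorm {Φ : ℝ → ℝ} (hΦ : IsNFunction Φ) {K : Set E}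
    (hK : μ K ≠ ⊤) {v : ℕ → E → ℝ}
    (hv : ∀ α > (0 : ℝ), Tendsto (fun k => ∫⁻ x in K, ENNReal.ofReal (Φ (v k x / α)) ∂μ)
      atTop (𝓝 0)) :
    Tendsto (fun k => ∫⁻ x in K, ‖v k x‖ₑ ∂μ) atTop (𝓝 0) := by
  obtain ⟨T, hT0, hT⟩ := hΦ.exists_le_add
  set D : ℝ≥0∞ := ENNReal.ofReal T * μ K + 1 with hD
  have hDtop : D ≠ ⊤ := ENNReal.add_ne_top.2
    ⟨ENNReal.mul_ne_top ENNReal.ofReal_ne_top hK, ENNReal.one_ne_top⟩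
  rw [ENNReal.tendsto_nhds_zero]
  intro e he
  have hlim : Tendsto (fun α : ℝ => ENNReal.ofReal α * D) (𝓝[>] 0) (𝓝 0) := by
    have h := ENNReal.Tendsto.mul_const (b := D)
      (ENNReal.tendsto_ofReal (tendsto_id (α := ℝ) (x := 𝓝 0))) (Or.inr hDtop)
    simpa using h.mono_left (nhdsWithin_le_nhds (s := Set.Ioi 0))
  obtain ⟨α, hαe, hα⟩ :=
    ((ENNReal.tendsto_nhds_zero.1 hlim e he).and self_mem_nhdsWithin).exists
  filter_upwards [ENNReal.tendsto_nhds_zero.1 (hv α hα) 1 one_pos] with k hk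
  refine (hΦ.lintegral_enorm_le hT0 hT (μ.restrict K) hα hk).trans ?_
  rwa [Measure.restrict_apply_univ]

end LocalIntegrability

section Translation

variable {N : ℕ} {Φ : ℝ → ℝ}

lemma HasWeakGradient.congr_ae {u u' : EuclideanSpace ℝ (Fin N) → ℝ}
    {g g' : EuclideanSpace ℝ (Fin N) → EuclideanSpace ℝ (Fin N)} (h : HasWeakGradient u g)
    (hu : u =ᵐ[volume] u') (hg : g =ᵐ[volume] g') : HasWeakGradient u' g' := by
  refine ⟨h.1.congr hu, h.2.1.congr hg, fun φ hφ hφc i => ?_⟩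
  rw [integral_congr_ae (g := fun x => u x * fderiv ℝ φ x (EuclideanSpace.single i 1)),
    integral_congr_ae (f := fun x => g' x i * φ x) (g := fun x => g x i * φ x)]
  · exact h.2.2 φ hφ hφc i
  · filter_upwards [hg] with x hx
    rw [hx]
  · filter_upwards [hu] with x hx
    rw [hx]

lemma mollify_add_right {E : Type*} [NormedAddCommGroup E] [InnerProductSpace ℝ E]
    [FiniteDimensional ℝ E] [MeasurableSpace E] [BorelSpace E] (μ : Measure E)
    (φ : ContDiffBump (0 : E)) (f : E → ℝ) (z x : E) :
    mollify μ φ (fun y => f (y + z)) x = mollify μ φ f (x + z) := by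
  simp only [mollify, sub_add_eq_add_sub]

/-- If mollification at a fine scale moves `u` little in modular while `u` is large on a set of
non-negligible measure, then the mollification is large somewhere. -/
lemma IsNFunction.exists_lt_abs_of_lintegral_le {E : Type*} [MeasurableSpace E] {μ : Measure E}
    (hΦ : IsNFunction Φ) {u m : E → ℝ} (hu : Measurable u) (hm : Measurable m)
    {M : ℝ≥0∞} {r c δ : ℝ} (hr : 0 < r) (hrc : r ≤ c)
    (hM : ∫⁻ x, ENNReal.ofReal (Φ ((u x - m x) / r)) ∂μ ≤ M)
    (hδ : ENNReal.ofReal δ ≤ μ {x | 2 * c < |u x|})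
    (hsmall : ENNReal.ofReal (r / c) * M < ENNReal.ofReal (Φ 1) * ENNReal.ofReal δ) :
    ∃ x, c < |m x| := by
  by_contra! hle
  have hc : 0 < c := hr.trans_le hrc
  refine hsmall.not_ge ?_
  have hsub : {x | 2 * c < |u x|} ⊆
      {x | ENNReal.ofReal (Φ 1) ≤ ENNReal.ofReal (Φ ((u x - m x) / c))} := by
    intro x hx
    refine ENNReal.ofReal_le_ofReal ?_
    rw [← hΦ.apply_abs ((u x - m x) / c)]
    refine hΦ.mono zero_le_one ?_
    rw [abs_div, abs_of_pos hc, one_le_div hc]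
    have h1 := abs_sub_abs_le_abs_sub (u x) (m x)
    have h2 := hle x
    have h3 : 2 * c < |u x| := hx
    linarith
  calc ENNReal.ofReal (Φ 1) * ENNReal.ofReal δ
      ≤ ENNReal.ofReal (Φ 1) *
        μ {x | ENNReal.ofReal (Φ 1) ≤ ENNReal.ofReal (Φ ((u x - m x) / c))} := by
        gcongr
        exact hδ.trans (measure_mono hsub)
    _ ≤ ∫⁻ x, ENNReal.ofReal (Φ ((u x - m x) / c)) ∂μ :=
        mul_meas_ge_le_lintegral (hΦ.measurable_ofReal.comp ((hu.sub hm).div_const _)) _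
    _ ≤ ENNReal.ofReal (r / c) * M := hΦ.lintegral_apply_div_le μ _ hr hrc hM

lemma exists_int_norm_sub_le (x : EuclideanSpace ℝ (Fin N)) :
    ∃ z : EuclideanSpace ℝ (Fin N), (∀ i, ∃ a : ℤ, z i = (a : ℝ)) ∧ ‖x - z‖ ≤ √N := by
  refine ⟨WithLp.toLp 2 fun i => (⌊x i⌋ : ℝ), fun i => ⟨⌊x i⌋, rfl⟩, ?_⟩
  rw [EuclideanSpace.norm_eq]
  refine Real.sqrt_le_sqrt ?_
  calc ∑ i, ‖(x - WithLp.toLp 2 fun i => (⌊x i⌋ : ℝ)) i‖ ^ 2 ≤ ∑ _i : Fin N, (1 : ℝ) := by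
        refine Finset.sum_le_sum fun i _ => ?_
        refine pow_le_one₀ (norm_nonneg _) ?_
        change ‖x i - ⌊x i⌋‖ ≤ 1
        rw [Int.self_sub_floor, Real.norm_of_nonneg (Int.fract_nonneg _)]
        exact (Int.fract_lt_one _).le
    _ = N := by simp

end Translation

/-- A Lieb type result (Theorem 1.4): if `∫ Φ(|∇u_n|) ≤ M`, `(u_n)` is bounded in
`L^Φ(ℝ^N)` and `mes([|u_n| > ε]) ≥ δ` for all `n`, then there are integer translations
`(z_n) ⊂ ℤ^N` such that a subsequence of `v_n(x) = u_n(x + z_n)` converges in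
`L^Φ_loc(ℝ^N)` to a nontrivial limit. -/
theorem lieb_type (N : ℕ) (Φ : ℝ → ℝ) (hΦ : IsNFunction Φ) (hΦC1 : ContDiff ℝ 1 Φ)
    (u : ℕ → EuclideanSpace ℝ (Fin N) → ℝ)
    (g : ℕ → EuclideanSpace ℝ (Fin N) → EuclideanSpace ℝ (Fin N))
    (hweak : ∀ n, HasWeakGradient (u n) (g n))
    (M : ℝ) (hM : ∀ n, ∫⁻ x, ENNReal.ofReal (Φ ‖g n x‖) ≤ ENNReal.ofReal M)
    (C : ℝ≥0∞) (hC : C ≠ ⊤)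
    (hbdd : ∀ n, ∫⁻ x, ENNReal.ofReal (Φ |u n x|) ≤ C)
    (ε δ : ℝ) (hε : 0 < ε) (hδ : 0 < δ)
    (hmes : ∀ n, ENNReal.ofReal δ ≤ volume {x | ε < |u n x|}) :
    ∃ (z : ℕ → EuclideanSpace ℝ (Fin N)) (nk : ℕ → ℕ)
      (v : EuclideanSpace ℝ (Fin N) → ℝ),
      (∀ k i, ∃ a : ℤ, z k i = (a : ℝ)) ∧ StrictMono nk ∧ Measurable v ∧
      0 < volume {x | v x ≠ 0} ∧
      ∀ K : Set (EuclideanSpace ℝ (Fin N)), IsCompact K → ∀ α > (0:ℝ),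
        Tendsto (fun k => ∫⁻ x in K,
          ENNReal.ofReal (Φ (|u (nk k) (x + z k) - v x| / α))) atTop (𝓝 0) := by
  choose u' hum huae using fun n => (⟨_, (hweak n).1.aestronglyMeasurable.measurable_mk,
    (hweak n).1.aestronglyMeasurable.ae_eq_mk⟩ :
      ∃ w : EuclideanSpace ℝ (Fin N) → ℝ, Measurable w ∧ u n =ᵐ[volume] w)
  choose g' hgm hgae using fun n => (⟨_, (hweak n).2.1.aestronglyMeasurable.measurable_mk,
    (hweak n).2.1.aestronglyMeasurable.ae_eq_mk⟩ :
      ∃ w : EuclideanSpace ℝ (Fin N) → EuclideanSpace ℝ (Fin N),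
        Measurable w ∧ g n =ᵐ[volume] w)
  have hweak' : ∀ n, HasWeakGradient (u' n) (g' n) :=
    fun n => (hweak n).congr_ae (huae n) (hgae n)
  have hM' : ∀ n, ∫⁻ x, ENNReal.ofReal (Φ ‖g' n x‖) ≤ ENNReal.ofReal M := by
    refine fun n => le_trans (lintegral_congr_ae ?_).le (hM n)
    filter_upwards [hgae n] with x hx
    rw [hx]
  have hbdd' : ∀ n, ∫⁻ x, ENNReal.ofReal (Φ (u' n x)) ≤ C := by
    refine fun n => le_trans (lintegral_congr_ae ?_).le (hbdd n)
    filter_upwards [huae n] with x hx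
    rw [hx, hΦ.apply_abs]
  have hmes' : ∀ n, ENNReal.ofReal δ ≤ volume {x | 2 * (ε / 2) < |u' n x|} := by
    refine fun n => (hmes n).trans (measure_congr ?_).le
    filter_upwards [huae n] with x hx
    change (ε < |u n x|) = (2 * (ε / 2) < |u' n x|)
    rw [hx, mul_div_cancel₀ _ two_ne_zero]
  have hmoll : ∀ n j, ∫⁻ x, ENNReal.ofReal (Φ ((u' n x -
      mollify volume (dyadicBump (EuclideanSpace ℝ (Fin N)) j) (u' n) x) /
      (dyadicBump (EuclideanSpace ℝ (Fin N)) j).rOut)) ≤ ENNReal.ofReal M := fun n j =>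
    hΦ.lintegral_apply_sub_mollify_le (hweak' n) (hum n) (hgm n) (hM' n) _
  have hε2 : 0 < ε / 2 := half_pos hε
  obtain ⟨j, hjε, hjδ⟩ : ∃ j, (dyadicBump (EuclideanSpace ℝ (Fin N)) j).rOut ≤ ε / 2 ∧
      ENNReal.ofReal ((dyadicBump (EuclideanSpace ℝ (Fin N)) j).rOut / (ε / 2)) *
        ENNReal.ofReal M < ENNReal.ofReal (Φ 1) * ENNReal.ofReal δ := by
    have hr := tendsto_dyadicBump_rOut (EuclideanSpace ℝ (Fin N))
    have hlim := ENNReal.Tendsto.mul_const (b := ENNReal.ofReal M)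
      (ENNReal.tendsto_ofReal (hr.div_const (ε / 2))) (Or.inr ENNReal.ofReal_ne_top)
    rw [zero_div, ENNReal.ofReal_zero, zero_mul] at hlim
    refine ((hr.eventually (ge_mem_nhds hε2)).and (hlim.eventually (gt_mem_nhds ?_))).exists
    exact ENNReal.mul_pos (ENNReal.ofReal_pos.2 (hΦ.apply_pos one_ne_zero)).ne'
      (ENNReal.ofReal_pos.2 hδ).ne'
  set φ := dyadicBump (EuclideanSpace ℝ (Fin N)) j
  choose x hx using fun n => hΦ.exists_lt_abs_of_lintegral_le (hum n)
    (continuous_mollify volume φ (hweak' n).1).measurable φ.rOut_pos hjε (hmoll n j) (hmes' n) hjδ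
  choose z hz hxz using fun n => exists_int_norm_sub_le (x n)
  set v : ℕ → EuclideanSpace ℝ (Fin N) → ℝ := fun n y => u' n (y + z n) with hv
  have hvm : ∀ n, Measurable (v n) := fun n => (hum n).comp (measurable_add_const _)
  have hvC : ∀ n, ∫⁻ y, ENNReal.ofReal (Φ (v n y)) ≤ C := fun n =>
    (lintegral_add_right_eq_self (fun y => ENNReal.ofReal (Φ (u' n y))) (z n)).trans_le (hbdd' n)
  have hvl : ∀ n, LocallyIntegrable (v n) volume := fun n =>
    hΦ.locallyIntegrable (hvm n) hC (hvC n)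
  obtain ⟨nk, v₀, hnk, hv₀m, hlim⟩ := exists_subseq_tendsto_lintegral hΦ hvm hvl hC
    (ENNReal.ofReal_ne_top (r := M)) hvC fun n i => by
      simp only [hv, mollify_add_right]
      exact (lintegral_add_right_eq_self (fun y => ENNReal.ofReal (Φ ((u' n y -
        mollify volume (dyadicBump (EuclideanSpace ℝ (Fin N)) i) (u' n) y) /
        (dyadicBump (EuclideanSpace ℝ (Fin N)) i).rOut))) (z n)).trans_le (hmoll n i)
  refine ⟨fun k => z (nk k), nk, v₀, fun k i => hz (nk k) i, hnk, hv₀m, ?_, fun K hK α hα => ?_⟩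
  · rw [pos_iff_ne_zero]
    intro hzero
    have hv₀ : ∀ᵐ y, v₀ y = 0 := hzero
    set K := Metric.closedBall (0 : EuclideanSpace ℝ (Fin N)) (√N + φ.rOut)
    have hK : IsCompact K := isCompact_closedBall _ _
    have hmean : Tendsto (fun k => ∫⁻ y in K, ‖v (nk k) y‖ₑ) atTop (𝓝 0) := by
      refine hΦ.tendsto_setLIntegral_enorm hK.measure_lt_top.ne fun α hα => ?_
      refine (hlim K hK α hα).congr fun k => lintegral_congr_ae ?_
      filter_upwards [ae_restrict_of_ae hv₀] with y hy
      rw [hy, sub_zero]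
    obtain ⟨B, hB0, hB⟩ := exists_abs_mollify_le volume φ
    have hint : Tendsto (fun k => B * ∫ y in K, |v (nk k) y|) atTop (𝓝 0) := by
      have h := ((ENNReal.tendsto_toReal ENNReal.zero_ne_top).comp hmean).const_mul B
      rw [ENNReal.toReal_zero, mul_zero] at h
      refine h.congr fun k => ?_
      simp only [← Real.norm_eq_abs]
      rw [integral_norm_eq_lintegral_enorm (hvm _).aestronglyMeasurable]
      rfl
    obtain ⟨k, hk⟩ := (hint.eventually (gt_mem_nhds hε2)).exists
    refine hk.not_ge ((hx (nk k)).le.trans ?_)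
    have hmx := hB _ (hvl (nk k)) (x (nk k) - z (nk k))
    rw [hv, mollify_add_right, sub_add_cancel] at hmx
    refine hmx.trans (mul_le_mul_of_nonneg_left ?_ hB0)
    refine setIntegral_mono_set ((hvl (nk k)).integrableOn_isCompact hK).abs
      (Eventually.of_forall fun y => abs_nonneg _) (LE.le.eventuallyLE ?_)
    refine Metric.closedBall_subset_closedBall' ?_
    rw [dist_zero_right, add_comm]
    gcongr
    exact hxz _
  · refine (hlim K hK α hα).congr fun k => lintegral_congr_ae (ae_restrict_of_ae ?_)
    filter_upwards [(measurePreserving_add_right volume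
      (z (nk k))).quasiMeasurePreserving.ae (huae (nk k))] with y hy
    rw [hy, ← hΦ.apply_abs, abs_div, abs_of_pos hα]
end
end
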